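/- arXiv:2009.04492 — 4 statements merged into one kernel-verified Lean document; each statement's English description precedes it below -/
import Mathlib

section
/- Let f : ℝ → ℂ be a bounded continuous function with f(0) = 1, and let K_f denote its modified Cauchy transform. Then f is a characteristic function (i.e., f(x) = ∫ℝ e^{ixt} dσ(t) for some probability measure σ on ℝ) if and only if there exists a constant a_f ∈ ℝ such that: (i) the function y ↦ a_f + K_f(iy) is real-valued and completely monotonic on (0, ∞), and (ii) the function y ↦ −(a_f + K_f(iy)) is real-valued and absolutely monotonic on (−∞, 0). -/
open MeasureTheory Complex Set
open scoped ENNReal ComplexOrder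

noncomputable def cauchyTransform (f : ℝ → ℂ) (z : ℂ) : ℂ :=
  (Complex.I / (Real.pi : ℂ)) * ∫ t : ℝ, f t / (z - (t : ℂ))

noncomputable def modCauchyTransform (f : ℝ → ℂ) (z : ℂ) : ℂ :=
  (Complex.I / (Real.pi : ℂ)) *
    ∫ t : ℝ, (1 / (z - (t : ℂ)) + (t : ℂ) / ((t : ℂ) ^ 2 + 1)) * f t

def CompletelyMonotonicOn (ω : ℝ → ℝ) (s : Set ℝ) : Prop :=
  ContDiffOn ℝ (⊤ : ℕ∞) ω s ∧ ∀ (n : ℕ), ∀ x ∈ s, 0 ≤ (-1 : ℝ) ^ n * iteratedDeriv n ω x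

def AbsolutelyMonotonicOn (ω : ℝ → ℝ) (s : Set ℝ) : Prop :=
  ContDiffOn ℝ (⊤ : ℕ∞) ω s ∧ ∀ (n : ℕ), ∀ x ∈ s, 0 ≤ iteratedDeriv n ω x

def IsCharFun (f : ℝ → ℂ) : Prop :=
  ∃ σ : Measure ℝ, IsProbabilityMeasure σ ∧
    ∀ x : ℝ, f x = ∫ t : ℝ, Complex.exp (Complex.I * x * t) ∂σ


namespace CFProof
section
open Filter Topology

lemma levy_prob (μ : ℕ → Measure ℝ) [∀ n, IsProbabilityMeasure (μ n)] (φ : ℝ → ℂ)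
    (hφ : ContinuousAt φ 0)
    (h : ∀ t, Tendsto (fun n => charFun (μ n) t) atTop (𝓝 (φ t))) :
    ∃ ν : Measure ℝ, IsProbabilityMeasure ν ∧ ∀ t, charFun ν t = φ t := by
  have ht := isTightMeasureSet_of_tendsto_charFun hφ h
  let P : ℕ → ProbabilityMeasure ℝ := fun n => ⟨μ n, inferInstance⟩
  have h_compact : IsCompact (closure (Set.range P)) := by
    apply isCompact_closure_of_isTightMeasureSet
    convert ht using 1
    ext x
    constructor
    · rintro ⟨_, ⟨n, rfl⟩, rfl⟩
      exact ⟨n, rfl⟩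
    · rintro ⟨n, rfl⟩
      exact ⟨P n, ⟨n, rfl⟩, rfl⟩
  let U : Ultrafilter ℕ := Ultrafilter.of atTop
  have hU : (U : Filter ℕ) ≤ atTop := Ultrafilter.of_le atTop
  obtain ⟨ν, -, hν⟩ := h_compact.ultrafilter_le_nhds (U.map P)
    (le_trans (by simp [Ultrafilter.coe_map]) (monotone_principal subset_closure))
  have hν' : Tendsto P U (𝓝 ν) := hν
  rw [ProbabilityMeasure.tendsto_iff_forall_integral_rclike_tendsto ℂ] at hν'
  refine ⟨ν, inferInstance, fun t => ?_⟩
  have h1 := hν' (BoundedContinuousFunction.innerProbChar t)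
  simp_rw [← charFun_eq_integral_innerProbChar] at h1
  exact tendsto_nhds_unique h1 ((h t).mono_left hU)

lemma charFun_smul' (c : ENNReal) (μ : Measure ℝ) (t : ℝ) :
    charFun (c • μ) t = c.toReal * charFun μ t := by
  simp [charFun_apply_real, integral_smul_measure]

lemma charFun_add' (μ ν : Measure ℝ) [IsFiniteMeasure μ] [IsFiniteMeasure ν] (t : ℝ) :
    charFun (μ + ν) t = charFun μ t + charFun ν t := by
  have : ∀ (ρ : Measure ℝ) [IsFiniteMeasure ρ], Integrable (fun x : ℝ => cexp (t * x * I)) ρ := by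
    intro ρ _
    refine Integrable.of_bound (C := 1) (by fun_prop) (ae_of_all _ fun x => ?_)
    rw [← ofReal_mul, norm_exp_ofReal_mul_I]
  simp only [charFun_apply_real]
  exact integral_add_measure (this μ) (this ν)

lemma levy_fin (μ : ℕ → Measure ℝ) [∀ n, IsFiniteMeasure (μ n)] (φ : ℝ → ℂ)
    (hφ : ContinuousAt φ 0)
    (h : ∀ t, Tendsto (fun n => charFun (μ n) t) atTop (𝓝 (φ t))) :
    ∃ ν : Measure ℝ, IsFiniteMeasure ν ∧ ∀ t, charFun ν t = φ t := by
  have h00 := h 0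
  simp only [charFun_zero] at h00
  have hre : Tendsto (fun n => (μ n).real Set.univ) atTop (𝓝 (φ 0).re) := by
    simpa [Function.comp_def] using (continuous_re.tendsto _).comp h00
  have him : (φ 0).im = 0 := by
    have := (continuous_im.tendsto _).comp h00
    simp only [Function.comp_def, ofReal_im] at this
    exact (tendsto_nhds_unique this tendsto_const_nhds)
  have hφ0 : φ 0 = ((φ 0).re : ℂ) := by
    apply Complex.ext <;> simp [him]
  have hnn : 0 ≤ (φ 0).re := ge_of_tendsto' hre fun n => measureReal_nonneg
  rcases hnn.eq_or_lt with h0 | hpos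
  · refine ⟨0, inferInstance, fun t => ?_⟩
    have : Tendsto (fun n => charFun (μ n) t) atTop (𝓝 0) := by
      rw [← h0] at hre
      exact squeeze_zero_norm (fun n => norm_charFun_le t) hre
    rw [charFun_zero_measure, tendsto_nhds_unique (h t) this]
  · obtain ⟨N, hN⟩ := eventually_atTop.1 (hre.eventually (lt_mem_nhds hpos))
    have hne : ∀ n, μ (n + N) ≠ 0 := by
      intro n hn
      have := hN (n + N) (by omega)
      simp [hn] at this
    have : ∀ n, NeZero (μ (n + N)) := fun n => ⟨hne n⟩
    let m : ℕ → Measure ℝ := fun n => (μ (n+N) Set.univ)⁻¹ • μ (n+N)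
    have : ∀ n, IsProbabilityMeasure (m n) := fun n => isProbabilityMeasureSMul
    obtain ⟨ν, hν, hν'⟩ := levy_prob m (fun t => ((φ 0).re : ℂ)⁻¹ * φ t) (by fun_prop) (by
      intro t
      have e : ∀ n, charFun (m n) t = (((μ (n+N)).real Set.univ : ℝ) : ℂ)⁻¹ * charFun (μ (n+N)) t := by
        intro n
        rw [charFun_smul']
        simp [Measure.real]
      simp_rw [e]
      refine Tendsto.mul (Tendsto.inv₀ ?_ ?_) ?_
      · have := (h00.comp (tendsto_add_atTop_nat N))
        rw [hφ0] at this
        exact this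
      · exact_mod_cast hpos.ne'
      · exact (h t).comp (tendsto_add_atTop_nat N))
    refine ⟨ENNReal.ofReal (φ 0).re • ν, ?_, fun t => ?_⟩
    · exact Measure.smul_finite ν ENNReal.ofReal_ne_top
    · rw [charFun_smul', hν', ENNReal.toReal_ofReal hnn, mul_inv_cancel_left₀]
      exact_mod_cast hpos.ne'

/-- iterated derivatives along the real axis -/
lemma iter_real (G : ℂ → ℂ) (hG : DifferentiableOn ℂ G {p | 0 < p.re})
    (him : ∀ y : ℝ, 0 < y → (G y).im = 0) (n : ℕ) :
    ∀ y : ℝ, 0 < y → iteratedDeriv n G y = ((iteratedDeriv n (fun y : ℝ => (G y).re) y : ℝ) : ℂ) := by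
  have hopen : IsOpen {p : ℂ | 0 < p.re} := isOpen_lt continuous_const continuous_re
  have hdiff : ∀ n, DifferentiableOn ℂ (iteratedDeriv n G) {p | 0 < p.re} := by
    intro n
    induction n with
    | zero => simpa [iteratedDeriv_zero] using hG
    | succ n ih => rw [iteratedDeriv_succ]; exact ih.deriv hopen
  induction n with
  | zero => intro y hy; apply Complex.ext <;> simp [him y hy]
  | succ n ih =>
    intro y hy
    have hd : HasDerivAt (iteratedDeriv n G) (iteratedDeriv (n+1) G y) (y : ℂ) := by
      rw [iteratedDeriv_succ]
      exact ((hdiff n).differentiableAt (hopen.mem_nhds (by simpa using hy))).hasDerivAt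
    have hd1 := hd.comp_ofReal
    have hev : (fun x : ℝ => iteratedDeriv n G x) =ᶠ[𝓝 y]
        fun x : ℝ => ((iteratedDeriv n (fun y : ℝ => (G y).re) x : ℝ) : ℂ) := by
      filter_upwards [lt_mem_nhds hy] with x hx using ih x hx
    have hd2 := hd1.congr_of_eventuallyEq hev.symm
    have hd3 : HasDerivAt (iteratedDeriv n (fun y : ℝ => (G y).re))
        (iteratedDeriv (n+1) G y).re y := by
      have := (hasFDerivAt_id (𝕜 := ℝ) (0:ℂ))
      have h4 := (reCLM.hasFDerivAt (x := ((iteratedDeriv n (fun y : ℝ => (G y).re) y : ℝ) : ℂ))).comp_hasDerivAt y hd2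
      simpa [Function.comp_def] using h4
    have h5 : HasDerivAt (fun x : ℝ => (((iteratedDeriv n (fun y : ℝ => (G y).re) x : ℝ)) : ℂ))
        ((iteratedDeriv (n+1) G y).re : ℂ) y := hd3.ofReal_comp
    rw [iteratedDeriv_succ (f := fun y : ℝ => (G y).re), hd3.deriv]
    exact hd2.unique h5

lemma _root_.HasSum.congr_fun' {u v : ℕ → ℂ} {s : ℂ} (h : HasSum u s) (e : ∀ n, v n = u n) :
    HasSum v s := by
  rwa [funext e]

/-- Feller's discretization. -/
lemma discr (G : ℂ → ℂ) (hG : DifferentiableOn ℂ G {p | 0 < p.re})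
    (him : ∀ y : ℝ, 0 < y → (G y).im = 0)
    (hcm : ∀ (n : ℕ) (y : ℝ), 0 < y → 0 ≤ (-1 : ℝ) ^ n * iteratedDeriv n (fun y : ℝ => (G y).re) y)
    (Y y : ℝ) (hY : 0 < Y) (hy : 0 < y) :
    ∃ m : Measure ℝ, IsFiniteMeasure m ∧
      ∀ x : ℝ, charFun m x = G (Y * (1 - cexp (-(y - x * I) / Y))) := by
  have hball : ∀ x : ℝ, (Y * (1 - cexp (-(y - x * I) / Y)) : ℂ) ∈ Metric.ball (Y : ℂ) Y := by
    intro x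
    rw [mem_ball_iff_norm]
    have : (Y * (1 - cexp (-(y - x * I) / Y)) : ℂ) - Y = - (Y * cexp (-(y - x * I) / Y)) := by ring
    rw [this, norm_neg, norm_mul, norm_exp, norm_real, Real.norm_of_nonneg hY.le]
    have h2 : (-(y - x * I) / Y : ℂ).re = - y / Y := by
      rw [div_ofReal_re]; simp
    rw [h2]
    have : Real.exp (-y / Y) < 1 := by
      rw [Real.exp_lt_one_iff]
      exact div_neg_of_neg_of_pos (by linarith) hY
    nlinarith
  have hsub : Metric.ball (Y : ℂ) Y ⊆ {p | 0 < p.re} := by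
    intro p hp
    rw [mem_ball_iff_norm] at hp
    have h1 := (abs_re_le_norm (p - Y)).trans_lt hp
    rw [abs_lt] at h1
    simp at h1
    exact h1.1
  set w : ℕ → ℝ := fun n => (n.factorial : ℝ)⁻¹ *
    ((-1 : ℝ) ^ n * iteratedDeriv n (fun y : ℝ => (G y).re) Y) * Y ^ n * Real.exp (-(n * y) / Y) with hw
  have hw0 : ∀ n, 0 ≤ w n := fun n => by
    have := hcm n Y hY
    positivity
  have key : ∀ x : ℝ, HasSum (fun n : ℕ => (w n : ℂ) * cexp (x * (n / Y : ℝ) * I))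
      (G (Y * (1 - cexp (-(y - x * I) / Y)))) := by
    intro x
    have := Complex.hasSum_taylorSeries_on_ball (hG.mono hsub) (hball x)
    refine this.congr_fun' fun n => ?_
    rw [iter_real G hG him n Y hY, hw]
    have e1 : (Y * (1 - cexp (-(y - x * I) / Y)) : ℂ) - Y = (-1) * (Y * cexp (-(y - x * I) / Y)) := by ring
    rw [e1, mul_pow, mul_pow, ← Complex.exp_nat_mul]
    have e2 : (n : ℂ) * (-(y - x * I) / Y) = (-(n * y) / Y) + (x * (n / Y : ℝ) * I) := by
      push_cast; ring
    rw [e2, Complex.exp_add]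
    push_cast
    simp only [smul_eq_mul]
    ring
  have hws : Summable w := by
    have := (key 0).summable
    simp only [ofReal_zero, zero_mul, Complex.exp_zero, mul_one] at this
    exact_mod_cast this
  let m : Measure ℝ := Measure.sum fun n : ℕ => ENNReal.ofReal (w n) • Measure.dirac ((n : ℝ) / Y)
  have hm : IsFiniteMeasure m := by
    constructor
    simp only [m, Measure.sum_apply _ MeasurableSet.univ, Measure.smul_apply, measure_univ,
      smul_eq_mul, mul_one]
    rw [← ENNReal.ofReal_tsum_of_nonneg hw0 hws]
    exact ENNReal.ofReal_lt_top
  refine ⟨m, hm, fun x => ?_⟩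
  have hint : Integrable (fun t : ℝ => cexp (x * t * I)) m := by
    refine Integrable.of_bound (C := 1) (by fun_prop) (ae_of_all _ fun t => ?_)
    rw [← ofReal_mul, norm_exp_ofReal_mul_I]
  have h1 := hasSum_integral_measure hint
  rw [charFun_apply_real]
  refine h1.unique ?_
  refine (key x).congr_fun' fun n => ?_
  rw [integral_smul_measure, integral_dirac, ENNReal.toReal_ofReal (hw0 n)]
  simp

lemma tendsto_discr (p : ℂ) :
    Tendsto (fun n : ℕ => (((n : ℝ) + 1 : ℝ) : ℂ) * (1 - cexp (-p / ((n : ℝ) + 1 : ℝ)))) atTop (𝓝 p) := by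
  have hd : HasDerivAt (fun s : ℂ => 1 - cexp (-p * s)) p 0 := by
    have := (((hasDerivAt_id (0:ℂ)).const_mul (-p)).cexp).const_sub 1
    simpa using this
  have h2 := hd.tendsto_slope_zero
  have h3 : Tendsto (fun n : ℕ => (((n : ℝ) + 1 : ℝ) : ℂ)⁻¹) atTop (𝓝[≠] 0) := by
    rw [tendsto_nhdsWithin_iff]
    constructor
    · have := tendsto_one_div_add_atTop_nhds_zero_nat (𝕜 := ℂ)
      simpa using this
    · refine Eventually.of_forall fun n => ?_
      have : ((n : ℝ) + 1 : ℝ) ≠ 0 := by positivity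
      simp only [mem_compl_iff, mem_singleton_iff, inv_eq_zero]
      exact_mod_cast this
  have h4 := h2.comp h3
  refine h4.congr fun n => ?_
  simp [div_eq_mul_inv]

lemma charFun_of_cm (G : ℂ → ℂ) (hG : DifferentiableOn ℂ G {p | 0 < p.re})
    (him : ∀ y : ℝ, 0 < y → (G y).im = 0)
    (hcm : ∀ (n : ℕ) (y : ℝ), 0 < y → 0 ≤ (-1 : ℝ) ^ n * iteratedDeriv n (fun y : ℝ => (G y).re) y)
    (y : ℝ) (hy : 0 < y) :
    ∃ m : Measure ℝ, IsFiniteMeasure m ∧ ∀ x : ℝ, charFun m x = G (y - x * I) := by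
  have hopen : IsOpen {p : ℂ | 0 < p.re} := isOpen_lt continuous_const continuous_re
  have H := fun n : ℕ => discr G hG him hcm ((n : ℝ) + 1) y (by positivity) hy
  choose m hm hm' using H
  refine levy_fin m _ ?_ fun x => ?_
  · have : ContinuousAt G ((y : ℂ) - (0:ℝ) * I) :=
      (hG.continuousOn).continuousAt (hopen.mem_nhds (by simpa using hy))
    exact ContinuousAt.comp (f := fun x : ℝ => (y - x * I : ℂ)) this (by fun_prop)
  · simp_rw [hm']
    have : ContinuousAt G ((y : ℂ) - x * I) :=
      (hG.continuousOn).continuousAt (hopen.mem_nhds (by simpa using hy))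
    exact this.tendsto.comp (tendsto_discr _)

end
end CFProof

namespace CFProof
section
open Filter Topology

/-- the modified Cauchy kernel -/
noncomputable def ker (z : ℂ) (t : ℝ) : ℂ := 1 / (z - (t : ℂ)) + (t : ℂ) / ((t : ℂ) ^ 2 + 1)

lemma sub_ne {z : ℂ} (hz : z.im ≠ 0) (t : ℝ) : z - t ≠ 0 := by
  intro h
  apply hz
  have := congrArg Complex.im h
  simpa using this

lemma sq_ne (t : ℝ) : ((t : ℂ) ^ 2 + 1) ≠ 0 := by
  have : (t ^ 2 + 1 : ℝ) ≠ 0 := by positivity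
  exact_mod_cast this

lemma ker_eq {z : ℂ} (hz : z.im ≠ 0) (t : ℝ) :
    ker z t = (-z + (1 + z ^ 2) / (z - t)) * (((1 + t ^ 2)⁻¹ : ℝ) : ℂ) := by
  have h1 := sub_ne hz t
  have h2 := sq_ne t
  have h3 : (1 + (t : ℂ) ^ 2) ≠ 0 := by rwa [add_comm]
  rw [ker]
  push_cast
  field_simp
  ring

lemma norm_inv_sub_le {z : ℂ} {δ : ℝ} (hδ : 0 < δ) (hz : δ ≤ |z.im|) (t : ℝ) :
    ‖(z - t)⁻¹‖ ≤ δ⁻¹ := by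
  rw [norm_inv]
  apply inv_anti₀ hδ
  refine hz.trans ?_
  have := abs_im_le_norm (z - t)
  simpa using this

lemma norm_ker_le {z : ℂ} (hz : z.im ≠ 0) (t : ℝ) :
    ‖ker z t‖ ≤ (‖z‖ + ‖1 + z ^ 2‖ * |z.im|⁻¹) * (1 + t ^ 2)⁻¹ := by
  rw [ker_eq hz, norm_mul, norm_real, Real.norm_of_nonneg (by positivity : 0 ≤ (1 + t ^ 2)⁻¹)]
  gcongr
  refine (norm_add_le _ _).trans ?_
  rw [norm_neg, div_eq_mul_inv, norm_mul]
  gcongr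
  exact norm_inv_sub_le (abs_pos.2 hz) le_rfl t

lemma continuous_ker {z : ℂ} (hz : z.im ≠ 0) : Continuous (ker z) := by
  unfold ker
  refine Continuous.add ?_ ?_
  · exact Continuous.div (by fun_prop) (by fun_prop) (sub_ne hz)
  · exact Continuous.div (by fun_prop) (by fun_prop) sq_ne

lemma integrable_ker {z : ℂ} (hz : z.im ≠ 0) : Integrable (ker z) := by
  refine Integrable.mono' (integrable_inv_one_add_sq.const_mul _)
    (continuous_ker hz).aestronglyMeasurable (ae_of_all _ (norm_ker_le hz))


lemma integrable_ker_mul {f : ℝ → ℂ} (hc : Continuous f) (hb : ∃ M : ℝ, ∀ x : ℝ, ‖f x‖ ≤ M)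
    {z : ℂ} (hz : z.im ≠ 0) : Integrable (fun t => ker z t * f t) := by
  obtain ⟨M, hM⟩ := hb
  exact (integrable_ker hz).mul_bdd hc.aestronglyMeasurable (ae_of_all _ hM)

lemma mct_eq (f : ℝ → ℂ) (z : ℂ) :
    modCauchyTransform f z = (I / (Real.pi : ℂ)) * ∫ t : ℝ, ker z t * f t := rfl

lemma differentiable_mct {f : ℝ → ℂ} (hc : Continuous f) (hb : ∃ M : ℝ, ∀ x : ℝ, ‖f x‖ ≤ M)
    : DifferentiableOn ℂ (modCauchyTransform f) {z | 0 < z.im} := by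
  intro z hz
  apply DifferentiableAt.differentiableWithinAt
  simp only [mem_ofPred_eq] at hz
  have hs : {w : ℂ | z.im / 2 < w.im} ∩ Metric.ball z 1 ∈ 𝓝 z := by
    refine inter_mem ((isOpen_lt continuous_const continuous_im).mem_nhds ?_)
      (Metric.ball_mem_nhds _ one_pos)
    simp only [mem_ofPred_eq]; linarith
  obtain ⟨M, hM⟩ := hb
  have hM0 : 0 ≤ M := (norm_nonneg _).trans (hM 0)
  set R : ℝ := ‖z‖ + 1 with hR
  set δ : ℝ := z.im / 2 with hδ
  have hδ0 : 0 < δ := by positivity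
  have hfi : Integrable (fun t : ℝ => (((1 + t ^ 2)⁻¹ : ℝ) : ℂ) * f t) :=
    (integrable_inv_one_add_sq.ofReal).mul_bdd hc.aestronglyMeasurable (ae_of_all _ hM)
  have H := hasDerivAt_integral_of_dominated_loc_of_deriv_le (μ := volume) (𝕜 := ℂ)
    (bound := fun t => (1 + (2 * R * δ⁻¹ + (1 + R ^ 2) * (δ⁻¹) ^ 2)) * ((1 + t ^ 2)⁻¹ * M))
    (F := fun w t => ker w t * f t) (x₀ := z)
    (F' := fun w t => (-1 + (2 * w * (w - t)⁻¹ - (1 + w ^ 2) * ((w - t)⁻¹) ^ 2)) *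
      ((((1 + t ^ 2)⁻¹ : ℝ) : ℂ) * f t)) hs ?_ (integrable_ker_mul hc ⟨M, hM⟩ hz.ne') ?_ ?_ ?_ ?_
  · have := H.2.differentiableAt
    have h2 := this.const_mul (I / (Real.pi : ℂ))
    exact h2
  · filter_upwards [(isOpen_lt continuous_const continuous_im).mem_nhds hz] with w hw
    exact (integrable_ker_mul hc ⟨M, hM⟩ (ne_of_gt hw)).aestronglyMeasurable
  · refine AEStronglyMeasurable.mul ?_ hfi.aestronglyMeasurable
    refine Continuous.aestronglyMeasurable ?_
    have : Continuous fun t : ℝ => (z - t)⁻¹ := Continuous.inv₀ (by fun_prop) (sub_ne hz.ne')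
    fun_prop
  · refine ae_of_all _ fun t w hw => ?_
    have hw1 : δ ≤ |w.im| := hw.1.le.trans (le_abs_self _)
    have hw2 : ‖w‖ ≤ R := by
      have := hw.2
      rw [mem_ball_iff_norm] at this
      have h3 := norm_add_le (w - z) z
      simp only [sub_add_cancel] at h3
      linarith
    have hi := norm_inv_sub_le hδ0 hw1 t
    have hi0 := norm_nonneg (w - t : ℂ)⁻¹
    rw [norm_mul, norm_mul, norm_real, Real.norm_of_nonneg (by positivity : 0 ≤ (1 + t ^ 2)⁻¹)]
    gcongr
    · refine (norm_add_le _ _).trans ?_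
      rw [norm_neg, norm_one]
      gcongr
      refine (norm_sub_le _ _).trans ?_
      rw [norm_mul, norm_mul, norm_mul, norm_pow]
      have h4 : ‖1 + w ^ 2‖ ≤ 1 + R ^ 2 := by
        refine (norm_add_le _ _).trans ?_
        rw [norm_one, norm_pow]
        gcongr
      have h2 : ‖(2:ℂ)‖ = 2 := by simp
      rw [h2]
      gcongr
    · exact hM t
  · exact (integrable_inv_one_add_sq.mul_const M).const_mul _
  · refine ae_of_all _ fun t w hw => ?_
    have hwi : w.im ≠ 0 := by
      have := hw.1
      simp only [mem_ofPred_eq] at this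
      linarith
    have hne := sub_ne hwi t
    have hd : HasDerivAt (fun w : ℂ => -w + (1 + w ^ 2) * (w - t)⁻¹)
        (-1 + (2 * w * (w - t)⁻¹ - (1 + w ^ 2) * ((w - t)⁻¹) ^ 2)) w := by
      have h1 : HasDerivAt (fun w : ℂ => (w - t)⁻¹) (-1 / (w - t) ^ 2) w :=
        ((hasDerivAt_id w).sub_const (t : ℂ)).inv hne
      have h2 : HasDerivAt (fun w : ℂ => 1 + w ^ 2) (2 * w) w := by
        simpa using ((hasDerivAt_id w).pow 2).const_add 1
      have h3 := (hasDerivAt_id w).neg.add (h2.mul h1)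
      convert! h3 using 1
      field_simp
      ring
    have h4 := hd.mul_const ((((1 + t ^ 2)⁻¹ : ℝ) : ℂ) * f t)
    refine h4.congr_of_eventuallyEq ?_
    have : {w : ℂ | w.im ≠ 0} ∈ 𝓝 w := (isOpen_ne_fun continuous_im continuous_const).mem_nhds hwi
    filter_upwards [this] with u hu
    rw [ker_eq hu, div_eq_mul_inv]
    ring

lemma mct_neg (f : ℝ → ℂ) (z : ℂ) :
    modCauchyTransform f (-z) = - modCauchyTransform (fun t => f (-t)) z := by
  rw [mct_eq, mct_eq, ← mul_neg, ← integral_neg,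
    ← integral_neg_eq_self (fun t => ker (-z) t * f t)]
  congr 1
  refine integral_congr_ae (ae_of_all _ fun t => ?_)
  simp only [ker]
  push_cast
  have h : -z - -(t : ℂ) = - (z - t) := by ring
  rw [h]
  simp only [one_div, inv_neg, even_two, Even.neg_pow, neg_div]
  ring

/-- Poisson integral -/
noncomputable def poi (f : ℝ → ℂ) (y x : ℝ) : ℂ :=
  (Real.pi : ℂ)⁻¹ * ∫ s : ℝ, (((1 + s ^ 2)⁻¹ : ℝ) : ℂ) * f (x + y * s)

lemma mct_sub {f : ℝ → ℂ} (hc : Continuous f) (hb : ∃ M : ℝ, ∀ x : ℝ, ‖f x‖ ≤ M)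
    (x y : ℝ) (hy : 0 < y) :
    modCauchyTransform f (x + y * I) - modCauchyTransform f (x - y * I) = 2 * poi f y x := by
  have hz1 : (x + y * I : ℂ).im ≠ 0 := by simpa using hy.ne'
  have hz2 : (x - y * I : ℂ).im ≠ 0 := by simpa using hy.ne'
  rw [mct_eq, mct_eq, ← mul_sub, ← integral_sub (integrable_ker_mul hc hb hz1)
    (integrable_ker_mul hc hb hz2)]
  have e1 : ∫ t, (ker (x + y * I) t * f t - ker (x - y * I) t * f t) =
      y * ∫ s : ℝ, (ker (x + y * I) (x + y * s) * f (x + y * s) - ker (x - y * I) (x + y * s) * f (x + y * s)) := by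
    set g : ℝ → ℂ := fun t => ker (x + y * I) t * f t - ker (x - y * I) t * f t with hg
    have h1 := Measure.integral_comp_mul_left (fun u => g (x + u)) y
    have h2 := integral_add_left_eq_self g x (μ := volume)
    rw [h2] at h1
    have h3 : ∫ s : ℝ, (ker (x + y * I) (x + y * s : ℝ) * f (x + y * s) - ker (x - y * I) (x + y * s : ℝ) * f (x + y * s)) = ∫ s, g (x + y * s) := rfl
    rw [h3, h1, abs_of_pos (by positivity), real_smul]
    have : (y : ℂ) ≠ 0 := by exact_mod_cast hy.ne'
    push_cast
    field_simp
  rw [e1, poi, ← integral_const_mul, ← integral_const_mul, ← integral_const_mul,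
    ← integral_const_mul]
  refine integral_congr_ae (ae_of_all _ fun s => ?_)
  simp only [ker]
  have hyc : (y : ℂ) ≠ 0 := by exact_mod_cast hy.ne'
  have hp : (Real.pi : ℂ) ≠ 0 := by exact_mod_cast Real.pi_ne_zero
  have a1 := sub_ne (z := I) (by simp) s
  have a2 := sub_ne (z := -I) (by simp) s
  have a3 : (1 + (s : ℂ) ^ 2) ≠ 0 := by rw [add_comm]; exact sq_ne s
  have b1 : (x + y * I : ℂ) - (x + y * s : ℝ) = y * (I - s) := by push_cast; ring
  have b2 : (x - y * I : ℂ) - (x + y * s : ℝ) = y * (-I - s) := by push_cast; ring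
  rw [b1, b2]
  have b3 : (I - s : ℂ)⁻¹ - (-I - s)⁻¹ = -2 * I * (1 + (s:ℂ) ^ 2)⁻¹ := by
    field_simp
    ring_nf
    simp [I_pow_three]
    ring_nf
  simp only [one_div, mul_inv]
  push_cast
  calc _ = (I / Real.pi) * (y * (y:ℂ)⁻¹) * ((I - s : ℂ)⁻¹ - (-I - s)⁻¹) * f (x + y * s) := by ring
    _ = _ := by
      rw [b3, mul_inv_cancel₀ hyc]
      linear_combination (-2 * (Real.pi:ℂ)⁻¹ * (1 + (s:ℂ) ^ 2)⁻¹ * f (x + y * s)) * I_sq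

lemma poi_cont {f : ℝ → ℂ} (hc : Continuous f) (hb : ∃ M : ℝ, ∀ x : ℝ, ‖f x‖ ≤ M)
    (y : ℝ) : Continuous (poi f y) := by
  obtain ⟨M, hM⟩ := hb
  unfold poi
  refine continuous_const.mul ?_
  refine continuous_of_dominated (bound := fun s => (1 + s ^ 2)⁻¹ * M) ?_ ?_ ?_ ?_
  · intro x
    refine Continuous.aestronglyMeasurable ?_
    refine Continuous.mul (continuous_ofReal.comp ?_) (by fun_prop)
    exact Continuous.inv₀ (by fun_prop) (fun s => by positivity)
  · intro x
    refine ae_of_all _ fun s => ?_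
    rw [norm_mul, norm_real, Real.norm_of_nonneg (by positivity : 0 ≤ (1 + s ^ 2)⁻¹)]
    gcongr
    exact hM _
  · exact integrable_inv_one_add_sq.mul_const M
  · exact ae_of_all _ fun s => by fun_prop

lemma poi_tendsto {f : ℝ → ℂ} (hc : Continuous f) (hb : ∃ M : ℝ, ∀ x : ℝ, ‖f x‖ ≤ M)
    (x : ℝ) :
    Tendsto (fun n : ℕ => poi f (1 / ((n : ℝ) + 1)) x) atTop (𝓝 (f x)) := by
  obtain ⟨M, hM⟩ := hb
  have hp : (Real.pi : ℂ) ≠ 0 := by exact_mod_cast Real.pi_ne_zero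
  have e : f x = (Real.pi : ℂ)⁻¹ * ∫ s : ℝ, (((1 + s ^ 2)⁻¹ : ℝ) : ℂ) * f x := by
    rw [integral_mul_const, integral_complex_ofReal, integral_univ_inv_one_add_sq,
      inv_mul_cancel_left₀ hp]
  rw [e]
  unfold poi
  refine Tendsto.const_mul _ ?_
  refine tendsto_integral_of_dominated_convergence (fun s => (1 + s ^ 2)⁻¹ * M) ?_ ?_ ?_ ?_
  · intro n
    refine Continuous.aestronglyMeasurable ?_
    refine Continuous.mul (continuous_ofReal.comp ?_) (by fun_prop)
    exact Continuous.inv₀ (by fun_prop) (fun s => by positivity)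
  · exact integrable_inv_one_add_sq.mul_const M
  · intro n
    refine ae_of_all _ fun s => ?_
    rw [norm_mul, norm_real, Real.norm_of_nonneg (by positivity : 0 ≤ (1 + s ^ 2)⁻¹)]
    gcongr
    exact hM _
  · refine ae_of_all _ fun s => ?_
    refine Tendsto.const_mul _ ?_
    have h1 : Tendsto (fun n : ℕ => x + 1 / ((n : ℝ) + 1) * s) atTop (𝓝 (x + 0 * s)) :=
      (tendsto_one_div_add_atTop_nhds_zero_nat.mul_const s).const_add x
    have h2 := (hc.tendsto (x + 0 * s)).comp h1
    simpa [Function.comp_def] using h2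

end
end CFProof

namespace CFProof
section
open Filter Topology

/-- the function whose Fourier transform is the kernel -/
noncomputable def kk (y s : ℝ) : ℂ :=
  if s ≤ 0 then cexp s else 2 * cexp (-(y * s)) - cexp (-s)

lemma kk_cont (y : ℝ) : Continuous (kk y) := by
  unfold kk
  refine Continuous.if_le (by fun_prop) (by fun_prop) continuous_id continuous_const ?_
  rintro s rfl
  norm_num

lemma kk_mul_Iic (y : ℝ) (c : ℝ) : Set.EqOn (fun s : ℝ => cexp (-(c * s * I)) * kk y s)
    (fun s : ℝ => cexp ((1 - c * I) * s)) (Iic 0) := by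
  intro s hs
  simp only [kk, mem_Iic.1 hs, if_true]
  rw [← Complex.exp_add]
  ring_nf

lemma kk_mul_Ioi (y : ℝ) (c : ℝ) : Set.EqOn (fun s : ℝ => cexp (-(c * s * I)) * kk y s)
    (fun s : ℝ => 2 * cexp (-(y + c * I) * s) - cexp (-(1 + c * I) * s)) (Ioi 0) := by
  intro s hs
  simp only [kk, not_le.2 (mem_Ioi.1 hs), if_false]
  rw [mul_sub, mul_left_comm, ← Complex.exp_add, ← Complex.exp_add]
  ring_nf

lemma kk_int_Iic (y c : ℝ) :
    IntegrableOn (fun s : ℝ => cexp (-(c * s * I)) * kk y s) (Iic 0) := by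
  refine IntegrableOn.congr_fun ?_ (kk_mul_Iic y c).symm measurableSet_Iic
  exact integrableOn_exp_mul_complex_Iic (by simp) 0

lemma kk_int_Ioi (y c : ℝ) (hy : 0 < y) :
    IntegrableOn (fun s : ℝ => cexp (-(c * s * I)) * kk y s) (Ioi 0) := by
  refine IntegrableOn.congr_fun ?_ (kk_mul_Ioi y c).symm measurableSet_Ioi
  exact ((integrableOn_exp_mul_complex_Ioi (by simp [hy]) 0).const_mul 2).sub
    (integrableOn_exp_mul_complex_Ioi (by simp) 0)

lemma kk_fourier (y c : ℝ) (hy : 0 < y) :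
    ∫ s : ℝ, cexp (-(c * s * I)) * kk y s = 2 * I * ker (I * y) c := by
  rw [← intervalIntegral.integral_Iic_add_Ioi (kk_int_Iic y c) (kk_int_Ioi y c hy),
    setIntegral_congr_fun measurableSet_Iic (kk_mul_Iic y c),
    setIntegral_congr_fun measurableSet_Ioi (kk_mul_Ioi y c),
    integral_sub ((integrableOn_exp_mul_complex_Ioi (by simp [hy]) 0).const_mul 2)
    (integrableOn_exp_mul_complex_Ioi (by simp) 0), integral_const_mul,
    integral_exp_mul_complex_Ioi (by simp [hy]), integral_exp_mul_complex_Ioi (by simp),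
    integral_exp_mul_complex_Iic (by simp)]
  simp only [ofReal_zero, mul_zero, Complex.exp_zero, ker]
  have h1 : (1 - c * I : ℂ) ≠ 0 := by
    intro h; have := congrArg Complex.re h; simp at this
  have h2 : (1 + c * I : ℂ) ≠ 0 := by
    intro h; have := congrArg Complex.re h; simp at this
  have h3 : (y + c * I : ℂ) ≠ 0 := by
    intro h; have := congrArg Complex.re h; simp at this; exact hy.ne' this
  have h4 : (I * y - c : ℂ) = I * (y + c * I) := by linear_combination (-(c:ℂ)) * I_sq
  have h5 : (c ^ 2 + 1 : ℂ) = (1 - c * I) * (1 + c * I) := by linear_combination (c:ℂ)^2 * I_sq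
  rw [h4, h5]
  field_simp [I_ne_zero]
  ring

lemma kk_inv (y s : ℝ) (hy : 0 < y) :
    (I / (Real.pi : ℂ)) * ∫ t : ℝ, ker (I * y) t * cexp (I * t * s) = kk y s := by
  have hz : (I * y : ℂ).im ≠ 0 := by simpa using hy.ne'
  have hint : Integrable (kk y) := by
    have h1 := kk_int_Iic y 0
    have h2 := kk_int_Ioi y 0 hy
    simp only [ofReal_zero, zero_mul, neg_zero, Complex.exp_zero, one_mul] at h1 h2
    rw [← integrableOn_univ, ← Iic_union_Ioi (a := (0:ℝ))]
    exact h1.union h2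
  have hF : FourierTransform.fourier (kk y) = fun ξ : ℝ => 2 * I * ker (I * y) (2 * Real.pi * ξ) := by
    ext ξ
    rw [Real.fourier_real_eq_integral_exp_smul, ← kk_fourier y _ hy]
    refine integral_congr_ae (ae_of_all _ fun v => ?_)
    simp only [smul_eq_mul]
    push_cast
    ring_nf
  have hFi : Integrable (FourierTransform.fourier (kk y)) := by
    rw [hF]
    exact ((integrable_ker hz).comp_mul_left' (by positivity)).const_mul _
  have h := hint.fourierInv_fourier_eq hFi (kk_cont y).continuousAt (v := s)
  rw [hF, Real.fourierInv_eq'] at h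
  rw [← h]
  have h1 := Measure.integral_comp_mul_left (fun t : ℝ => ker (I * y) t * cexp (I * t * s)) (2 * Real.pi)
  have h2 : ∫ v : ℝ, cexp (((2 * Real.pi * inner ℝ v s : ℝ) : ℂ) * I) • (2 * I * ker (I * y) (2 * Real.pi * v))
      = 2 * I * ∫ v : ℝ, ker (I * y) (2 * Real.pi * v) * cexp (I * (2 * Real.pi * v : ℝ) * s) := by
    rw [← integral_const_mul]
    refine integral_congr_ae (ae_of_all _ fun v => ?_)
    simp only [smul_eq_mul, RCLike.inner_apply, conj_trivial]
    push_cast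
    ring_nf
  rw [h2, h1, abs_of_pos (by positivity), real_smul]
  push_cast
  have hp : (Real.pi : ℂ) ≠ 0 := by exact_mod_cast Real.pi_ne_zero
  generalize (∫ t : ℝ, ker (I * y) t * cexp (I * t * s)) = J
  field_simp

/-- odd exponential -/
noncomputable def aa (s : ℝ) : ℝ := (Ioi 0).indicator (fun s => Real.exp (-|s|)) s -
  (Iio 0).indicator (fun s => Real.exp (-|s|)) s

lemma kk_eq (y s : ℝ) : kk y s = (((Ioi 0).indicator (fun s => Real.exp (y * -|s|)) s +
    (Ici 0).indicator (fun s => Real.exp (y * -|s|)) s - aa s : ℝ) : ℂ) := by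
  rcases lt_trichotomy s 0 with h | rfl | h
  · simp [kk, aa, h, h.le, h.not_gt, h.not_ge, abs_of_neg h]
  · simp [kk, aa]
  · simp [kk, aa, h, h.le, h.not_gt, h.not_ge, abs_of_pos h]
    ring

lemma aa_meas : Measurable aa := by
  unfold aa
  refine Measurable.sub ?_ ?_
  · exact Measurable.indicator (by fun_prop) measurableSet_Ioi
  · exact Measurable.indicator (by fun_prop) measurableSet_Iio

lemma aa_neg (s : ℝ) : aa (-s) = - aa s := by
  rcases lt_trichotomy s 0 with h | rfl | h
  · simp [aa, h, h.not_gt]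
  · simp [aa]
  · simp [aa, h, h.not_gt]

lemma aa_bound (s : ℝ) : ‖aa s‖ ≤ 1 := by
  rcases lt_trichotomy s 0 with h | rfl | h
  · simp [aa, h, h.not_gt]
  · simp [aa]
  · simp [aa, h, h.not_gt]

/-- the condition on the positive axis -/
def Cond (f : ℝ → ℂ) (a : ℝ) : Prop :=
  (∀ y ∈ Ioi (0 : ℝ), ((a : ℂ) + modCauchyTransform f (Complex.I * y)).im = 0) ∧
    CompletelyMonotonicOn
      (fun y : ℝ => ((a : ℂ) + modCauchyTransform f (Complex.I * y)).re) (Ioi 0)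

lemma formula (σ : Measure ℝ) [IsProbabilityMeasure σ] (f : ℝ → ℂ)
    (hf : ∀ x : ℝ, f x = ∫ t : ℝ, cexp (I * x * t) ∂σ) (y : ℝ) (hy : 0 < y) :
    ((∫ s, aa s ∂σ : ℝ) : ℂ) + modCauchyTransform f (I * y) =
      ((ProbabilityTheory.mgf (fun s : ℝ => -|s|) (σ.restrict (Ioi 0) + σ.restrict (Ici 0)) y : ℝ) : ℂ) := by
  have hz : (I * y : ℂ).im ≠ 0 := by simpa using hy.ne'
  have e1 : modCauchyTransform f (I * y) = ∫ s, kk y s ∂σ := by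
    rw [mct_eq]
    have : ∀ t, ker (I * y) t * f t = ∫ s : ℝ, ker (I * y) t * cexp (I * t * s) ∂σ := by
      intro t
      rw [hf, integral_const_mul]
    simp_rw [this]
    rw [integral_integral_swap, ← integral_const_mul]
    · simp_rw [kk_inv y _ hy]
    · have h1 : Integrable (fun p : ℝ × ℝ => ker (I * y) p.1 * (1:ℂ)) (volume.prod σ) :=
        (integrable_ker hz).mul_prod (integrable_const (1:ℂ))
      refine (h1.mul_bdd (c := 1) (g := fun p : ℝ × ℝ => cexp (I * p.1 * p.2)) ?_ ?_).congr ?_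
      · exact Continuous.aestronglyMeasurable (by fun_prop)
      · refine ae_of_all _ fun p => ?_
        have : (I * p.1 * p.2 : ℂ) = ((p.1 * p.2 : ℝ) : ℂ) * I := by push_cast; ring
        rw [this, norm_exp_ofReal_mul_I]
      · refine ae_of_all _ fun p => ?_
        simp [Function.uncurry]
  have hE : ∀ ρ : Measure ℝ, IsFiniteMeasure ρ → Integrable (fun s : ℝ => Real.exp (y * -|s|)) ρ := by
    intro ρ _
    refine Integrable.of_bound (C := 1) (by fun_prop) (ae_of_all _ fun s => ?_)
    rw [Real.norm_of_nonneg (Real.exp_pos _).le, Real.exp_le_one_iff]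
    nlinarith [abs_nonneg s]
  have hA : Integrable aa σ := Integrable.of_bound (C := 1) aa_meas.aestronglyMeasurable
    (ae_of_all _ aa_bound)
  rw [e1]
  simp_rw [kk_eq]
  rw [integral_complex_ofReal, ← ofReal_add]
  congr 1
  have i1 : Integrable ((Ioi (0:ℝ)).indicator (fun s : ℝ => Real.exp (y * -|s|))) σ :=
    (hE σ inferInstance).indicator measurableSet_Ioi
  have i2 : Integrable ((Ici (0:ℝ)).indicator (fun s : ℝ => Real.exp (y * -|s|))) σ :=
    (hE σ inferInstance).indicator measurableSet_Ici
  have i3 : Integrable (fun s => (Ioi (0:ℝ)).indicator (fun s : ℝ => Real.exp (y * -|s|)) s +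
      (Ici (0:ℝ)).indicator (fun s : ℝ => Real.exp (y * -|s|)) s) σ := i1.add i2
  rw [integral_sub i3 hA, integral_add i1 i2, integral_indicator measurableSet_Ioi,
    integral_indicator measurableSet_Ici, ProbabilityTheory.mgf,
    integral_add_measure (hE _ inferInstance) (hE _ inferInstance)]
  ring

lemma forward (σ : Measure ℝ) [IsProbabilityMeasure σ] (f : ℝ → ℂ)
    (hf : ∀ x : ℝ, f x = ∫ t : ℝ, cexp (I * x * t) ∂σ) : Cond f (∫ s, aa s ∂σ) := by
  have F := formula σ f hf
  set μ := σ.restrict (Ioi 0) + σ.restrict (Ici 0) with hμ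
  have hset : Ioi (0:ℝ) ⊆ interior (ProbabilityTheory.integrableExpSet (fun s : ℝ => -|s|) μ) := by
    refine interior_maximal ?_ isOpen_Ioi
    intro y hy
    have hy' : 0 < y := hy
    refine Integrable.of_bound (C := 1) (by fun_prop) (ae_of_all _ fun s => ?_)
    rw [Real.norm_of_nonneg (Real.exp_pos _).le, Real.exp_le_one_iff]
    nlinarith [abs_nonneg s]
  have heq : Set.EqOn (fun y : ℝ => (((∫ s, aa s ∂σ : ℝ) : ℂ) + modCauchyTransform f (I * y)).re)
      (ProbabilityTheory.mgf (fun s : ℝ => -|s|) μ) (Ioi 0) := by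
    intro y hy
    simp only
    rw [F y hy, ofReal_re]
  refine ⟨fun y hy => by rw [F y hy, ofReal_im], ?_, fun n y hy => ?_⟩
  · refine ContDiffOn.congr ?_ heq
    exact ((ProbabilityTheory.analyticOn_mgf.mono hset).contDiffOn (uniqueDiffOn_Ioi 0))
  · have : (fun y : ℝ => (((∫ s, aa s ∂σ : ℝ) : ℂ) + modCauchyTransform f (I * y)).re) =ᶠ[𝓝 y]
      (ProbabilityTheory.mgf (fun s : ℝ => -|s|) μ) := heq.eventuallyEq_of_mem (Ioi_mem_nhds hy)
    rw [this.iteratedDeriv_eq, ProbabilityTheory.iteratedDeriv_mgf (hset hy),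
      ← integral_const_mul]
    refine integral_nonneg fun s => ?_
    simp only [Pi.zero_apply]
    rw [← mul_assoc, ← mul_pow]
    simp only [neg_mul, one_mul, neg_neg]
    positivity

lemma cond_neg (f : ℝ → ℂ) (a : ℝ) :
    ((∀ y ∈ Iio (0 : ℝ), (-((a : ℂ) + modCauchyTransform f (Complex.I * y))).im = 0) ∧
      AbsolutelyMonotonicOn
        (fun y : ℝ => (-((a : ℂ) + modCauchyTransform f (Complex.I * y))).re) (Iio 0)) ↔
    Cond (fun t => f (-t)) (-a) := by
  have e : ∀ y : ℝ, -((a : ℂ) + modCauchyTransform f (Complex.I * y)) =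
      ((-a : ℝ) : ℂ) + modCauchyTransform (fun t => f (-t)) (Complex.I * (-y : ℝ)) := by
    intro y
    have := mct_neg f (I * (-y : ℝ))
    have h2 : -(I * ((-y : ℝ) : ℂ)) = I * y := by push_cast; ring
    rw [h2] at this
    rw [this]
    push_cast; ring
  simp_rw [e]
  unfold Cond AbsolutelyMonotonicOn CompletelyMonotonicOn
  set g : ℝ → ℂ := fun y => ((-a : ℝ) : ℂ) + modCauchyTransform (fun t => f (-t)) (Complex.I * y) with hg
  have key : ∀ n y, iteratedDeriv n (fun y : ℝ => (g (-y)).re) y =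
      (-1) ^ n * iteratedDeriv n (fun y : ℝ => (g y).re) (-y) := by
    intro n y
    have := iteratedDeriv_comp_neg n (fun y : ℝ => (g y).re) y
    simpa using this
  have hsm : ContDiffOn ℝ (⊤ : ℕ∞) (fun y : ℝ => (g (-y)).re) (Iio 0) ↔
      ContDiffOn ℝ (⊤ : ℕ∞) (fun y : ℝ => (g y).re) (Ioi 0) := by
    constructor
    · intro h
      have := h.comp (s := Ioi 0) (contDiff_neg.contDiffOn) (fun y hy => by simpa using hy)
      simpa [Function.comp_def] using this
    · intro h
      exact h.comp (s := Iio 0) (contDiff_neg.contDiffOn) (fun y hy => by simpa using hy)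
  refine and_congr ?_ (and_congr hsm ?_)
  · constructor
    · intro h y hy
      simpa [hg] using h (-y) (by simpa using hy)
    · intro h y hy
      exact h (-y) (by simpa using hy)
  · constructor
    · intro h n y hy
      have := h n (-y) (by simpa using hy)
      rw [key, neg_neg] at this
      exact this
    · intro h n y hy
      change 0 ≤ iteratedDeriv n (fun y : ℝ => (g (-y)).re) y
      rw [key]
      exact h n (-y) (by simpa using hy)

lemma half {f : ℝ → ℂ} (hc : Continuous f) (hb : ∃ M : ℝ, ∀ x : ℝ, ‖f x‖ ≤ M) {a : ℝ}
    (h : Cond f a) (y : ℝ) (hy : 0 < y) :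
    ∃ m : Measure ℝ, IsFiniteMeasure m ∧
      ∀ x : ℝ, charFun m x = a + modCauchyTransform f (x + y * I) := by
  have hd : DifferentiableOn ℂ (fun p => a + modCauchyTransform f (I * p)) {p | 0 < p.re} := by
    refine DifferentiableOn.const_add _ ?_
    refine (differentiable_mct hc hb).comp (by fun_prop) ?_
    intro p hp
    simpa using hp
  obtain ⟨m, hm, hm'⟩ := charFun_of_cm (fun p => a + modCauchyTransform f (I * p)) hd h.1
    (fun n y hy => h.2.2 n y hy) y hy
  refine ⟨m, hm, fun x => ?_⟩
  rw [hm']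
  have : (I * (y - x * I) : ℂ) = x + y * I := by linear_combination (-(x:ℂ)) * I_sq
  rw [this]

lemma backward {f : ℝ → ℂ} (hc : Continuous f) (hb : ∃ M : ℝ, ∀ x : ℝ, ‖f x‖ ≤ M)
    (h0 : f 0 = 1) {a : ℝ} (h1 : Cond f a) (h2 : Cond (fun t => f (-t)) (-a)) : IsCharFun f := by
  have hP : ∀ y : ℝ, 0 < y → ∃ m : Measure ℝ, IsFiniteMeasure m ∧ ∀ x, charFun m x = poi f y x := by
    intro y hy
    obtain ⟨m1, hm1, e1⟩ := half hc hb h1 y hy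
    obtain ⟨m2, hm2, e2⟩ := half (hc.comp continuous_neg)
      (hb.imp fun M hM x => hM (-x)) h2 y hy
    have : IsFiniteMeasure (m1 + m2.map (fun x => -1 * x)) := inferInstance
    refine ⟨ENNReal.ofReal (1/2) • (m1 + m2.map (fun x => -1 * x)),
      Measure.smul_finite _ ENNReal.ofReal_ne_top, fun x => ?_⟩
    rw [charFun_smul', charFun_add', charFun_map_mul, e1, e2]
    have h3 := mct_sub hc hb x y hy
    have h4 := mct_neg f (((-1 * x : ℝ) : ℂ) + y * I)
    have h5 : -(((-1 * x : ℝ) : ℂ) + y * I) = x - y * I := by push_cast; ring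
    rw [h5] at h4
    rw [h4] at h3
    rw [ENNReal.toReal_ofReal (by norm_num)]
    simp only [Function.comp_def]
    push_cast at h3 ⊢
    linear_combination (1/2 : ℂ) * h3
  choose! m hm hm' using hP
  have hfin : ∀ n : ℕ, IsFiniteMeasure (m (1 / ((n : ℝ) + 1))) := fun n => hm _ (by positivity)
  obtain ⟨ν, hν, hν'⟩ := levy_fin (fun n : ℕ => m (1 / ((n : ℝ) + 1))) f hc.continuousAt (by
    intro t
    have := poi_tendsto hc hb t
    refine this.congr fun n => ?_
    rw [hm' _ (by positivity)])
  refine ⟨ν, ⟨?_⟩, fun x => ?_⟩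
  · have := hν' 0
    rw [charFun_zero, h0] at this
    have h2 : ν.real univ = 1 := by exact_mod_cast this
    rw [Measure.real, ENNReal.toReal_eq_one_iff] at h2
    exact h2
  · rw [← hν', charFun_apply_real]
    refine integral_congr_ae (ae_of_all _ fun t => ?_)
    simp only
    ring_nf

end
end CFProof

/-- Theorem 2: `f` bounded continuous with `f 0 = 1` is a characteristic function iff
there is `a_f ∈ ℝ` with `a_f + K_f(iy)` real-valued completely monotonic on `(0,∞)`
and `-(a_f + K_f(iy))` real-valued absolutely monotonic on `(-∞,0)`. -/
theorem stmt_0 (f : ℝ → ℂ) (hc : Continuous f) (hb : ∃ M : ℝ, ∀ x : ℝ, ‖f x‖ ≤ M)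
    (h0 : f 0 = 1) :
    IsCharFun f ↔
      ∃ a : ℝ,
        ((∀ y ∈ Ioi (0 : ℝ), ((a : ℂ) + modCauchyTransform f (Complex.I * y)).im = 0) ∧
          CompletelyMonotonicOn
            (fun y : ℝ => ((a : ℂ) + modCauchyTransform f (Complex.I * y)).re) (Ioi 0)) ∧
        ((∀ y ∈ Iio (0 : ℝ), (-((a : ℂ) + modCauchyTransform f (Complex.I * y))).im = 0) ∧
          AbsolutelyMonotonicOn
            (fun y : ℝ => (-((a : ℂ) + modCauchyTransform f (Complex.I * y))).re) (Iio 0)) := by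
  constructor
  · rintro ⟨σ, hσ, hf⟩
    refine ⟨∫ s, CFProof.aa s ∂σ, CFProof.forward σ f hf, ?_⟩
    rw [CFProof.cond_neg]
    have hp : IsProbabilityMeasure (σ.map (fun x : ℝ => -x)) :=
      Measure.isProbabilityMeasure_map (by fun_prop)
    have h := CFProof.forward (σ.map (fun x : ℝ => -x)) (fun t => f (-t)) (by
      intro x
      rw [integral_map (by fun_prop) (Continuous.aestronglyMeasurable (by fun_prop)), hf]
      refine integral_congr_ae (ae_of_all _ fun t => ?_)
      simp only
      push_cast
      ring_nf)
    rw [integral_map (by fun_prop) CFProof.aa_meas.aestronglyMeasurable] at h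
    simp_rw [CFProof.aa_neg] at h
    rwa [integral_neg] at h
  · rintro ⟨a, h1, h2⟩
    rw [CFProof.cond_neg] at h2
    exact CFProof.backward hc hb h0 h1 h2
end

section
/- Let f : ℝ → ℂ be a bounded continuous function with f(0) = 1 that satisfies ∫ℝ |f(t)|/(1 + |t|) dt < ∞, and let k_f denote its Cauchy transform. Then f is a characteristic function if and only if: (i) the function y ↦ k_f(iy) is real-valued and completely monotonic on (0, ∞), and (ii) the function y ↦ −k_f(iy) is real-valued and absolutely monotonic on (−∞, 0). -/
open MeasureTheory Complex Set
open scoped ENNReal ComplexOrder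

open Filter Topology

noncomputable def Jint (f : ℝ → ℂ) (n : ℕ) (y : ℝ) : ℂ :=
  ∫ t : ℝ, f t / ((y : ℂ) + I * t) ^ (n + 1)

noncomputable def Qint (f : ℝ → ℂ) (n : ℕ) (r : ℝ) : ℂ :=
  ∫ t : ℝ, f t / (1 + I * r * t) ^ (n + 1)

lemma norm_lower (a y t : ℝ) (ha : 0 < a) (hy : a ≤ |y|) :
    a / (1 + a) * (1 + |t|) ≤ ‖(y : ℂ) + I * t‖ := by
  have h1 : |y| ≤ ‖(y : ℂ) + I * t‖ := by
    simpa using Complex.abs_re_le_norm ((y : ℂ) + I * t)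
  have h2 : |t| ≤ ‖(y : ℂ) + I * t‖ := by
    simpa using Complex.abs_im_le_norm ((y : ℂ) + I * t)
  rw [div_mul_eq_mul_div, div_le_iff₀ (by positivity)]
  nlinarith [mul_le_mul_of_nonneg_left h2 ha.le]

lemma ne_zero_of_ne {y : ℝ} (hy : y ≠ 0) (t : ℝ) : (y : ℂ) + I * t ≠ 0 := by
  intro h
  have := congrArg Complex.re h
  simp at this
  exact hy this

lemma norm_bound (f : ℝ → ℂ) (n : ℕ) (a y t : ℝ) (ha : 0 < a) (hy : a ≤ |y|) :
    ‖f t / ((y : ℂ) + I * t) ^ (n + 1)‖ ≤ ((1 + a) / a) ^ (n + 1) * (‖f t‖ / (1 + |t|)) := by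
  have h1 := norm_lower a y t ha hy
  have ht : 0 ≤ |t| := abs_nonneg t
  rw [norm_div, norm_pow]
  have h2 : (a / (1 + a)) ^ (n + 1) * (1 + |t|) ≤ ‖(y : ℂ) + I * t‖ ^ (n + 1) := by
    calc (a / (1 + a)) ^ (n + 1) * (1 + |t|)
        ≤ (a / (1 + a)) ^ (n + 1) * (1 + |t|) ^ (n + 1) := by
          gcongr
          exact le_self_pow₀ (by linarith) (by omega)
      _ = (a / (1 + a) * (1 + |t|)) ^ (n + 1) := by rw [mul_pow]
      _ ≤ _ := by gcongr
  calc ‖f t‖ / ‖(y : ℂ) + I * t‖ ^ (n + 1)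
      ≤ ‖f t‖ / ((a / (1 + a)) ^ (n + 1) * (1 + |t|)) := by gcongr
    _ = _ := by
      rw [div_pow, div_pow]
      field_simp

lemma J_meas (f : ℝ → ℂ) (hc : Continuous f) (n : ℕ) (y : ℝ) :
    AEStronglyMeasurable (fun t : ℝ => f t / ((y : ℂ) + I * t) ^ (n + 1)) := by
  have := hc.measurable
  exact Measurable.aestronglyMeasurable (by fun_prop)

lemma J_integrable (f : ℝ → ℂ) (hc : Continuous f)
    (hint : Integrable (fun t : ℝ => ‖f t‖ / (1 + |t|))) (n : ℕ) (y : ℝ) (hy : y ≠ 0) :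
    Integrable (fun t : ℝ => f t / ((y : ℂ) + I * t) ^ (n + 1)) :=
  (hint.const_mul (((1 + |y|) / |y|) ^ (n + 1))).mono' (J_meas f hc n y)
    (ae_of_all _ fun t => norm_bound f n |y| y t (abs_pos.2 hy) le_rfl)

lemma J_hasDerivAt (f : ℝ → ℂ) (hc : Continuous f)
    (hint : Integrable (fun t : ℝ => ‖f t‖ / (1 + |t|))) (n : ℕ) (y : ℝ) (hy : y ≠ 0) :
    HasDerivAt (Jint f n) (-((n : ℂ) + 1) * Jint f (n + 1) y) y := by
  have hy' : 0 < |y| := abs_pos.2 hy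
  have hball : ∀ x ∈ Metric.ball y (|y| / 2), |y| / 2 ≤ |x| := by
    intro x hx
    rw [Metric.mem_ball, Real.dist_eq] at hx
    have := abs_sub_abs_le_abs_sub y x
    rw [abs_sub_comm] at this
    linarith
  have key := (hasDerivAt_integral_of_dominated_loc_of_deriv_le (μ := volume)
    (F := fun (x : ℝ) (t : ℝ) => f t / ((x : ℂ) + I * t) ^ (n + 1))
    (F' := fun (x : ℝ) (t : ℝ) => -((n : ℂ) + 1) * (f t / ((x : ℂ) + I * t) ^ (n + 1 + 1)))
    (x₀ := y) (s := Metric.ball y (|y| / 2))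
    (bound := fun t => (n + 1) * (((1 + |y| / 2) / (|y| / 2)) ^ (n + 1 + 1) * (‖f t‖ / (1 + |t|))))
    (Metric.ball_mem_nhds _ (by positivity))
    (Eventually.of_forall fun x => J_meas f hc n x)
    (J_integrable f hc hint n y hy)
    ((J_meas f hc (n + 1) y).const_mul _)
    (ae_of_all _ fun t x hx => ?_)
    ((hint.const_mul _).const_mul _)
    (ae_of_all _ fun t x hx => ?_)).2
  · rw [integral_const_mul] at key
    exact key
  · rw [norm_mul]
    have e : ‖(-((n : ℂ) + 1))‖ = (n : ℝ) + 1 := by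
      rw [norm_neg]; exact_mod_cast Complex.norm_natCast (n + 1)
    rw [e]
    gcongr
    exact norm_bound f (n + 1) (|y| / 2) x t (by positivity) (hball x hx)
  · have hx0 : x ≠ 0 := by
      have := hball x hx
      intro h
      rw [h, abs_zero] at this
      linarith
    have hne := ne_zero_of_ne hx0 t
    have h1 : HasDerivAt (fun x : ℝ => (x : ℂ) + I * t) 1 x :=
      (Complex.ofRealCLM.hasDerivAt (x := x)).add_const _
    have h2 := (h1.pow (n + 1)).fun_inv (pow_ne_zero _ hne)
    have h3 := h2.const_mul (f t)
    simp only [div_eq_mul_inv]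
    refine h3.congr_deriv ?_
    simp only [Pi.pow_apply]
    push_cast
    field_simp
    ring

lemma J_contDiffOn (f : ℝ → ℂ) (hc : Continuous f)
    (hint : Integrable (fun t : ℝ => ‖f t‖ / (1 + |t|))) (m : ℕ) :
    ∀ n : ℕ, ContDiffOn ℝ m (Jint f n) {y | y ≠ 0} := by
  have ho : IsOpen {y : ℝ | y ≠ 0} := isOpen_ne
  have hd : ∀ n, DifferentiableOn ℝ (Jint f n) {y | y ≠ 0} := fun n y hy =>
    (J_hasDerivAt f hc hint n y hy).differentiableAt.differentiableWithinAt
  induction m with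
  | zero => exact fun n => by simpa using (hd n).continuousOn
  | succ m ih =>
    intro n
    have : ((m + 1 : ℕ) : WithTop ℕ∞) = (m : WithTop ℕ∞) + 1 := by push_cast; rfl
    rw [this, contDiffOn_succ_iff_deriv_of_isOpen ho]
    refine ⟨hd n, by simp, ?_⟩
    refine ((contDiffOn_const (c := -((n : ℂ) + 1))).mul (ih (n + 1))).congr ?_
    intro y hy
    exact (J_hasDerivAt f hc hint n y hy).deriv

lemma J_contDiffOn_top (f : ℝ → ℂ) (hc : Continuous f)
    (hint : Integrable (fun t : ℝ => ‖f t‖ / (1 + |t|))) :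
    ContDiffOn ℝ (⊤ : ℕ∞) (Jint f 0) {y | y ≠ 0} :=
  contDiffOn_infty.2 fun m => J_contDiffOn f hc hint m 0

lemma J_iter (f : ℝ → ℂ) (hc : Continuous f)
    (hint : Integrable (fun t : ℝ => ‖f t‖ / (1 + |t|))) (c : ℝ) (n : ℕ) :
    ∀ y : ℝ, y ≠ 0 → iteratedDeriv n (fun y => c * (Jint f 0 y).re) y
      = c * ((-1) ^ n * n.factorial * (Jint f n y).re) := by
  induction n with
  | zero => intro y hy; simp
  | succ n ih =>
    intro y hy
    rw [iteratedDeriv_succ]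
    have he : iteratedDeriv n (fun y => c * (Jint f 0 y).re) =ᶠ[𝓝 y]
        fun y => c * ((-1) ^ n * n.factorial * (Jint f n y).re) := by
      filter_upwards [isOpen_ne.mem_nhds hy] with x hx using ih x hx
    rw [he.deriv_eq]
    have h1 := J_hasDerivAt f hc hint n y hy
    have h2 : HasDerivAt (fun y => (Jint f n y).re) (-((n : ℂ) + 1) * Jint f (n + 1) y).re y :=
      Complex.reCLM.hasFDerivAt.comp_hasDerivAt y h1
    rw [((h2.const_mul _).const_mul c).deriv]
    have : (-((n : ℂ) + 1) * Jint f (n + 1) y).re = -((n : ℝ) + 1) * (Jint f (n + 1) y).re := by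
      simp [Complex.mul_re]
    rw [this, Nat.factorial_succ]
    push_cast
    ring

lemma J_im (f : ℝ → ℂ) (hc : Continuous f)
    (hint : Integrable (fun t : ℝ => ‖f t‖ / (1 + |t|))) (s : Set ℝ) (hs : IsOpen s)
    (hs0 : ∀ y ∈ s, y ≠ 0) (h : ∀ y ∈ s, (Jint f 0 y).im = 0) (n : ℕ) :
    ∀ y ∈ s, (Jint f n y).im = 0 := by
  induction n with
  | zero => exact h
  | succ n ih =>
    intro y hy
    have h1 := J_hasDerivAt f hc hint n y (hs0 y hy)
    have h2 : HasDerivAt (fun y => (Jint f n y).im) (-((n : ℂ) + 1) * Jint f (n + 1) y).im y :=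
      Complex.imCLM.hasFDerivAt.comp_hasDerivAt y h1
    have he : (fun y => (Jint f n y).im) =ᶠ[𝓝 y] fun _ => 0 := by
      filter_upwards [hs.mem_nhds hy] with x hx using ih x hx
    have h3 := h2.deriv
    rw [he.deriv_eq] at h3
    have h4 : (-((n : ℂ) + 1) * Jint f (n + 1) y).im = -((n : ℝ) + 1) * (Jint f (n + 1) y).im := by
      simp [Complex.mul_im]
    rw [h4] at h3
    simp only [deriv_const] at h3
    have : ((n : ℝ) + 1) ≠ 0 := by positivity
    have h5 : ((n : ℝ) + 1) * (Jint f (n + 1) y).im = 0 := by linarith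
    exact (mul_eq_zero.1 h5).resolve_left this

lemma cauchy_eq (f : ℝ → ℂ) (y : ℝ) :
    cauchyTransform f (I * y) = ((Real.pi⁻¹ : ℝ) : ℂ) * Jint f 0 y := by
  unfold cauchyTransform Jint
  rw [← integral_const_mul, ← integral_const_mul]
  congr 1
  ext t
  have : I * (y : ℂ) - t = I * (y + I * t) := by
    linear_combination (-(t : ℂ)) * Complex.I_sq
  rw [this, zero_add, pow_one, ofReal_inv]
  rw [div_eq_mul_inv, div_eq_mul_inv, div_eq_mul_inv, mul_inv]
  have := mul_inv_cancel₀ Complex.I_ne_zero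
  linear_combination (f t * (↑Real.pi)⁻¹ * (y + I * (t : ℂ))⁻¹) * this

lemma Q_eq_J (f : ℝ → ℂ) (n : ℕ) (y : ℝ) (hy : y ≠ 0) :
    Qint f n y⁻¹ = ((y ^ (n + 1) : ℝ) : ℂ) * Jint f n y := by
  unfold Qint Jint
  rw [← integral_const_mul]
  congr 1
  ext t
  have hy' : (y : ℂ) ≠ 0 := by exact_mod_cast hy
  have : 1 + I * ((y⁻¹ : ℝ) : ℂ) * t = (y + I * t) / y := by
    push_cast; field_simp
  rw [this, div_pow]
  push_cast
  rw [div_div_eq_mul_div]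
  ring

lemma cplx_nonneg_iff (z : ℂ) : 0 ≤ z ↔ 0 ≤ z.re ∧ z.im = 0 := by
  rw [Complex.nonneg_iff, eq_comm (a := (0 : ℝ)) (b := z.im)]

theorem monot_iff (f : ℝ → ℂ) (hc : Continuous f)
    (hint : Integrable (fun t : ℝ => ‖f t‖ / (1 + |t|))) :
    (((∀ y ∈ Ioi (0 : ℝ), (cauchyTransform f (Complex.I * y)).im = 0) ∧
        CompletelyMonotonicOn (fun y : ℝ => (cauchyTransform f (Complex.I * y)).re) (Ioi 0)) ∧
      ((∀ y ∈ Iio (0 : ℝ), (-(cauchyTransform f (Complex.I * y))).im = 0) ∧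
        AbsolutelyMonotonicOn (fun y : ℝ => (-(cauchyTransform f (Complex.I * y))).re) (Iio 0)))
    ↔ ∀ (n : ℕ) (r : ℝ), r ≠ 0 → 0 ≤ Qint f n r := by
  have hpi : (0 : ℝ) < Real.pi⁻¹ := inv_pos.2 Real.pi_pos
  have e1 : (fun y : ℝ => (cauchyTransform f (Complex.I * y)).re)
      = fun y => Real.pi⁻¹ * (Jint f 0 y).re := by
    ext y; rw [cauchy_eq, Complex.re_ofReal_mul]
  have e2 : (fun y : ℝ => (-(cauchyTransform f (Complex.I * y))).re)
      = fun y => (-Real.pi⁻¹) * (Jint f 0 y).re := by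
    ext y; rw [cauchy_eq, Complex.neg_re, Complex.re_ofReal_mul]; ring
  have e3 : ∀ y : ℝ, (cauchyTransform f (Complex.I * y)).im = 0 ↔ (Jint f 0 y).im = 0 := by
    intro y
    rw [cauchy_eq, Complex.im_ofReal_mul, mul_eq_zero, or_iff_right hpi.ne']
  have e4 : ∀ y : ℝ, (-(cauchyTransform f (Complex.I * y))).im = 0 ↔ (Jint f 0 y).im = 0 := by
    intro y
    rw [Complex.neg_im, neg_eq_zero, e3]
  have hcd : ∀ (c : ℝ) (s : Set ℝ), (∀ y ∈ s, y ≠ 0) →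
      ContDiffOn ℝ (⊤ : ℕ∞) (fun y => c * (Jint f 0 y).re) s := by
    intro c s hs
    have h1 := (J_contDiffOn_top f hc hint).mono (fun y hy => hs y hy : s ⊆ {y | y ≠ 0})
    exact contDiffOn_const.mul (Complex.reCLM.contDiff.comp_contDiffOn h1)
  rw [e1, e2]
  simp only [e3, e4]
  unfold CompletelyMonotonicOn AbsolutelyMonotonicOn
  have hneg : ∀ y ∈ Iio (0 : ℝ), y ≠ 0 := fun y hy => (mem_Iio.1 hy).ne
  have hpos : ∀ y ∈ Ioi (0 : ℝ), y ≠ 0 := fun y hy => (mem_Ioi.1 hy).ne'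
  have q1 : ∀ (n : ℕ), ∀ y : ℝ, y ≠ 0 →
      (-1 : ℝ) ^ n * iteratedDeriv n (fun y => Real.pi⁻¹ * (Jint f 0 y).re) y
        = (Real.pi⁻¹ * n.factorial) * (Jint f n y).re := by
    intro n y hy
    rw [J_iter f hc hint _ n y hy]
    have : (-1 : ℝ) ^ n * (-1) ^ n = 1 := by rw [← mul_pow]; simp
    linear_combination (Real.pi⁻¹ * n.factorial * (Jint f n y).re) * this
  have q2 : ∀ (n : ℕ), ∀ y : ℝ, y ≠ 0 →
      iteratedDeriv n (fun y => (-Real.pi⁻¹) * (Jint f 0 y).re) y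
        = (Real.pi⁻¹ * n.factorial) * ((-1) ^ (n + 1) * (Jint f n y).re) := by
    intro n y hy
    rw [J_iter f hc hint _ n y hy]
    ring
  have hfac : ∀ n : ℕ, (0 : ℝ) < Real.pi⁻¹ * n.factorial := fun n =>
    mul_pos hpi (by exact_mod_cast n.factorial_pos)
  constructor
  · rintro ⟨⟨i1, -, c1⟩, i2, -, c2⟩ n r hr
    have hr' : r⁻¹ ≠ 0 := inv_ne_zero hr
    have hq := Q_eq_J f n r⁻¹ hr'
    rw [inv_inv] at hq
    rw [hq, cplx_nonneg_iff, Complex.re_ofReal_mul, Complex.im_ofReal_mul]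
    rcases lt_or_gt_of_ne hr' with h | h
    · have a1 := J_im f hc hint _ isOpen_Iio hneg i2 n _ h
      have a2 := c2 n _ h
      rw [q2 n _ hr'] at a2
      have a3 := nonneg_of_mul_nonneg_right a2 (hfac n)
      refine ⟨?_, by rw [a1, mul_zero]⟩
      have : (r⁻¹) ^ (n + 1) = (-r⁻¹) ^ (n + 1) * (-1) ^ (n + 1) := by
        rw [← mul_pow]; simp
      rw [this, mul_assoc]
      exact mul_nonneg (pow_nonneg (by linarith) _) a3
    · have a1 := J_im f hc hint _ isOpen_Ioi hpos i1 n _ h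
      have a2 := c1 n _ h
      rw [q1 n _ hr'] at a2
      have a3 := nonneg_of_mul_nonneg_right a2 (hfac n)
      refine ⟨?_, by rw [a1, mul_zero]⟩
      exact mul_nonneg (pow_nonneg h.le _) a3
  · intro H
    have H' : ∀ (n : ℕ) (y : ℝ), y ≠ 0 → 0 ≤ y ^ (n + 1) * (Jint f n y).re ∧
        (Jint f n y).im = 0 := by
      intro n y hy
      have := H n y⁻¹ (inv_ne_zero hy)
      rw [Q_eq_J f n y hy, cplx_nonneg_iff, Complex.re_ofReal_mul, Complex.im_ofReal_mul] at this
      exact ⟨this.1, (mul_eq_zero.1 this.2).resolve_left (pow_ne_zero _ hy)⟩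
    refine ⟨⟨fun y hy => (H' 0 y (hpos y hy)).2, hcd _ _ hpos, ?_⟩,
      fun y hy => (H' 0 y (hneg y hy)).2, hcd _ _ hneg, ?_⟩
    · intro n y hy
      rw [q1 n y (hpos y hy)]
      exact mul_nonneg (hfac n).le
        (nonneg_of_mul_nonneg_right (H' n y (hpos y hy)).1 (pow_pos hy _))
    · intro n y hy
      rw [q2 n y (hneg y hy)]
      refine mul_nonneg (hfac n).le ?_
      have h1 := (H' n y (hneg y hy)).1
      have : y ^ (n + 1) = (-y) ^ (n + 1) * (-1) ^ (n + 1) := by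
        rw [← mul_pow]; simp
      rw [this, mul_assoc] at h1
      exact nonneg_of_mul_nonneg_right h1 (pow_pos (by linarith [mem_Iio.1 hy]) _)

noncomputable def Fg (f : ℝ → ℂ) (ε a : ℝ) : ℂ :=
  ∫ t : ℝ, f t * (cexp (-(ε : ℂ) * t ^ 2) * cexp (-(I * a * t)))

lemma cintegral_nonneg {α : Type*} [MeasurableSpace α] (μ : Measure α) (g : α → ℂ)
    (hg : ∀ x, 0 ≤ g x) : 0 ≤ ∫ x, g x ∂μ := by
  have : g = fun x => ((g x).re : ℂ) := by
    ext x
    exact (Complex.eq_re_of_ofReal_le (r := 0) (by simpa using hg x))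
  rw [this]
  simp only
  rw [integral_complex_ofReal]
  exact_mod_cast integral_nonneg fun x => ((cplx_nonneg_iff _).1 (hg x)).1

lemma gauss_integrable {ε : ℝ} (hε : 0 < ε) : Integrable (fun t : ℝ => cexp (-(ε : ℂ) * t ^ 2)) :=
  integrable_cexp_neg_mul_sq (by simpa using hε)

lemma norm_gauss (ε t : ℝ) : ‖cexp (-(ε : ℂ) * t ^ 2)‖ = Real.exp (-ε * t ^ 2) := by
  rw [Complex.norm_exp]
  congr 1
  have : (-(ε : ℂ) * t ^ 2) = ((-ε * t ^ 2 : ℝ) : ℂ) := by push_cast; rfl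
  rw [this, Complex.ofReal_re]

lemma norm_osc (a t : ℝ) : ‖cexp (-(I * a * t))‖ = 1 := by
  rw [Complex.norm_exp]; simp

lemma norm_osc' (a t : ℝ) : ‖cexp (I * a * t)‖ = 1 := by
  rw [Complex.norm_exp]; simp

lemma sqrt_nonneg_cpx {x : ℝ} (hx : 0 ≤ x) : (0 : ℂ) ≤ (x : ℂ) ^ (1 / 2 : ℂ) := by
  have h : ((x ^ (1 / 2 : ℝ) : ℝ) : ℂ) = (x : ℂ) ^ (1 / 2 : ℂ) := by
    rw [Complex.ofReal_cpow hx]; norm_num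
  rw [← h]
  exact_mod_cast Real.rpow_nonneg hx _

lemma char_gpos (f : ℝ → ℂ) (h : IsCharFun f) (ε : ℝ) (hε : 0 < ε) (a : ℝ) : 0 ≤ Fg f ε a := by
  obtain ⟨σ, hσ, hf⟩ := h
  unfold Fg
  have h1 : ∀ t : ℝ, f t * (cexp (-(ε : ℂ) * t ^ 2) * cexp (-(I * a * t)))
      = ∫ u : ℝ, cexp (I * t * u) * (cexp (-(ε : ℂ) * t ^ 2) * cexp (-(I * a * t))) ∂σ := by
    intro t
    rw [hf, integral_mul_const]
  simp_rw [h1]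
  rw [integral_integral_swap]
  · refine cintegral_nonneg _ _ fun u => ?_
    have h2 : ∀ t : ℝ, cexp (I * t * u) * (cexp (-(ε : ℂ) * t ^ 2) * cexp (-(I * a * t)))
        = cexp (I * ((u - a : ℝ) : ℂ) * t) * cexp (-(ε : ℂ) * t ^ 2) := by
      intro t
      rw [← Complex.exp_add, ← Complex.exp_add, ← Complex.exp_add]
      congr 1
      push_cast
      ring
    simp_rw [h2]
    rw [fourierIntegral_gaussian (by simpa using hε)]
    refine mul_nonneg ?_ ?_
    · have := sqrt_nonneg_cpx (x := Real.pi / ε) (by positivity)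
      push_cast at this
      exact this
    · have : cexp (-((u - a : ℝ) : ℂ) ^ 2 / (4 * (ε : ℂ)))
          = ((Real.exp (-(u - a) ^ 2 / (4 * ε)) : ℝ) : ℂ) := by
        push_cast; rfl
      rw [this]
      exact_mod_cast (Real.exp_pos _).le
  · have hi : Integrable (fun z : ℝ × ℝ => cexp (-(ε : ℂ) * z.1 ^ 2) * (1 : ℂ))
        ((volume : Measure ℝ).prod σ) :=
      (gauss_integrable hε).mul_prod (integrable_const (1 : ℂ))
    refine hi.norm.mono' (Continuous.aestronglyMeasurable ?_) (ae_of_all _ fun z => ?_)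
    · simp only [Function.uncurry_def]
      fun_prop
    · simp only [Function.uncurry_def, norm_mul, norm_osc, norm_osc', norm_one]
      simp

lemma pow_exp_integrable (n : ℕ) :
    IntegrableOn (fun s : ℝ => s ^ n * Real.exp (-s)) (Ioi 0) := by
  have := Real.GammaIntegral_convergent (s := (n : ℝ) + 1) (by positivity)
  refine this.congr_fun (fun s hs => ?_) measurableSet_Ioi
  simp only [add_sub_cancel_right, Real.rpow_natCast]
  ring

lemma norm_lap (n : ℕ) (x s : ℝ) (hs : 0 ≤ s) :
    ‖(s : ℂ) ^ n * cexp (-(s * (1 + I * x)))‖ = s ^ n * Real.exp (-s) := by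
  rw [norm_mul, Complex.norm_exp, norm_pow, Complex.norm_real, Real.norm_of_nonneg hs]
  simp

lemma lap_integrable (n : ℕ) (x : ℝ) :
    IntegrableOn (fun s : ℝ => (s : ℂ) ^ n * cexp (-(s * (1 + I * x)))) (Ioi 0) := by
  refine (pow_exp_integrable n).mono' (Continuous.aestronglyMeasurable (by fun_prop)) ?_
  filter_upwards [ae_restrict_mem measurableSet_Ioi] with s hs
  exact (norm_lap n x s (mem_Ioi.1 hs).le).le

lemma one_add_ne (x : ℝ) : (1 : ℂ) + I * x ≠ 0 := by
  have := ne_zero_of_ne (y := 1) one_ne_zero x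
  simpa using this

lemma lap_deriv (n : ℕ) (x s : ℝ) :
    HasDerivAt (fun s : ℝ => (s : ℂ) ^ n * cexp (-(s * (1 + I * x))))
      ((n * (s : ℂ) ^ (n - 1)) * cexp (-(s * (1 + I * x)))
        - (1 + I * x) * ((s : ℂ) ^ n * cexp (-(s * (1 + I * x))))) s := by
  have h0 : HasDerivAt (fun s : ℝ => (s : ℂ)) 1 s := Complex.ofRealCLM.hasDerivAt
  have h1 := h0.fun_pow n
  have h2 := ((h0.mul_const (1 + I * (x : ℂ))).fun_neg).cexp
  refine (h1.mul h2).congr_deriv ?_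
  ring

lemma lap_tendsto (n : ℕ) (x : ℝ) :
    Tendsto (fun s : ℝ => (s : ℂ) ^ n * cexp (-(s * (1 + I * x)))) atTop (𝓝 0) := by
  rw [tendsto_zero_iff_norm_tendsto_zero]
  refine (Real.tendsto_pow_mul_exp_neg_atTop_nhds_zero n).congr' ?_
  filter_upwards [eventually_ge_atTop 0] with s hs
  exact (norm_lap n x s hs).symm

lemma lap_eq (x : ℝ) (n : ℕ) :
    ∫ s : ℝ in Ioi 0, (s : ℂ) ^ n * cexp (-(s * (1 + I * x)))
      = n.factorial / (1 + I * x) ^ (n + 1) := by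
  have hne := one_add_ne x
  induction n with
  | zero =>
    have := integral_Ioi_of_hasDerivAt_of_tendsto' (a := 0) (fun s _ => lap_deriv 0 x s)
      (by simpa [IntegrableOn] using ((lap_integrable 0 x).const_mul (1 + I * (x : ℂ))).neg) (lap_tendsto 0 x)
    simp only [Nat.cast_zero, zero_mul, zero_sub, integral_neg, integral_const_mul] at this
    simp at this
    simp
    field_simp
    exact this
  | succ n ih =>
    have e : ∀ s : ℝ, (((n + 1 : ℕ) : ℂ) * (s : ℂ) ^ (n + 1 - 1)) * cexp (-(s * (1 + I * x)))
        = ((n + 1 : ℕ) : ℂ) * ((s : ℂ) ^ n * cexp (-(s * (1 + I * x)))) := by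
      intro s; rw [Nat.add_sub_cancel]; ring
    have hd := fun s : ℝ => lap_deriv (n + 1) x s
    simp_rw [e] at hd
    have := integral_Ioi_of_hasDerivAt_of_tendsto' (a := 0) (fun s _ => hd s)
      (((lap_integrable n x).const_mul _).sub ((lap_integrable (n + 1) x).const_mul _))
      (lap_tendsto (n + 1) x)
    rw [integral_sub ((lap_integrable n x).const_mul _) ((lap_integrable (n + 1) x).const_mul _),
      integral_const_mul, integral_const_mul, ih] at this
    simp only [Complex.ofReal_zero, zero_pow (Nat.succ_ne_zero n), zero_mul, sub_zero] at this
    rw [eq_div_iff (pow_ne_zero _ hne), Nat.factorial_succ]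
    have h2 := sub_eq_zero.1 this
    have h3 : (1 + I * (x : ℂ)) ^ (n + 1) *
      ((((n + 1 : ℕ) : ℂ)) * ((n.factorial : ℂ) / (1 + I * (x : ℂ)) ^ (n + 1)))
        = ((n + 1 : ℕ) : ℂ) * n.factorial := by
      field_simp
    rw [h2] at h3
    push_cast at h3 ⊢
    rw [← h3]
    ring

lemma Q_integrable (f : ℝ → ℂ) (hc : Continuous f)
    (hint : Integrable (fun t : ℝ => ‖f t‖ / (1 + |t|))) (n : ℕ) (r : ℝ) (hr : r ≠ 0) :
    Integrable (fun t : ℝ => f t / (1 + I * r * t) ^ (n + 1)) := by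
  have h := (J_integrable f hc hint n r⁻¹ (inv_ne_zero hr)).const_mul (((r : ℂ)⁻¹) ^ (n + 1))
  refine h.congr (ae_of_all _ fun t => ?_)
  have hr' : (r : ℂ) ≠ 0 := by exact_mod_cast hr
  have : 1 + I * (r : ℂ) * t = r * (((r⁻¹ : ℝ) : ℂ) + I * t) := by
    push_cast; field_simp
  simp only
  rw [this, mul_pow, inv_pow]
  rw [div_mul_eq_div_div, div_eq_mul_inv (f t)]
  ring

lemma fgauss_integrable (f : ℝ → ℂ) (hc : Continuous f) (hb : ∃ M : ℝ, ∀ x : ℝ, ‖f x‖ ≤ M)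
    {ε : ℝ} (hε : 0 < ε) : Integrable (fun t : ℝ => f t * cexp (-(ε : ℂ) * t ^ 2)) := by
  obtain ⟨M, hM⟩ := hb
  exact (gauss_integrable hε).bdd_mul (c := M) hc.aestronglyMeasurable (ae_of_all _ hM)

lemma gpos_pos (f : ℝ → ℂ) (hc : Continuous f) (hb : ∃ M : ℝ, ∀ x : ℝ, ‖f x‖ ≤ M)
    (hint : Integrable (fun t : ℝ => ‖f t‖ / (1 + |t|)))
    (h : ∀ ε : ℝ, 0 < ε → ∀ a : ℝ, 0 ≤ Fg f ε a) (n : ℕ) (r : ℝ) (hr : r ≠ 0) :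
    0 ≤ Qint f n r := by
  have hQ := Q_integrable f hc hint n r hr
  have hlim : Tendsto (fun k : ℕ => ∫ t : ℝ,
      (f t / (1 + I * r * t) ^ (n + 1)) * cexp (-((1 / ((k : ℝ) + 1) : ℝ) : ℂ) * t ^ 2)) atTop
      (𝓝 (Qint f n r)) := by
    unfold Qint
    refine tendsto_integral_of_dominated_convergence _ (fun k => ?_) hQ.norm (fun k => ?_) ?_
    · exact hQ.aestronglyMeasurable.mul (Continuous.aestronglyMeasurable (by fun_prop))
    · refine ae_of_all _ fun t => ?_
      rw [norm_mul, norm_gauss]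
      refine mul_le_of_le_one_right (norm_nonneg _) ?_
      rw [Real.exp_le_one_iff]
      have : 0 ≤ 1 / ((k : ℝ) + 1) * t ^ 2 := by positivity
      linarith
    · refine ae_of_all _ fun t => ?_
      have h1 : Tendsto (fun k : ℕ => (((1 / ((k : ℝ) + 1) : ℝ)) : ℂ)) atTop (𝓝 ((0 : ℝ) : ℂ)) :=
        (Complex.continuous_ofReal.tendsto 0).comp tendsto_one_div_add_atTop_nhds_zero_nat
      have h2 := ((h1.neg.mul_const ((t : ℂ) ^ 2)).cexp).const_mul (f t / (1 + I * r * t) ^ (n + 1))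
      simpa using h2
  refine ge_of_tendsto' hlim fun k => ?_
  set ε : ℝ := 1 / ((k : ℝ) + 1) with hε
  have hε0 : 0 < ε := by positivity
  have hfac : (0 : ℂ) ≤ (n.factorial : ℂ)⁻¹ := by
    have h0 : (0 : ℝ) ≤ (n.factorial : ℝ)⁻¹ := by positivity
    have h1 := Complex.zero_le_real.2 h0
    push_cast at h1
    exact h1
  suffices hs : 0 ≤ (n.factorial : ℂ) * ∫ t : ℝ,
      (f t / (1 + I * r * t) ^ (n + 1)) * cexp (-(ε : ℂ) * t ^ 2) by
    have h1 := mul_nonneg hfac hs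
    rwa [inv_mul_cancel_left₀ (by exact_mod_cast n.factorial_ne_zero)] at h1
  rw [← integral_const_mul]
  have e1 : ∀ t : ℝ, (n.factorial : ℂ) * ((f t / (1 + I * r * t) ^ (n + 1))
      * cexp (-(ε : ℂ) * t ^ 2)) = ∫ s : ℝ in Ioi 0,
        (f t * cexp (-(ε : ℂ) * t ^ 2)) * ((s : ℂ) ^ n * cexp (-(s * (1 + I * (r * t : ℝ))))) := by
    intro t
    rw [integral_const_mul, lap_eq]
    push_cast
    rw [← mul_assoc I]
    ring
  simp_rw [e1]
  rw [integral_integral_swap]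
  · have e2 : ∀ s : ℝ, ∫ t : ℝ, (f t * cexp (-(ε : ℂ) * t ^ 2)) *
        ((s : ℂ) ^ n * cexp (-(s * (1 + I * (r * t : ℝ)))))
        = ((s ^ n * Real.exp (-s) : ℝ) : ℂ) * Fg f ε (s * r) := by
      intro s
      unfold Fg
      rw [← integral_const_mul]
      congr 1
      ext t
      have : cexp (-(s * (1 + I * (r * t : ℝ)))) = cexp (-s) * cexp (-(I * (s * r : ℝ) * t)) := by
        rw [← Complex.exp_add]
        congr 1
        push_cast
        ring
      rw [this]
      push_cast
      ring
    simp_rw [e2]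
    have : ∀ s ∈ Ioi (0 : ℝ), ((s ^ n * Real.exp (-s) : ℝ) : ℂ) * Fg f ε (s * r)
        = (Ioi (0 : ℝ)).indicator (fun s : ℝ => ((s ^ n * Real.exp (-s) : ℝ) : ℂ) * Fg f ε (s * r)) s := by
      intro s hs
      rw [indicator_of_mem hs]
    rw [setIntegral_congr_fun measurableSet_Ioi this]
    refine cintegral_nonneg _ _ fun s => ?_
    by_cases hs : s ∈ Ioi (0 : ℝ)
    · rw [indicator_of_mem hs]
      refine mul_nonneg ?_ (h ε hε0 _)
      have hs' := (mem_Ioi.1 hs).le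
      have : 0 ≤ s ^ n * Real.exp (-s) := by positivity
      exact_mod_cast this
    · rw [indicator_of_notMem hs]
  · have hi := (fgauss_integrable f hc hb hε0).mul_prod ((pow_exp_integrable n).ofReal (𝕜 := ℂ))
    refine hi.norm.mono' (Continuous.aestronglyMeasurable ?_) ?_
    · simp only [Function.uncurry_def]
      fun_prop
    · have hae : ∀ᵐ z ∂((volume : Measure ℝ).prod (volume.restrict (Ioi (0 : ℝ)))),
          z.2 ∈ Ioi (0 : ℝ) :=
        Measure.quasiMeasurePreserving_snd.ae (ae_restrict_mem measurableSet_Ioi)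
      filter_upwards [hae] with z hz
      simp only [Function.uncurry_def]
      rw [norm_mul, norm_lap n _ _ (mem_Ioi.1 hz).le, norm_mul (f z.1 * _)]
      gcongr
      simp only [RCLike.norm_ofReal]
      exact le_abs_self _

noncomputable def qq (N s : ℝ) : ℝ := 1 - (1 + (N * s) ^ 2)⁻¹

lemma qq_nonneg (N s : ℝ) : 0 ≤ qq N s := by
  unfold qq
  have : (1 + (N * s) ^ 2)⁻¹ ≤ 1 := inv_le_one_of_one_le₀ (by nlinarith [sq_nonneg (N * s)])
  linarith

lemma qq_le_one (N s : ℝ) : qq N s ≤ 1 := by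
  unfold qq
  have : 0 ≤ (1 + (N * s) ^ 2)⁻¹ := by positivity
  linarith

lemma qq_eq (N s : ℝ) : qq N s = (N * s) ^ 2 / (1 + (N * s) ^ 2) := by
  unfold qq
  have : 0 < 1 + (N * s) ^ 2 := by positivity
  field_simp
  ring

lemma qq_le (N s : ℝ) (hN : 0 < N) : qq N s ≤ N * |s| := by
  rw [qq_eq, div_le_iff₀ (by positivity)]
  have h : (N * s) ^ 2 = (N * |s|) ^ 2 := by rw [mul_pow, mul_pow, sq_abs]
  rw [h]
  have h0 : 0 ≤ N * |s| := by positivity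
  nlinarith [sq_nonneg (N * |s| - 1), mul_nonneg h0 (sq_nonneg (N * |s| - 1))]

noncomputable def qq' (N s : ℝ) : ℝ := 2 * (N * s) * N / (1 + (N * s) ^ 2) ^ 2

lemma qq_deriv (N s : ℝ) : HasDerivAt (qq N) (qq' N s) s := by
  have hne : 1 + (N * s) ^ 2 ≠ 0 := by positivity
  have h1 : HasDerivAt (fun s : ℝ => 1 + (N * s) ^ 2) (2 * (N * s) * N) s := by
    have := ((((hasDerivAt_id s).const_mul N).fun_pow 2).const_add 1)
    refine this.congr_deriv ?_
    simp
  have h2 := (h1.fun_inv hne).const_sub 1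
  refine h2.congr_deriv ?_
  unfold qq'
  ring

lemma qq'_bound (N s : ℝ) (hN : 0 < N) : |qq' N s| ≤ N * (1 + (N * s) ^ 2)⁻¹ := by
  unfold qq'
  rw [abs_div, abs_mul, abs_mul, abs_of_pos hN, abs_of_pos (by positivity : 0 < (1 + (N * s) ^ 2) ^ 2),
    div_le_iff₀ (by positivity)]
  have : N * (1 + (N * s) ^ 2)⁻¹ * (1 + (N * s) ^ 2) ^ 2 = (1 + (N * s) ^ 2) * N := by
    have : 1 + (N * s) ^ 2 ≠ 0 := by positivity
    field_simp
  rw [this]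
  gcongr
  rw [← sq_abs (N * s), abs_two]
  nlinarith [sq_nonneg (|N * s| - 1)]

lemma qq'_cont (N : ℝ) : Continuous (qq' N) := by
  unfold qq'
  refine Continuous.div (by fun_prop) (by fun_prop) fun s => ?_
  positivity

lemma qq_cont (N : ℝ) : Continuous (qq N) := by
  unfold qq
  refine continuous_const.sub (Continuous.inv₀ (by fun_prop) fun s => ?_)
  positivity

lemma scaled_integrable (N : ℝ) (hN : 0 < N) :
    Integrable (fun s : ℝ => N * (1 + (N * s) ^ 2)⁻¹) :=
  (integrable_inv_one_add_sq.comp_mul_left' hN.ne').const_mul N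

lemma scaled_integral (N : ℝ) (hN : 0 < N) :
    ∫ s : ℝ, N * (1 + (N * s) ^ 2)⁻¹ = Real.pi := by
  rw [integral_const_mul, Measure.integral_comp_mul_left (fun x : ℝ => (1 + x ^ 2)⁻¹),
    integral_univ_inv_one_add_sq, abs_of_pos (inv_pos.2 hN), smul_eq_mul]
  field_simp

lemma one_le_norm (r t : ℝ) : 1 ≤ ‖1 + I * (r : ℂ) * t‖ := by
  have := Complex.abs_re_le_norm (1 + I * (r : ℂ) * t)
  simpa using this

lemma norm_inv_pow_le (r t : ℝ) (m : ℕ) : ‖((1 + I * (r : ℂ) * t) ^ m)⁻¹‖ ≤ 1 := by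
  rw [norm_inv, norm_pow]
  exact inv_le_one_of_one_le₀ (one_le_pow₀ (one_le_norm r t))

lemma base_ne (r t : ℝ) : 1 + I * (r : ℂ) * t ≠ 0 := by
  intro h
  have := one_le_norm r t
  rw [h, norm_zero] at this
  linarith

lemma norm_inv_pow_le' (r t : ℝ) (hr : r ≠ 0) (m : ℕ) :
    ‖((1 + I * (r : ℂ) * t) ^ (m + 1))⁻¹‖ ≤ 2 * (1 + |r|⁻¹) * (1 + |t|)⁻¹ := by
  have h1 := one_le_norm r t
  have h2 : |r| * |t| ≤ ‖1 + I * (r : ℂ) * t‖ := by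
    have := Complex.abs_im_le_norm (1 + I * (r : ℂ) * t)
    simpa [abs_mul] using this
  have hr' : 0 < |r| := abs_pos.2 hr
  have ht := abs_nonneg t
  rw [norm_inv, norm_pow, ← div_eq_mul_inv, le_div_iff₀ (by positivity), inv_mul_le_iff₀ (by positivity)]
  have h3 : ‖1 + I * (r : ℂ) * t‖ ≤ ‖1 + I * (r : ℂ) * t‖ ^ (m + 1) :=
    le_self_pow₀ h1 (by omega)
  have h4 : (1 + |t|) ≤ (1 + |r|⁻¹) * (1 + |r| * |t|) := by
    have : (1 + |r|⁻¹) * (1 + |r| * |t|) = 1 + |r|⁻¹ + |r| * |t| + |t| := by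
      field_simp; ring
    rw [this]
    have : 0 ≤ |r|⁻¹ := by positivity
    have : 0 ≤ |r| * |t| := by positivity
    linarith
  calc 1 + |t| ≤ (1 + |r|⁻¹) * (1 + |r| * |t|) := h4
    _ ≤ (1 + |r|⁻¹) * (2 * ‖1 + I * (r : ℂ) * t‖ ^ (m + 1)) := by gcongr; linarith
    _ = _ := by ring

lemma C_limit (t s : ℝ) : Tendsto (fun k : ℕ =>
    ((1 + I * ((s / ((k : ℝ) + 1) : ℝ) : ℂ) * t) ^ (k + 1 + 1))⁻¹) atTop
    (𝓝 (cexp (-(I * t * s)))) := by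
  have h1 := (Complex.tendsto_one_add_div_pow_exp (I * t * s)).comp (tendsto_add_atTop_nat 1)
  have h0 : Tendsto (fun k : ℕ => ((1 / ((k : ℝ) + 1) : ℝ) : ℂ)) atTop (𝓝 ((0 : ℝ) : ℂ)) :=
    (Complex.continuous_ofReal.tendsto 0).comp tendsto_one_div_add_atTop_nhds_zero_nat
  have h2 : Tendsto (fun k : ℕ => 1 + (I * t * s) * ((1 / ((k : ℝ) + 1) : ℝ) : ℂ)) atTop (𝓝 1) := by
    simpa using (h0.const_mul (I * t * s)).const_add 1
  have h3 := (h1.mul h2).inv₀ (by simp)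
  rw [mul_one, ← Complex.exp_neg] at h3
  refine h3.congr fun k => ?_
  congr 1
  rw [pow_succ]
  simp only [Function.comp]
  congr 2
  · push_cast; ring
  · push_cast; ring

section
variable (f : ℝ → ℂ) (g g' : ℝ → ℝ)

lemma C_fubini (hc : Continuous f) (hint : Integrable (fun t : ℝ => ‖f t‖ / (1 + |t|)))
    (hgc : Continuous g) (g0 : ∀ s, 0 ≤ g s) (hgi : Integrable g) (k : ℕ) :
    Integrable (Function.uncurry fun (t s : ℝ) => f t * (((g s * qq ((k : ℝ) + 1) s : ℝ) : ℂ) *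
      ((1 + I * ((s / ((k : ℝ) + 1) : ℝ) : ℂ) * t) ^ (k + 1 + 1))⁻¹)) := by
  set N : ℝ := (k : ℝ) + 1 with hN
  have hN0 : 0 < N := by positivity
  have hb := (hint.mul_prod hgi).const_mul (2 * (1 + N * N))
  refine hb.mono' (Continuous.aestronglyMeasurable ?_) (ae_of_all _ fun z => ?_)
  · simp only [Function.uncurry_def]
    have := qq_cont N
    refine Continuous.mul (by fun_prop) (Continuous.mul (by fun_prop)
      (Continuous.inv₀ (by fun_prop) fun z => pow_ne_zero _ (base_ne _ _)))
  · obtain ⟨t, s⟩ := z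
    simp only [Function.uncurry_def]
    rw [norm_mul, norm_mul, Complex.norm_real, Real.norm_of_nonneg (mul_nonneg (g0 s) (qq_nonneg _ _))]
    by_cases hs : s = 0
    · subst hs
      have : qq N 0 = 0 := by simp [qq]
      rw [this]
      have := g0 0
      simp only [mul_zero, zero_mul]
      positivity
    have hr : s / N ≠ 0 := div_ne_zero hs hN0.ne'
    have h1 := norm_inv_pow_le' (s / N) t hr (k + 1)
    have hs' : 0 < |s| := abs_pos.2 hs
    have h2 : qq N s * (1 + |s / N|⁻¹) ≤ 1 + N * N := by
      have e : |s / N|⁻¹ = N * |s|⁻¹ := by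
        rw [abs_div, abs_of_pos hN0, inv_div]; rfl
      rw [e, mul_add, mul_one]
      refine add_le_add (qq_le_one _ _) ?_
      calc qq N s * (N * |s|⁻¹) ≤ (N * |s|) * (N * |s|⁻¹) := by
            gcongr
            exact qq_le N s hN0
        _ = N * N := by field_simp
    have hq := qq_nonneg N s
    have hg := g0 s
    calc ‖f t‖ * (g s * qq N s * ‖((1 + I * ((s / N : ℝ) : ℂ) * t) ^ (k + 1 + 1))⁻¹‖)
        ≤ ‖f t‖ * (g s * qq N s * (2 * (1 + |s / N|⁻¹) * (1 + |t|)⁻¹)) := by gcongr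
      _ = ‖f t‖ * (g s * 2 * (1 + |t|)⁻¹) * (qq N s * (1 + |s / N|⁻¹)) := by ring
      _ ≤ ‖f t‖ * (g s * 2 * (1 + |t|)⁻¹) * (1 + N * N) := by gcongr
      _ = _ := by rw [div_eq_mul_inv]; ring

noncomputable def psi (k : ℕ) (t : ℝ) : ℂ := ∫ s : ℝ, (((g s * qq ((k : ℝ) + 1) s : ℝ) : ℂ) *
      ((1 + I * ((s / ((k : ℝ) + 1) : ℝ) : ℂ) * t) ^ (k + 1 + 1))⁻¹)

lemma C_nonneg (hc : Continuous f) (hint : Integrable (fun t : ℝ => ‖f t‖ / (1 + |t|)))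
    (hgc : Continuous g) (g0 : ∀ s, 0 ≤ g s) (hgi : Integrable g) (k : ℕ)
    (hpos : ∀ (n : ℕ) (r : ℝ), r ≠ 0 → 0 ≤ Qint f n r) :
    0 ≤ ∫ t : ℝ, f t * psi g k t := by
  have hF := C_fubini f g hc hint hgc g0 hgi k
  unfold psi
  simp_rw [← integral_const_mul]
  rw [integral_integral_swap hF]
  refine cintegral_nonneg _ _ fun s => ?_
  have e : ∀ t : ℝ, f t * (((g s * qq ((k : ℝ) + 1) s : ℝ) : ℂ) *
      ((1 + I * ((s / ((k : ℝ) + 1) : ℝ) : ℂ) * t) ^ (k + 1 + 1))⁻¹)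
      = ((g s * qq ((k : ℝ) + 1) s : ℝ) : ℂ) *
        (f t / (1 + I * ((s / ((k : ℝ) + 1) : ℝ) : ℂ) * t) ^ (k + 1 + 1)) := by
    intro t; rw [div_eq_mul_inv]; ring
  simp_rw [e]
  rw [integral_const_mul]
  change 0 ≤ _ * Qint f (k + 1) (s / ((k : ℝ) + 1))
  by_cases hs : s = 0
  · subst hs
    simp [qq]
  · refine mul_nonneg ?_ (hpos _ _ (div_ne_zero hs (by positivity)))
    exact Complex.zero_le_real.2 (mul_nonneg (g0 s) (qq_nonneg _ _))

lemma psi_meas (hc : Continuous f) (hint : Integrable (fun t : ℝ => ‖f t‖ / (1 + |t|)))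
    (hgc : Continuous g) (g0 : ∀ s, 0 ≤ g s) (hgi : Integrable g) (k : ℕ) :
    AEStronglyMeasurable (fun t : ℝ => f t * psi g k t) := by
  have hF := (C_fubini f g hc hint hgc g0 hgi k).integral_prod_left
  refine hF.aestronglyMeasurable.congr (ae_of_all _ fun t => ?_)
  simp only [Function.uncurry_def, psi]
  rw [integral_const_mul]

lemma u_integrable (hgc : Continuous g) (g0 : ∀ s, 0 ≤ g s) (hgi : Integrable g) (N : ℝ) :
    Integrable (fun s : ℝ => ((g s * qq N s : ℝ) : ℂ)) := by
  have := qq_cont N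
  refine hgi.mono' (Continuous.aestronglyMeasurable (by fun_prop)) (ae_of_all _ fun s => ?_)
  rw [Complex.norm_real, Real.norm_of_nonneg (mul_nonneg (g0 s) (qq_nonneg _ _))]
  exact mul_le_of_le_one_right (g0 s) (qq_le_one _ _)

lemma u_norm (g0 : ∀ s, 0 ≤ g s) (N s : ℝ) : ‖((g s * qq N s : ℝ) : ℂ)‖ ≤ g s := by
  rw [Complex.norm_real, Real.norm_of_nonneg (mul_nonneg (g0 s) (qq_nonneg _ _))]
  exact mul_le_of_le_one_right (g0 s) (qq_le_one _ _)

lemma term_norm (g0 : ∀ s, 0 ≤ g s) (N s r t : ℝ) (m : ℕ) :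
    ‖((g s * qq N s : ℝ) : ℂ) * ((1 + I * (r : ℂ) * t) ^ m)⁻¹‖ ≤ g s := by
  rw [norm_mul]
  calc _ ≤ g s * 1 := mul_le_mul (u_norm g g0 N s) (norm_inv_pow_le r t m) (norm_nonneg _) (g0 s)
    _ = g s := mul_one _

lemma psi_bound0 (g0 : ∀ s, 0 ≤ g s) (hgi : Integrable g) (k : ℕ) (t : ℝ) :
    ‖psi g k t‖ ≤ ∫ s, g s :=
  norm_integral_le_of_norm_le hgi (ae_of_all _ fun s => term_norm g g0 _ s _ t _)

lemma psi_bound1 (hg : ∀ s, HasDerivAt g (g' s) s) (hgc' : Continuous g')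
    (g0 : ∀ s, 0 ≤ g s) (g1 : ∀ s, g s ≤ 1)
    (hgi : Integrable g) (hgi' : Integrable g') (k : ℕ) (t : ℝ) :
    |t| * ‖psi g k t‖ ≤ (∫ s, |g' s|) + Real.pi := by
  by_cases ht : t = 0
  · subst ht
    have : 0 ≤ ∫ s, |g' s| := integral_nonneg fun s => abs_nonneg _
    have := Real.pi_pos
    simp only [abs_zero, zero_mul]
    linarith
  have hgc : Continuous g := continuous_iff_continuousAt.2 fun s => (hg s).continuousAt
  unfold psi
  set N : ℝ := (k : ℝ) + 1 with hN
  have hN0 : 0 < N := by positivity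
  have hNc : (N : ℂ) ≠ 0 := by exact_mod_cast hN0.ne'
  have htc : (t : ℂ) ≠ 0 := by exact_mod_cast ht
  set u : ℝ → ℂ := fun s => ((g s * qq N s : ℝ) : ℂ) with hu
  set u' : ℝ → ℂ := fun s => ((g' s * qq N s + g s * qq' N s : ℝ) : ℂ) with hu'
  set v : ℝ → ℂ := fun s => -(I * t)⁻¹ * ((1 + I * ((s / N : ℝ) : ℂ) * t) ^ (k + 1))⁻¹ with hv
  set v' : ℝ → ℂ := fun s => ((1 + I * ((s / N : ℝ) : ℂ) * t) ^ (k + 1 + 1))⁻¹ with hv'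
  have hqc := qq_cont N
  have hqc' := qq'_cont N
  have hvc : ∀ m : ℕ, Continuous fun s : ℝ => ((1 + I * ((s / N : ℝ) : ℂ) * t) ^ m)⁻¹ := fun m =>
    Continuous.inv₀ (by fun_prop) fun z => pow_ne_zero _ (base_ne _ _)
  have hudiff : ∀ s, HasDerivAt u (u' s) s := fun s =>
    ((hg s).mul (qq_deriv N s)).ofReal_comp
  have hvdiff : ∀ s, HasDerivAt v (v' s) s := by
    intro s
    have hne := base_ne (s / N) t
    have h0 : HasDerivAt (fun s : ℝ => 1 + I * ((s / N : ℝ) : ℂ) * t) (I * ((1 / N : ℝ) : ℂ) * t) s :=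
      (((((hasDerivAt_id s).div_const N).ofReal_comp).const_mul I).mul_const (t : ℂ)).const_add 1
    have h1 := ((h0.fun_pow (k + 1)).fun_inv (pow_ne_zero _ hne)).const_mul (-(I * (t : ℂ))⁻¹)
    refine h1.congr_deriv ?_
    have hk : ((k + 1 : ℕ) : ℂ) = (N : ℂ) := by rw [hN]; push_cast; rfl
    simp only [hv', Nat.add_sub_cancel]
    rw [hk]
    generalize (1 + I * ((s / N : ℝ) : ℂ) * t) = w at hne
    have hI := Complex.I_ne_zero
    push_cast
    field_simp
    ring
  have hubound : ∀ s, ‖u' s‖ ≤ |g' s| + N * (1 + (N * s) ^ 2)⁻¹ := by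
    intro s
    rw [hu', Complex.norm_real, Real.norm_eq_abs]
    refine (abs_add_le _ _).trans (add_le_add ?_ ?_)
    · rw [abs_mul, abs_of_nonneg (qq_nonneg N s)]
      exact mul_le_of_le_one_right (abs_nonneg _) (qq_le_one _ _)
    · rw [abs_mul, abs_of_nonneg (g0 s)]
      calc g s * |qq' N s| ≤ 1 * |qq' N s| := by gcongr; exact g1 s
        _ ≤ _ := by rw [one_mul]; exact qq'_bound N s hN0
  have hbi : Integrable fun s => |g' s| + N * (1 + (N * s) ^ 2)⁻¹ :=
    hgi'.abs.add (scaled_integrable N hN0)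
  have hvb : ∀ s, ‖v s‖ ≤ |t|⁻¹ := by
    intro s
    rw [hv, norm_mul, norm_neg, norm_inv, norm_mul, Complex.norm_I, one_mul, Complex.norm_real,
      Real.norm_eq_abs]
    exact mul_le_of_le_one_right (by positivity) (norm_inv_pow_le _ _ _)
  have huint : Integrable u := u_integrable g hgc g0 hgi N
  have hu'int : Integrable u' :=
    hbi.mono' (Continuous.aestronglyMeasurable (by fun_prop)) (ae_of_all _ hubound)
  have hvcont : Continuous v := continuous_const.mul (hvc _)
  have hprod : ∀ s, ‖u' s * v s‖ ≤ (|g' s| + N * (1 + (N * s) ^ 2)⁻¹) * |t|⁻¹ := by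
    intro s
    rw [norm_mul]
    exact mul_le_mul (hubound s) (hvb s) (norm_nonneg _) ((norm_nonneg _).trans (hubound s))
  have ibp := integral_mul_deriv_eq_deriv_mul_of_integrable (u := u) (v := v) (u' := u') (v' := v')
    (fun s _ => hudiff s) (fun s _ => hvdiff s)
    (huint.mul_bdd (c := 1) (hvc _).aestronglyMeasurable (ae_of_all _ fun s => norm_inv_pow_le _ _ _))
    (hu'int.mul_bdd (c := |t|⁻¹) hvcont.aestronglyMeasurable (ae_of_all _ hvb))
    (huint.mul_bdd (c := |t|⁻¹) hvcont.aestronglyMeasurable (ae_of_all _ hvb))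
  have hfin : ‖∫ s, u s * v' s‖ ≤ ((∫ s, |g' s|) + Real.pi) * |t|⁻¹ := by
    rw [ibp, norm_neg]
    refine (norm_integral_le_of_norm_le (hbi.mul_const _) (ae_of_all _ hprod)).trans ?_
    rw [integral_mul_const, integral_add hgi'.abs (scaled_integrable N hN0), scaled_integral N hN0]
  have ht' : 0 < |t| := abs_pos.2 ht
  calc |t| * ‖∫ s, u s * v' s‖ ≤ |t| * (((∫ s, |g' s|) + Real.pi) * |t|⁻¹) := by gcongr
    _ = _ := by field_simp

lemma psi_limit (hgc : Continuous g) (g0 : ∀ s, 0 ≤ g s) (hgi : Integrable g) (t : ℝ) :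
    Tendsto (fun k => psi g k t) atTop (𝓝 (∫ s : ℝ, (g s : ℂ) * cexp (-(I * t * s)))) := by
  unfold psi
  refine tendsto_integral_of_dominated_convergence g (fun k => ?_) hgi
    (fun k => ae_of_all _ fun s => term_norm g g0 _ s _ t _) ?_
  · have := qq_cont ((k : ℝ) + 1)
    refine Continuous.aestronglyMeasurable (Continuous.mul (by fun_prop)
      (Continuous.inv₀ (by fun_prop) fun z => pow_ne_zero _ (base_ne _ _)))
  · have h0 : ∀ᵐ s : ℝ, s ≠ 0 := by
      simp [ae_iff]
    filter_upwards [h0] with s hs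
    refine Tendsto.mul ?_ (C_limit t s)
    refine (Complex.continuous_ofReal.tendsto (g s)).comp ?_
    have h1 : Tendsto (fun k : ℕ => qq ((k : ℝ) + 1) s) atTop (𝓝 (1 - 0)) := by
      unfold qq
      refine tendsto_const_nhds.sub (tendsto_inv_atTop_zero.comp ?_)
      refine tendsto_atTop_add_const_left _ _ ?_
      simp_rw [mul_pow]
      refine Tendsto.atTop_mul_const (by positivity) ?_
      refine (tendsto_pow_atTop two_ne_zero).comp ?_
      exact tendsto_atTop_add_const_right _ _ tendsto_natCast_atTop_atTop
    simpa using h1.const_mul (g s)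

theorem C_general (hc : Continuous f) (hint : Integrable (fun t : ℝ => ‖f t‖ / (1 + |t|)))
    (hpos : ∀ (n : ℕ) (r : ℝ), r ≠ 0 → 0 ≤ Qint f n r)
    (hg : ∀ s, HasDerivAt g (g' s) s) (hgc' : Continuous g')
    (g0 : ∀ s, 0 ≤ g s) (g1 : ∀ s, g s ≤ 1)
    (hgi : Integrable g) (hgi' : Integrable g') :
    0 ≤ ∫ t : ℝ, f t * ∫ s : ℝ, (g s : ℂ) * cexp (-(I * t * s)) := by
  have hgc : Continuous g := continuous_iff_continuousAt.2 fun s => (hg s).continuousAt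
  refine ge_of_tendsto' (f := fun k : ℕ => ∫ t : ℝ, f t * psi g k t) (x := atTop) ?_
    fun k => C_nonneg f g hc hint hgc g0 hgi k hpos
  set C : ℝ := (∫ s, g s) + ((∫ s, |g' s|) + Real.pi) with hC
  refine tendsto_integral_of_dominated_convergence (fun t => C * (‖f t‖ / (1 + |t|)))
    (fun k => psi_meas f g hc hint hgc g0 hgi k) (hint.const_mul C)
    (fun k => ae_of_all _ fun t => ?_) (ae_of_all _ fun t => ?_)
  · have h0 := psi_bound0 g g0 hgi k t
    have h1 := psi_bound1 g g' hg hgc' g0 g1 hgi hgi' k t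
    have ht := abs_nonneg t
    have h2 : ‖psi g k t‖ ≤ C / (1 + |t|) := by
      rw [le_div_iff₀ (by positivity)]
      linarith
    rw [norm_mul]
    calc ‖f t‖ * ‖psi g k t‖ ≤ ‖f t‖ * (C / (1 + |t|)) := by gcongr
      _ = _ := by ring
  · exact (psi_limit g hgc g0 hgi t).const_mul (f t)

end

theorem pos_gpos (f : ℝ → ℂ) (hc : Continuous f)
    (hint : Integrable (fun t : ℝ => ‖f t‖ / (1 + |t|)))
    (hpos : ∀ (n : ℕ) (r : ℝ), r ≠ 0 → 0 ≤ Qint f n r) (ε : ℝ) (hε : 0 < ε) (a : ℝ) :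
    0 ≤ Fg f ε a := by
  set b : ℝ := 1 / (4 * ε) with hb
  have hb0 : 0 < b := by positivity
  have hbc : (b : ℂ) ≠ 0 := by exact_mod_cast hb0.ne'
  have hεc : (ε : ℂ) ≠ 0 := by exact_mod_cast hε.ne'
  have h := C_general f (fun s => Real.exp (-b * (s - a) ^ 2))
    (fun s => Real.exp (-b * (s - a) ^ 2) * (-b * (2 * (s - a)))) hc hint hpos ?_ (by fun_prop)
    (fun s => (Real.exp_pos _).le) ?_ ?_ ?_
  · have e : ∀ t : ℝ, ∫ s : ℝ, ((Real.exp (-b * (s - a) ^ 2) : ℝ) : ℂ) * cexp (-(I * t * s))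
        = (((Real.pi / b : ℝ) : ℂ) ^ (1 / 2 : ℂ)) *
          (cexp (-(ε : ℂ) * t ^ 2) * cexp (-(I * a * t))) := by
      intro t
      rw [← integral_add_right_eq_self _ a]
      have e1 : ∀ s : ℝ, ((Real.exp (-b * (s + a - a) ^ 2) : ℝ) : ℂ) * cexp (-(I * t * ((s + a : ℝ) : ℂ)))
          = cexp (-(I * a * t)) * (cexp (I * (-(t : ℂ)) * s) * cexp (-(b : ℂ) * s ^ 2)) := by
        intro s
        push_cast
        rw [← Complex.exp_add, ← Complex.exp_add, ← Complex.exp_add]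
        congr 1
        ring
      simp_rw [e1]
      rw [integral_const_mul, fourierIntegral_gaussian (by simpa using hb0)]
      have e2 : -(-(t : ℂ)) ^ 2 / (4 * (b : ℂ)) = -(ε : ℂ) * t ^ 2 := by
        rw [hb]; push_cast; field_simp
      rw [e2]
      push_cast
      ring
    simp_rw [e] at h
    have e3 : ∀ t : ℝ, f t * ((((Real.pi / b : ℝ) : ℂ) ^ (1 / 2 : ℂ)) *
          (cexp (-(ε : ℂ) * t ^ 2) * cexp (-(I * a * t))))
        = (((Real.pi / b : ℝ) : ℂ) ^ (1 / 2 : ℂ)) * (f t *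
          (cexp (-(ε : ℂ) * t ^ 2) * cexp (-(I * a * t)))) := by intro t; ring
    simp_rw [e3] at h
    rw [integral_const_mul] at h
    have hx : 0 < Real.pi / b := by positivity
    have hr : ((Real.pi / b : ℝ) : ℂ) ^ (1 / 2 : ℂ) = (((Real.pi / b) ^ (1 / 2 : ℝ) : ℝ) : ℂ) := by
      rw [Complex.ofReal_cpow hx.le]; norm_num
    rw [hr] at h
    have hp : 0 < (Real.pi / b) ^ (1 / 2 : ℝ) := Real.rpow_pos_of_pos hx _
    rw [cplx_nonneg_iff, Complex.re_ofReal_mul, Complex.im_ofReal_mul] at h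
    rw [cplx_nonneg_iff]
    exact ⟨nonneg_of_mul_nonneg_right h.1 hp, (mul_eq_zero.1 h.2).resolve_left hp.ne'⟩
  · intro s
    have h1 : HasDerivAt (fun s : ℝ => -b * (s - a) ^ 2) (-b * (2 * (s - a))) s := by
      refine ((((hasDerivAt_id s).sub_const a).fun_pow 2).const_mul (-b)).congr_deriv ?_
      simp
    exact h1.exp
  · intro s
    rw [Real.exp_le_one_iff]
    have : 0 ≤ b * (s - a) ^ 2 := by positivity
    linarith
  · exact (integrable_exp_neg_mul_sq hb0).comp_sub_right a
  · have h1 := ((integrable_mul_exp_neg_mul_sq hb0).comp_sub_right a).const_mul (-b * 2)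
    refine h1.congr (ae_of_all _ fun s => ?_)
    simp only
    ring

open scoped FourierTransform

lemma fourier_formula (h : ℝ → ℂ) (w : ℝ) :
    𝓕 h w = ∫ t : ℝ, h t * cexp (-(I * (2 * Real.pi * w : ℝ) * t)) := by
  rw [Real.fourier_real_eq_integral_exp_smul]
  congr 1
  ext t
  rw [smul_eq_mul, mul_comm]
  congr 2
  push_cast
  ring

lemma fourier_cont (h : ℝ → ℂ) (hi : Integrable h) : Continuous (𝓕 h) := by
  have : 𝓕 h = fun w : ℝ => ∫ t : ℝ, h t * cexp (-(I * (2 * Real.pi * w : ℝ) * t)) := by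
    ext w; exact fourier_formula h w
  rw [this]
  refine continuous_of_dominated (bound := fun t => ‖h t‖) (fun w => ?_) (fun w => ?_) hi.norm ?_
  · exact hi.aestronglyMeasurable.mul (Continuous.aestronglyMeasurable (by fun_prop))
  · exact ae_of_all _ fun t => by rw [norm_mul, norm_osc, mul_one]
  · exact ae_of_all _ fun t => by fun_prop

lemma fourier_bound (h : ℝ → ℂ) (hc : Continuous h) (hi : Integrable h) (M : ℝ)
    (hM : ∀ t, ‖h t‖ ≤ M) (δ : ℝ) (hδ : 0 < δ) :
    ‖∫ w : ℝ, 𝓕 h w * cexp (-(δ : ℂ) * w ^ 2)‖ ≤ M := by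
  have e1 : ∀ w : ℝ, 𝓕 h w * cexp (-(δ : ℂ) * w ^ 2)
      = ∫ t : ℝ, h t * cexp (-(I * (2 * Real.pi * w : ℝ) * t)) * cexp (-(δ : ℂ) * w ^ 2) := by
    intro w; rw [integral_mul_const, fourier_formula]
  simp_rw [e1]
  rw [integral_integral_swap]
  · have e2 : ∀ t : ℝ, ∫ w : ℝ, h t * cexp (-(I * (2 * Real.pi * w : ℝ) * t)) *
        cexp (-(δ : ℂ) * w ^ 2) = h t * ((((Real.pi / δ : ℝ) : ℂ) ^ (1 / 2 : ℂ)) *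
          cexp (-((Real.pi ^ 2 / δ : ℝ) : ℂ) * t ^ 2)) := by
      intro t
      have e3 : ∀ w : ℝ, h t * cexp (-(I * (2 * Real.pi * w : ℝ) * t)) *
        cexp (-(δ : ℂ) * w ^ 2) = h t * (cexp (I * (-(2 * Real.pi * t : ℝ) : ℂ) * w) *
          cexp (-(δ : ℂ) * w ^ 2)) := by
        intro w
        rw [mul_assoc]
        congr 3
        push_cast
        ring
      simp_rw [e3]
      rw [integral_const_mul, fourierIntegral_gaussian (by simpa using hδ)]
      have hδc : (δ : ℂ) ≠ 0 := by exact_mod_cast hδ.ne'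
      have e4 : -(-(2 * Real.pi * t : ℝ) : ℂ) ^ 2 / (4 * (δ : ℂ))
          = -((Real.pi ^ 2 / δ : ℝ) : ℂ) * t ^ 2 := by
        push_cast; field_simp; ring
      rw [e4]
      push_cast
      rfl
    simp_rw [e2]
    have hx : 0 < Real.pi / δ := by positivity
    have hr : ((Real.pi / δ : ℝ) : ℂ) ^ (1 / 2 : ℂ) = ((√(Real.pi / δ) : ℝ) : ℂ) := by
      rw [Real.sqrt_eq_rpow, Complex.ofReal_cpow hx.le]; norm_num
    have hb0 : 0 < Real.pi ^ 2 / δ := by positivity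
    have hgi := (integrable_exp_neg_mul_sq hb0).const_mul (M * √(Real.pi / δ))
    refine (norm_integral_le_of_norm_le hgi (ae_of_all _ fun t => ?_)).trans ?_
    · rw [hr, norm_mul, norm_mul, norm_gauss, Complex.norm_real, Real.norm_of_nonneg (Real.sqrt_nonneg _),
        mul_assoc]
      gcongr
      exact hM t
    · rw [integral_const_mul, integral_gaussian, mul_assoc, ← Real.sqrt_mul hx.le]
      have : Real.pi / δ * (Real.pi / (Real.pi ^ 2 / δ)) = 1 := by
        have := Real.pi_pos
        field_simp
      rw [this, Real.sqrt_one, mul_one]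
  · have hp := (gauss_integrable hδ).mul_prod hi
    refine hp.norm.mono' (Continuous.aestronglyMeasurable ?_) (ae_of_all _ fun z => ?_)
    · simp only [Function.uncurry_def]
      fun_prop
    · simp only [Function.uncurry_def]
      rw [norm_mul, norm_mul, norm_osc, norm_mul, mul_one, mul_comm]

lemma fourier_integrable (h : ℝ → ℂ) (hc : Continuous h) (hi : Integrable h) (M : ℝ)
    (hM : ∀ t, ‖h t‖ ≤ M) (hpos : ∀ w, 0 ≤ 𝓕 h w) : Integrable (𝓕 h) := by
  have hG := fourier_cont h hi
  have hnorm : ∀ w, ‖𝓕 h w‖ = (𝓕 h w).re := fun w => by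
    have h1 := (cplx_nonneg_iff _).1 (hpos w)
    have h2 : 𝓕 h w = (((𝓕 h w).re : ℝ) : ℂ) := by
      apply Complex.ext <;> simp [h1.2]
    conv_lhs => rw [h2]
    rw [Complex.norm_real, Real.norm_of_nonneg h1.1]
  have hGb : ∀ w, ‖𝓕 h w‖ ≤ ∫ t, ‖h t‖ := fun w => by
    rw [fourier_formula]
    refine norm_integral_le_of_norm_le hi.norm (ae_of_all _ fun t => ?_)
    rw [norm_mul, norm_osc, mul_one]
  have hcov : AECover (volume : Measure ℝ) atTop fun n : ℕ => Icc (-((n : ℝ) + 1)) ((n : ℝ) + 1) := by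
    have h1 : Tendsto (fun n : ℕ => (n : ℝ) + 1) atTop atTop :=
      tendsto_atTop_add_const_right _ _ tendsto_natCast_atTop_atTop
    exact aecover_Icc (tendsto_neg_atTop_atBot.comp h1) h1
  refine hcov.integrable_of_integral_norm_bounded (Real.exp 1 * M)
    (fun n => hG.continuousOn.integrableOn_compact isCompact_Icc) (Eventually.of_forall fun n => ?_)
  set R : ℝ := (n : ℝ) + 1 with hR
  have hR0 : 0 < R := by positivity
  set δ : ℝ := 1 / R ^ 2 with hδ
  have hδ0 : 0 < δ := by positivity
  have hint : Integrable (fun w : ℝ => 𝓕 h w * cexp (-(δ : ℂ) * w ^ 2)) :=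
    (gauss_integrable hδ0).bdd_mul (c := ∫ t, ‖h t‖) hG.aestronglyMeasurable (ae_of_all _ hGb)
  have hre : ∀ w : ℝ, (𝓕 h w * cexp (-(δ : ℂ) * w ^ 2)).re = ‖𝓕 h w‖ * Real.exp (-δ * w ^ 2) := by
    intro w
    have : cexp (-(δ : ℂ) * w ^ 2) = ((Real.exp (-δ * w ^ 2) : ℝ) : ℂ) := by push_cast; rfl
    rw [this, Complex.re_mul_ofReal, hnorm]
  have hint2 : Integrable (fun w : ℝ => ‖𝓕 h w‖ * Real.exp (-δ * w ^ 2)) := by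
    refine hint.re.congr (ae_of_all _ fun w => ?_)
    exact hre w
  have htot : ∫ w : ℝ, ‖𝓕 h w‖ * Real.exp (-δ * w ^ 2) ≤ M := by
    have h1 : ∫ w : ℝ, ‖𝓕 h w‖ * Real.exp (-δ * w ^ 2)
        = (∫ w : ℝ, 𝓕 h w * cexp (-(δ : ℂ) * w ^ 2)).re := by
      have h2 := integral_re hint
      simp_rw [← hre]
      exact h2
    rw [h1]
    exact (Complex.re_le_norm _).trans (fourier_bound h hc hi M hM δ hδ0)
  calc ∫ w in Icc (-R) R, ‖𝓕 h w‖
      ≤ ∫ w in Icc (-R) R, Real.exp 1 * (‖𝓕 h w‖ * Real.exp (-δ * w ^ 2)) := by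
        refine setIntegral_mono_on (hG.norm.continuousOn.integrableOn_compact isCompact_Icc)
          (hint2.const_mul _).integrableOn measurableSet_Icc fun w hw => ?_
        have h1 : δ * w ^ 2 ≤ 1 := by
          rw [hδ, div_mul_eq_mul_div, one_mul, div_le_one (by positivity)]
          exact sq_le_sq' hw.1 hw.2
        have h2 : 1 ≤ Real.exp 1 * Real.exp (-δ * w ^ 2) := by
          rw [← Real.exp_add]
          exact Real.one_le_exp (by linarith)
        calc ‖𝓕 h w‖ = ‖𝓕 h w‖ * 1 := (mul_one _).symm
          _ ≤ ‖𝓕 h w‖ * (Real.exp 1 * Real.exp (-δ * w ^ 2)) := by gcongr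
          _ = _ := by ring
    _ ≤ ∫ w : ℝ, Real.exp 1 * (‖𝓕 h w‖ * Real.exp (-δ * w ^ 2)) := by
        refine setIntegral_le_integral (hint2.const_mul _) (ae_of_all _ fun w => ?_)
        simp only [Pi.zero_apply]
        positivity
    _ ≤ Real.exp 1 * M := by
        rw [integral_const_mul]
        gcongr

lemma exists_measure (h : ℝ → ℂ) (hc : Continuous h) (hi : Integrable h) (M : ℝ)
    (hM : ∀ t, ‖h t‖ ≤ M) (h0 : h 0 = 1) (hpos : ∀ w, 0 ≤ 𝓕 h w) :
    ∃ σ : Measure ℝ, IsProbabilityMeasure σ ∧ ∀ x : ℝ, charFun σ x = h x := by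
  have hG := fourier_cont h hi
  have hGi := fourier_integrable h hc hi M hM hpos
  have hinv := hc.fourierInv_fourier_eq hi hGi
  have hre : ∀ w, 𝓕 h w = (((𝓕 h w).re : ℝ) : ℂ) := fun w => by
    have h1 := (cplx_nonneg_iff _).1 (hpos w)
    apply Complex.ext <;> simp [h1.2]
  have hre0 : ∀ w, 0 ≤ (𝓕 h w).re := fun w => ((cplx_nonneg_iff _).1 (hpos w)).1
  have hmeas : Measurable fun w => ENNReal.ofReal (𝓕 h w).re :=
    (Complex.measurable_re.comp hG.measurable).ennreal_ofReal
  set ρ : Measure ℝ := volume.withDensity fun w => ENNReal.ofReal (𝓕 h w).re with hρ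
  have hformula : ∀ x : ℝ, ∫ w : ℝ, cexp (x * ((2 * Real.pi * w : ℝ) : ℂ) * I) ∂ρ = h x := by
    intro x
    rw [hρ, integral_withDensity_eq_integral_toReal_smul hmeas
      (ae_of_all _ fun w => ENNReal.ofReal_lt_top)]
    conv_rhs => rw [← hinv, Real.fourierInv_eq']
    congr 1
    ext w
    rw [ENNReal.toReal_ofReal (hre0 w), Complex.real_smul, ← hre, smul_eq_mul, mul_comm]
    congr 2
    simp
    ring
  have hone : ρ univ = 1 := by
    have h1 := hformula 0
    rw [h0] at h1
    simp only [Complex.ofReal_zero, zero_mul, Complex.exp_zero] at h1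
    rw [integral_const] at h1
    have h2 : ρ.real univ = 1 := by
      simpa using h1
    have h3 : ρ univ ≠ ∞ := by
      intro h4
      simp [Measure.real, h4] at h2
    rw [Measure.real] at h2
    rw [← ENNReal.ofReal_toReal h3, h2, ENNReal.ofReal_one]
  have hρp : IsProbabilityMeasure ρ := ⟨hone⟩
  refine ⟨ρ.map fun w => 2 * Real.pi * w,
    Measure.isProbabilityMeasure_map (by fun_prop), fun x => ?_⟩
  rw [charFun_apply_real, integral_map (by fun_prop)
    (Continuous.aestronglyMeasurable (by fun_prop))]
  exact hformula x

lemma levy_exists (f : ℝ → ℂ) (hc : Continuous f) (σ : ℕ → ProbabilityMeasure ℝ)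
    (h : ∀ x : ℝ, Tendsto (fun n => charFun (σ n : Measure ℝ) x) atTop (𝓝 (f x))) :
    ∃ μ : ProbabilityMeasure ℝ, ∀ x : ℝ, charFun (μ : Measure ℝ) x = f x := by
  have ht : IsTightMeasureSet (range fun n => (σ n : Measure ℝ)) :=
    isTightMeasureSet_of_tendsto_charFun hc.continuousAt h
  have hcomp : IsCompact (closure (range σ)) := by
    refine isCompact_closure_of_isTightMeasureSet ?_
    convert ht using 1
    ext x
    simp
  let U : Ultrafilter ℕ := Ultrafilter.of atTop
  have hU : (U : Filter ℕ) ≤ atTop := Ultrafilter.of_le atTop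
  obtain ⟨μ, -, hμ⟩ := hcomp.ultrafilter_le_nhds (U.map σ)
    (le_principal_iff.2 (mem_of_superset (Ultrafilter.mem_map.2 (by
      have : σ ⁻¹' range σ = univ := by ext; simp
      rw [this]; exact univ_mem)) subset_closure))
  have hμ' : Tendsto σ U (𝓝 μ) := hμ
  rw [ProbabilityMeasure.tendsto_iff_forall_integral_rclike_tendsto ℂ] at hμ'
  refine ⟨μ, fun x => ?_⟩
  have h1 := hμ' (BoundedContinuousFunction.innerProbChar x)
  simp_rw [← charFun_eq_integral_innerProbChar] at h1
  exact tendsto_nhds_unique h1 ((h x).mono_left hU)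

theorem gpos_char (f : ℝ → ℂ) (hc : Continuous f) (hb : ∃ M : ℝ, ∀ x : ℝ, ‖f x‖ ≤ M)
    (h0 : f 0 = 1) (h : ∀ ε : ℝ, 0 < ε → ∀ a : ℝ, 0 ≤ Fg f ε a) : IsCharFun f := by
  have key : ∀ k : ℕ, ∃ σ : ProbabilityMeasure ℝ, ∀ x : ℝ, charFun (σ : Measure ℝ) x
      = f x * cexp (-((1 / ((k : ℝ) + 1) : ℝ) : ℂ) * x ^ 2) := by
    intro k
    set ε : ℝ := 1 / ((k : ℝ) + 1) with hε
    have hε0 : 0 < ε := by positivity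
    obtain ⟨M, hM⟩ := hb
    obtain ⟨σ, hσ, hσ'⟩ := exists_measure (fun x : ℝ => f x * cexp (-(ε : ℂ) * x ^ 2)) (by fun_prop)
      (fgauss_integrable f hc ⟨M, hM⟩ hε0) M (fun t => by
        rw [norm_mul, norm_gauss]
        refine (mul_le_of_le_one_right (norm_nonneg _) ?_).trans (hM t)
        rw [Real.exp_le_one_iff]
        have : 0 ≤ ε * t ^ 2 := by positivity
        linarith) (by simp [h0]) (fun w => by
        have h1 := h ε hε0 (2 * Real.pi * w)
        rw [fourier_formula]
        unfold Fg at h1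
        simp_rw [← mul_assoc (f _)] at h1
        exact h1)
    exact ⟨⟨σ, hσ⟩, hσ'⟩
  choose σ hσ using key
  obtain ⟨μ, hμ⟩ := levy_exists f hc σ (fun x => by
    simp_rw [hσ]
    have h1 : Tendsto (fun k : ℕ => (((1 / ((k : ℝ) + 1) : ℝ)) : ℂ)) atTop (𝓝 ((0 : ℝ) : ℂ)) :=
      (Complex.continuous_ofReal.tendsto 0).comp tendsto_one_div_add_atTop_nhds_zero_nat
    have h2 := ((h1.neg.mul_const ((x : ℂ) ^ 2)).cexp).const_mul (f x)
    simpa using h2)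
  refine ⟨μ, inferInstance, fun x => ?_⟩
  rw [← hμ x, charFun_apply_real]
  congr 1
  ext t
  congr 1
  ring

/-- Theorem 3: under the integrability condition (1.7), `f` is a characteristic function iff
`k_f(iy)` is real-valued completely monotonic on `(0,∞)` and `-k_f(iy)` is real-valued
absolutely monotonic on `(-∞,0)`. -/
theorem stmt_1 (f : ℝ → ℂ) (hc : Continuous f) (hb : ∃ M : ℝ, ∀ x : ℝ, ‖f x‖ ≤ M)
    (h0 : f 0 = 1) (hint : Integrable (fun t : ℝ => ‖f t‖ / (1 + |t|))) :
    IsCharFun f ↔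
      ((∀ y ∈ Ioi (0 : ℝ), (cauchyTransform f (Complex.I * y)).im = 0) ∧
        CompletelyMonotonicOn (fun y : ℝ => (cauchyTransform f (Complex.I * y)).re) (Ioi 0)) ∧
      ((∀ y ∈ Iio (0 : ℝ), (-(cauchyTransform f (Complex.I * y))).im = 0) ∧
        AbsolutelyMonotonicOn (fun y : ℝ => (-(cauchyTransform f (Complex.I * y))).re) (Iio 0)) := by
  rw [monot_iff f hc hint]
  exact ⟨fun h => gpos_pos f hc hb hint (char_gpos f h),
    fun h => gpos_char f hc hb h0 (pos_gpos f hc hint h)⟩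
end

section
/- Let φ : ℝ → ℝ be a bounded continuous even function with φ(0) = 1, and let u_φ(x, y) = (1/π) ∫ℝ (y/((x − t)² + y²)) φ(t) dt be its Poisson extension to the upper half-plane. Then φ is a characteristic function if and only if the function y ↦ u_φ(0, y) is completely monotonic on [0, ∞) (i.e., continuous on [0, ∞) and completely monotonic on (0, ∞)). -/
open MeasureTheory Complex Set

noncomputable def poissonExtR (φ : ℝ → ℝ) (x y : ℝ) : ℝ :=
  (1 / Real.pi) * ∫ t : ℝ, (y / ((x - t) ^ 2 + y ^ 2)) * φ t

def IsCharFunR (φ : ℝ → ℝ) : Prop :=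
  ∃ σ : Measure ℝ, IsProbabilityMeasure σ ∧
    ∀ x : ℝ, (φ x : ℂ) = ∫ t : ℝ, Complex.exp (Complex.I * x * t) ∂σ


lemma integrable_pk {y : ℝ} (hy : 0 < y) : Integrable (fun t : ℝ => y / (t ^ 2 + y ^ 2)) := by
  have h := (integrable_inv_one_add_sq.comp_div hy.ne').const_mul y⁻¹
  refine h.congr (Filter.Eventually.of_forall fun t => ?_)
  have : t ^ 2 + y ^ 2 ≠ 0 := by positivity
  have : 1 + (t / y) ^ 2 ≠ 0 := by positivity
  simp only
  field_simp
  ring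

lemma integrable_expabs {y : ℝ} (hy : 0 < y) (w : ℝ) :
    IntegrableOn (fun v : ℝ => cexp (↑(-2 * Real.pi * v * w) * I) • ((Real.exp (-y * |v|) : ℝ) : ℂ)) (Iic 0)
    ∧ IntegrableOn (fun v : ℝ => cexp (↑(-2 * Real.pi * v * w) * I) • ((Real.exp (-y * |v|) : ℝ) : ℂ)) (Ioi 0)
    ∧ ∫ v : ℝ, cexp (↑(-2 * Real.pi * v * w) * I) • ((Real.exp (-y * |v|) : ℝ) : ℂ) =
      ((2 * y / ((2 * Real.pi * w) ^ 2 + y ^ 2) : ℝ) : ℂ) := by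
  have e1 : EqOn (fun v : ℝ => cexp (↑(-2 * Real.pi * v * w) * I) • ((Real.exp (-y * |v|) : ℝ) : ℂ))
      (fun v : ℝ => cexp (((y : ℂ) - 2 * Real.pi * w * I) * v)) (Iic 0) := by
    intro v hv
    simp only [smul_eq_mul]
    rw [abs_of_nonpos hv, Complex.ofReal_exp, ← Complex.exp_add]
    congr 1
    push_cast
    ring
  have e2 : EqOn (fun v : ℝ => cexp (↑(-2 * Real.pi * v * w) * I) • ((Real.exp (-y * |v|) : ℝ) : ℂ))
      (fun v : ℝ => cexp ((-(y : ℂ) - 2 * Real.pi * w * I) * v)) (Ioi 0) := by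
    intro v hv
    simp only [smul_eq_mul]
    rw [abs_of_pos hv, Complex.ofReal_exp, ← Complex.exp_add]
    congr 1
    push_cast
    ring
  have r1 : 0 < ((y : ℂ) - 2 * Real.pi * w * I).re := by simpa using hy
  have r2 : (-(y : ℂ) - 2 * Real.pi * w * I).re < 0 := by simpa using hy
  have i1 := (integrableOn_exp_mul_complex_Iic r1 0).congr_fun e1.symm measurableSet_Iic
  have i2 := (integrableOn_exp_mul_complex_Ioi r2 0).congr_fun e2.symm measurableSet_Ioi
  refine ⟨i1, i2, ?_⟩
  rw [← intervalIntegral.integral_Iic_add_Ioi i1 i2, setIntegral_congr_fun measurableSet_Iic e1,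
    setIntegral_congr_fun measurableSet_Ioi e2, integral_exp_mul_complex_Iic r1,
    integral_exp_mul_complex_Ioi r2]
  have n1 : ((y : ℂ) - 2 * Real.pi * w * I) ≠ 0 := by intro h; rw [h] at r1; simp at r1
  have n2 : (-(y : ℂ) - 2 * Real.pi * w * I) ≠ 0 := by intro h; rw [h] at r2; simp at r2
  have n3 : ((2 * Real.pi * w) ^ 2 + y ^ 2 : ℂ) ≠ 0 := by
    have : ((2 * Real.pi * w) ^ 2 + y ^ 2 : ℝ) ≠ 0 := by positivity
    exact_mod_cast this
  push_cast
  have h3 : ((2 * Real.pi * w) ^ 2 + y ^ 2 : ℂ) = -(((y : ℂ) - 2 * Real.pi * w * I) * (-(y : ℂ) - 2 * Real.pi * w * I)) := by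
    ring_nf
    simp
  rw [h3]
  simp only [mul_zero, Complex.exp_zero]
  field_simp
  ring

lemma cauchy_cos {y : ℝ} (hy : 0 < y) (s : ℝ) :
    ∫ t : ℝ, y / (t ^ 2 + y ^ 2) * Real.cos (t * s) = Real.pi * Real.exp (-y * |s|) := by
  set f : ℝ → ℂ := fun v => ((Real.exp (-y * |v|) : ℝ) : ℂ) with hf
  have hF : FourierTransform.fourier f = fun w : ℝ => ((2 * y / ((2 * Real.pi * w) ^ 2 + y ^ 2) : ℝ) : ℂ) := by
    ext w
    rw [Real.fourier_real_eq_integral_exp_smul]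
    exact (integrable_expabs hy w).2.2
  have hfi : Integrable f := by
    have h1 := (integrable_expabs hy 0).1.union (integrable_expabs hy 0).2.1
    rw [Iic_union_Ioi, integrableOn_univ] at h1
    simpa [hf] using h1
  have hFi : Integrable (FourierTransform.fourier f) := by
    rw [hF]
    apply Integrable.ofReal
    have := ((integrable_pk hy).comp_mul_left' (R := 2 * Real.pi) (by positivity)).const_mul 2
    refine this.congr (Filter.Eventually.of_forall fun t => ?_)
    show 2 * (y / ((2 * Real.pi * t) ^ 2 + y ^ 2)) = 2 * y / ((2 * Real.pi * t) ^ 2 + y ^ 2)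
    ring
  have hinv := congrFun (Continuous.fourierInv_fourier_eq (by fun_prop) hfi hFi) s
  rw [Real.fourierInv_eq', hF] at hinv
  have h2 := congrArg Complex.re hinv
  have hIntg : Integrable (fun v : ℝ => cexp (↑(2 * Real.pi * inner ℝ v s) * I) • (((2 * y / ((2 * Real.pi * v) ^ 2 + y ^ 2) : ℝ) : ℂ))) := by
    rw [hF] at hFi
    refine (hFi.norm).mono' (by simp only [RCLike.inner_apply, conj_trivial]; apply Continuous.aestronglyMeasurable; 
                                have : ∀ v : ℝ, (2 * Real.pi * v) ^ 2 + y ^ 2 ≠ 0 := fun v => by positivity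
                                simp only [smul_eq_mul]
                                fun_prop (disch := assumption)) ?_
    refine Filter.Eventually.of_forall fun t => ?_
    simp only [norm_smul, norm_exp_ofReal_mul_I, one_mul, le_refl]
  rw [← RCLike.re_eq_complex_re, ← integral_re hIntg] at h2
  have e : (fun v : ℝ => RCLike.re (cexp (↑(2 * Real.pi * inner ℝ v s) * I) • (((2 * y / ((2 * Real.pi * v) ^ 2 + y ^ 2) : ℝ) : ℂ)))) =
     fun v => (fun t : ℝ => 2 * (y / (t ^ 2 + y ^ 2) * Real.cos (t * s))) (2 * Real.pi * v) := by
    ext v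
    simp only [smul_eq_mul, RCLike.re_eq_complex_re, Complex.re_mul_ofReal, Complex.exp_ofReal_mul_I_re, RCLike.inner_apply, conj_trivial]
    rw [show 2 * Real.pi * (s * v) = 2 * Real.pi * v * s by ring]
    ring
  rw [e, Measure.integral_comp_mul_left (fun t : ℝ => 2 * (y / (t ^ 2 + y ^ 2) * Real.cos (t * s))) (2 * Real.pi), integral_const_mul] at h2
  simp only [hf, RCLike.re_eq_complex_re, Complex.ofReal_re, smul_eq_mul] at h2
  rw [← h2, abs_of_pos (by positivity)]
  have := Real.pi_pos.ne'
  generalize ∫ (t : ℝ), y / (t ^ 2 + y ^ 2) * Real.cos (t * s) = K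
  field_simp

lemma poisson_mix (ν : Measure ℝ) [IsProbabilityMeasure ν] {y : ℝ} (hy : 0 < y) :
    poissonExtR (fun t => ∫ s, Real.cos (t * s) ∂ν) 0 y = ∫ s, Real.exp (-y * |s|) ∂ν := by
  have hne : ∀ t : ℝ, t ^ 2 + y ^ 2 ≠ 0 := fun t => by positivity
  have hne' : ∀ t : ℝ × ℝ, t.1 ^ 2 + y ^ 2 ≠ 0 := fun t => by positivity
  have hIntg : Integrable (Function.uncurry fun t s : ℝ => y / (t ^ 2 + y ^ 2) * Real.cos (t * s))
      (volume.prod ν) := by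
    refine ((integrable_pk hy).mul_prod (integrable_const (1 : ℝ) (μ := ν))).mono' ?_ ?_
    · apply Continuous.aestronglyMeasurable
      simp only [Function.uncurry_def]
      fun_prop (disch := assumption)
    · refine Filter.Eventually.of_forall fun p => ?_
      simp only [Function.uncurry_def, norm_mul, mul_one]
      rw [Real.norm_of_nonneg (by positivity), Real.norm_eq_abs]
      have := Real.abs_cos_le_one (p.1 * p.2)
      exact mul_le_of_le_one_right (by positivity) this
  have h1 := integral_integral_swap hIntg
  simp only [poissonExtR, zero_sub, neg_sq]
  simp only [integral_const_mul] at h1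
  rw [h1]
  simp only [cauchy_cos hy, integral_const_mul]
  have := Real.pi_pos.ne'
  field_simp

lemma mix_cont (ν : Measure ℝ) [IsProbabilityMeasure ν] :
    Continuous (fun y : ℝ => ∫ s, Real.exp (-|y| * |s|) ∂ν) := by
  apply continuous_of_dominated (bound := fun _ => 1)
  · intro y
    apply Continuous.aestronglyMeasurable
    fun_prop
  · intro y
    refine Filter.Eventually.of_forall fun s => ?_
    rw [Real.norm_of_nonneg (Real.exp_pos _).le, Real.exp_le_one_iff]
    have := mul_nonneg (abs_nonneg y) (abs_nonneg s)
    linarith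
  · exact integrable_const _
  · exact Filter.Eventually.of_forall fun s => by fun_prop

lemma mix_cm (ν : Measure ℝ) [IsProbabilityMeasure ν] {U : ℝ → ℝ}
    (hU : ∀ y, 0 < y → U y = ∫ s, Real.exp (-y * |s|) ∂ν) : CompletelyMonotonicOn U (Ioi 0) := by
  have hmem : ∀ y : ℝ, 0 < y → -y ∈ interior (ProbabilityTheory.integrableExpSet (fun s : ℝ => |s|) ν) := by
    intro y hy
    rw [mem_interior]
    refine ⟨Iio 0, ?_, isOpen_Iio, by simpa using hy⟩
    intro z hz
    have hz : z < 0 := hz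
    refine (integrable_const (1 : ℝ)).mono' (by fun_prop) (Filter.Eventually.of_forall fun s => ?_)
    rw [Real.norm_of_nonneg (Real.exp_pos _).le, Real.exp_le_one_iff]
    exact mul_nonpos_of_nonpos_of_nonneg hz.le (abs_nonneg s)
  have hev : ∀ y : ℝ, 0 < y → U =ᶠ[nhds y] fun z => ProbabilityTheory.mgf (fun s : ℝ => |s|) ν (-z) := by
    intro y hy
    filter_upwards [Ioi_mem_nhds hy] with z hz
    rw [hU z hz, ProbabilityTheory.mgf]
  constructor
  · intro y hy
    apply ContDiffAt.contDiffWithinAt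
    refine ContDiffAt.congr_of_eventuallyEq ?_ (hev y hy)
    have h1 := (ProbabilityTheory.analyticAt_mgf (hmem y hy)).contDiffAt (n := (⊤ : ℕ∞))
    exact h1.comp y contDiffAt_id.neg
  · intro n y hy
    rw [(hev y hy).iteratedDeriv_eq, iteratedDeriv_comp_neg, smul_eq_mul, ← mul_assoc, ← mul_pow,
      ProbabilityTheory.iteratedDeriv_mgf (hmem y hy)]
    simp only [mul_neg, mul_one, neg_neg, one_pow, one_mul]
    exact integral_nonneg fun s => by positivity

lemma forward (φ : ℝ → ℝ) 
    (U : ℝ → ℝ) (hU : ∀ y : ℝ, U y = if y = 0 then φ 0 else poissonExtR φ 0 y)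
    (h : IsCharFunR φ) : ContinuousOn U (Ici 0) ∧ CompletelyMonotonicOn U (Ioi 0) := by
  obtain ⟨σ, hσ, hφ⟩ := h
  have hcos : φ = fun t => ∫ s, Real.cos (t * s) ∂σ := by
    ext t
    have h1 := congrArg Complex.re (hφ t)
    rw [Complex.ofReal_re, ← RCLike.re_eq_complex_re, ← integral_re] at h1
    · rw [h1]
      congr 1
      ext s
      rw [RCLike.re_eq_complex_re, show I * (t : ℂ) * s = ((t * s : ℝ) : ℂ) * I by push_cast; ring,
        Complex.exp_ofReal_mul_I_re]
    · refine (integrable_const (1 : ℝ)).mono' (by fun_prop) (Filter.Eventually.of_forall fun s => ?_)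
      rw [show I * (t : ℂ) * s = ((t * s : ℝ) : ℂ) * I by push_cast; ring, norm_exp_ofReal_mul_I]
  have hpos : ∀ y, 0 < y → U y = ∫ s, Real.exp (-y * |s|) ∂σ := by
    intro y hy
    rw [hU, if_neg hy.ne', hcos, poisson_mix σ hy]
  refine ⟨?_, mix_cm σ hpos⟩
  refine (mix_cont σ).continuousOn.congr ?_
  intro y hy
  rcases (show 0 ≤ y from hy).eq_or_lt with h0 | h0
  · subst h0
    simp [hU, hcos]
  · simp only [hpos y h0, abs_of_pos h0]

lemma integrable_pow_mul {g : ℝ → ℝ} (hg : Continuous g) {M : ℝ} (hM : ∀ x, |g x| ≤ M) {a : ℝ}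
    (ha : 0 < a) (n : ℕ) : Integrable (fun t : ℝ => g t * ((t ^ 2 + a) ^ (n + 1))⁻¹) := by
  have hM0 : 0 ≤ M := (abs_nonneg _).trans (hM 0)
  have hpk : Integrable (fun t : ℝ => (t ^ 2 + a)⁻¹) := by
    have h := (integrable_inv_one_add_sq.comp_div (Real.sqrt_pos.2 ha).ne').const_mul a⁻¹
    refine h.congr (Filter.Eventually.of_forall fun t => ?_)
    have h1 : t ^ 2 + a ≠ 0 := by positivity
    have h2 : a + t ^ 2 ≠ 0 := by positivity
    simp only [div_pow, Real.sq_sqrt ha.le]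
    field_simp
    ring
  refine (hpk.const_mul (M * (a ^ n)⁻¹)).mono' ?_ (Filter.Eventually.of_forall fun t => ?_)
  · have : ∀ t : ℝ, (t ^ 2 + a) ^ (n + 1) ≠ 0 := fun t => by positivity
    apply Continuous.aestronglyMeasurable
    fun_prop (disch := assumption)
  · rw [norm_mul, Real.norm_eq_abs, Real.norm_of_nonneg (by positivity), pow_succ, mul_inv, mul_assoc]
    have : ((t ^ 2 + a) ^ n)⁻¹ ≤ (a ^ n)⁻¹ := by
      gcongr
      nlinarith [sq_nonneg t]
    have h3 : 0 ≤ (t ^ 2 + a)⁻¹ := by positivity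
    have := hM t
    gcongr

lemma pow_vanish {g : ℝ → ℝ} (hg : Continuous g) {M : ℝ} (hM : ∀ x, |g x| ≤ M)
    (h : ∀ a : ℝ, 0 < a → ∫ t : ℝ, g t * ((t ^ 2 + a) ^ (0 + 1))⁻¹ = 0) (n : ℕ) :
    ∀ a : ℝ, 0 < a → ∫ t : ℝ, g t * ((t ^ 2 + a) ^ (n + 1))⁻¹ = 0 := by
  have hM0 : 0 ≤ M := (abs_nonneg _).trans (hM 0)
  induction n with
  | zero => exact h
  | succ n ih =>
    intro a ha
    have key := hasDerivAt_integral_of_dominated_loc_of_deriv_le (μ := (volume : Measure ℝ)) (𝕜 := ℝ)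
      (F := fun x t => g t * ((t ^ 2 + x) ^ (n + 1))⁻¹)
      (F' := fun x t => g t * (-((n + 1 : ℝ)) * ((t ^ 2 + x) ^ (n + 1 + 1))⁻¹))
      (bound := fun t => (n + 1 : ℝ) * (M * ((t ^ 2 + a / 2) ^ (n + 1 + 1))⁻¹))
      (x₀ := a) (s := Ioi (a / 2)) (Ioi_mem_nhds (by linarith)) ?_ (integrable_pow_mul hg hM ha n)
      ?_ ?_ ?_ ?_
    · have h2 : HasDerivAt (fun x => ∫ t : ℝ, g t * ((t ^ 2 + x) ^ (n + 1))⁻¹) 0 a := by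
        apply (hasDerivAt_const a (0 : ℝ)).congr_of_eventuallyEq
        filter_upwards [Ioi_mem_nhds ha] with x hx using ih x hx
      have h3 := key.2.unique h2
      have h4 : (fun t : ℝ => g t * (-((n + 1 : ℝ)) * ((t ^ 2 + a) ^ (n + 1 + 1))⁻¹)) = 
          fun t => (-((n + 1 : ℝ))) * (g t * ((t ^ 2 + a) ^ (n + 1 + 1))⁻¹) := by ext t; ring
      rw [h4, integral_const_mul] at h3
      rcases mul_eq_zero.1 h3 with h5 | h5
      · have : (0 : ℝ) < n + 1 := by positivity
        linarith
      · exact h5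
    · filter_upwards [Ioi_mem_nhds ha] with x hx
      exact (integrable_pow_mul hg hM hx n).aestronglyMeasurable
    · have := (integrable_pow_mul hg hM ha (n + 1)).aestronglyMeasurable.const_mul (-((n + 1 : ℝ)))
      refine this.congr (Filter.Eventually.of_forall fun t => ?_)
      simp only
      ring
    · refine Filter.Eventually.of_forall fun t x hx => ?_
      have hx : a / 2 < x := hx
      have hx0 : 0 < x := by linarith
      have hn : (0 : ℝ) ≤ n + 1 := by positivity
      rw [norm_mul, norm_mul, norm_neg, Real.norm_of_nonneg hn, Real.norm_eq_abs, Real.norm_of_nonneg (by positivity)]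
      have h1 : ((t ^ 2 + x) ^ (n + 1 + 1))⁻¹ ≤ ((t ^ 2 + a / 2) ^ (n + 1 + 1))⁻¹ := by
        gcongr
      have := hM t
      calc _ = (n + 1 : ℝ) * (|g t| * ((t ^ 2 + x) ^ (n + 1 + 1))⁻¹) := by ring
        _ ≤ _ := by gcongr
    · have := (integrable_pow_mul (g := fun _ => M) continuous_const (M := |M|) (fun _ => le_rfl) (half_pos ha) (n + 1))
      exact this.const_mul _
    · refine Filter.Eventually.of_forall fun t x hx => ?_
      have hx : a / 2 < x := hx
      have hx0 : 0 < x := by linarith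
      have hne : t ^ 2 + x ≠ 0 := by positivity
      have h1 : HasDerivAt (fun x : ℝ => (t ^ 2 + x)) 1 x := by
        simpa using (hasDerivAt_id x).const_add (t ^ 2)
      have h2 := ((h1.pow (n + 1)).inv (pow_ne_zero _ hne)).const_mul (g t)
      refine h2.congr_deriv ?_
      push_cast
      simp only [Pi.pow_apply]
      field_simp
      simp
      ring

lemma uniq {g : ℝ → ℝ} (hg : Continuous g) {M : ℝ} (hM : ∀ x, |g x| ≤ M)
    (heven : ∀ x, g (-x) = g x)
    (h : ∀ y : ℝ, 0 < y → ∫ t : ℝ, y / (t ^ 2 + y ^ 2) * g t = 0) : ∀ x, g x = 0 := by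
  have hM0 : 0 ≤ M := (abs_nonneg _).trans (hM 0)
  have hpow := pow_vanish hg hM (fun a ha => by
    have h1 := h (Real.sqrt a) (Real.sqrt_pos.2 ha)
    rw [Real.sq_sqrt ha.le] at h1
    have h2 : (fun t : ℝ => Real.sqrt a / (t ^ 2 + a) * g t) = 
      fun t => Real.sqrt a * (g t * ((t ^ 2 + a) ^ (0 + 1))⁻¹) := by
      ext t; rw [zero_add, pow_one]; ring
    rw [h2, integral_const_mul] at h1
    exact (mul_eq_zero.1 h1).resolve_left (Real.sqrt_pos.2 ha).ne')
  set w : ℝ → ℝ := fun t => (t ^ 2 + 1)⁻¹ with hw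
  have hne : ∀ t : ℝ, t ^ 2 + 1 ≠ 0 := fun t => by positivity
  have hwc : Continuous w := by fun_prop (disch := assumption)
  have hw0 : ∀ t, 0 < w t := fun t => by positivity
  have hw1 : ∀ t, w t ≤ 1 := fun t => by
    apply inv_le_one_of_one_le₀; nlinarith [sq_nonneg t]
  have hI1 : Integrable (fun t => g t * w t) := by
    simpa [hw] using integrable_pow_mul hg hM one_pos 0
  have hW : Integrable w := by
    simpa [hw] using integrable_pow_mul (g := fun _ => 1) continuous_const (M := 1) (by simp) one_pos 0
  -- polynomials
  have hpoly : ∀ p : Polynomial ℝ, Integrable (fun t => g t * w t * p.eval (w t)) ∧ 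
      ∫ t, g t * w t * p.eval (w t) = 0 := by
    intro p
    induction p using Polynomial.induction_on' with
    | add p q hp hq =>
      simp only [Polynomial.eval_add, mul_add]
      exact ⟨hp.1.add hq.1, by rw [integral_add hp.1 hq.1, hp.2, hq.2, add_zero]⟩
    | monomial n c =>
      have e : (fun t => g t * w t * (Polynomial.monomial n c).eval (w t)) =
        fun t => c * (g t * ((t ^ 2 + 1) ^ (n + 1))⁻¹) := by
        ext t
        simp only [Polynomial.eval_monomial, hw, pow_succ, mul_inv, inv_pow]
        ring
      rw [e]
      exact ⟨(integrable_pow_mul hg hM one_pos n).const_mul c, by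
        rw [integral_const_mul, hpow n 1 one_pos, mul_zero]⟩
  -- the test function
  set f : ℝ → ℝ := fun s => s * g (Real.sqrt (s⁻¹ - 1)) with hf
  have hfc : ContinuousOn f (Icc 0 1) := by
    intro s hs
    rcases hs.1.eq_or_lt with h0 | h0
    · subst h0
      apply ContinuousAt.continuousWithinAt
      have hf0 : f 0 = 0 := by simp [hf]
      rw [ContinuousAt, hf0]
      apply squeeze_zero_norm (a := fun s => |s| * M)
      · intro s
        simp only [hf, norm_mul, Real.norm_eq_abs]
        have := hM (Real.sqrt (s⁻¹ - 1))
        gcongr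
      · have : Continuous fun s : ℝ => |s| * M := by fun_prop
        simpa using this.tendsto 0
    · apply ContinuousAt.continuousWithinAt
      have : s ≠ 0 := h0.ne'
      simp only [hf]
      apply continuousAt_id.mul
      apply hg.continuousAt.comp
      apply Real.continuous_sqrt.continuousAt.comp
      exact (continuousAt_inv₀ this).sub continuousAt_const
  have hfw : ∀ t, f (w t) = w t * g t := by
    intro t
    simp only [hf, hw, inv_inv, add_sub_cancel_right, Real.sqrt_sq_eq_abs]
    rcases abs_cases t with h1 | h1 <;> rw [h1.1]
    rw [heven]
  have hI2 : Integrable (fun t => g t * w t * (w t * g t)) := by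
    refine (hW.const_mul (M * M)).mono' (by fun_prop) (Filter.Eventually.of_forall fun t => ?_)
    rw [norm_mul, norm_mul, norm_mul, Real.norm_of_nonneg (hw0 t).le, Real.norm_eq_abs]
    have h1 := hM t
    have h2 := hw1 t
    have h3 := (hw0 t).le
    have h4 := abs_nonneg (g t)
    calc |g t| * w t * (w t * |g t|) = (|g t| * |g t|) * (w t * w t) := by ring
      _ ≤ (M * M) * (w t * 1) := by gcongr
      _ = _ := by ring
  have hzero : ∫ t, g t * w t * (w t * g t) = 0 := by
    by_contra hcon
    set C := ∫ t, |g t * w t| with hC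
    have hC0 : 0 ≤ C := integral_nonneg fun t => abs_nonneg _
    set J := ∫ t, g t * w t * (w t * g t) with hJ
    have hJ0 : 0 < |J| := abs_pos.2 hcon
    obtain ⟨p, hp⟩ := exists_polynomial_near_of_continuousOn 0 1 f hfc (|J| / (C + 1)) (by positivity)
    have h1 : J = ∫ t, (g t * w t * (w t * g t) - g t * w t * p.eval (w t)) := by
      rw [integral_sub hI2 (hpoly p).1, (hpoly p).2, sub_zero]
    have h2 : |J| ≤ ∫ t, |g t * w t| * (|J| / (C + 1)) := by
      conv_lhs => rw [h1]
      rw [← Real.norm_eq_abs]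
      apply norm_integral_le_of_norm_le (hI1.abs.mul_const _)
      refine Filter.Eventually.of_forall fun t => ?_
      rw [← mul_sub, norm_mul, Real.norm_eq_abs, Real.norm_eq_abs]
      have := hp (w t) ⟨(hw0 t).le, hw1 t⟩
      rw [hfw, abs_sub_comm] at this
      gcongr
    rw [integral_mul_const, ← hC, ← mul_div_assoc, le_div_iff₀ (by positivity)] at h2
    nlinarith
  have hcont : Continuous (fun t => g t * w t * (w t * g t)) := by fun_prop
  have hnn : 0 ≤ (fun t => g t * w t * (w t * g t)) := fun t => by
    have : g t * w t * (w t * g t) = (g t * w t) ^ 2 := by ring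
    simp only [Pi.zero_apply, this]
    positivity
  rw [integral_eq_zero_iff_of_nonneg hnn hI2] at hzero
  have h5 := Measure.eq_of_ae_eq hzero hcont continuous_zero
  intro x
  have h6 := congrFun h5 x
  simp only [Pi.zero_apply] at h6
  have h7 := (hw0 x).ne'
  simpa [h7] using h6

noncomputable def tc (U : ℝ → ℝ) (A : ℝ) (j : ℕ) : ℝ := (-1 : ℝ) ^ j * iteratedDeriv j U A / j.factorial

lemma tc_nonneg {U : ℝ → ℝ} (h : CompletelyMonotonicOn U (Ioi 0)) {A : ℝ} (hA : 0 < A) (j : ℕ) :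
    0 ≤ tc U A j := div_nonneg (h.2 j A hA) (by positivity)

lemma cm_contDiffAt {U : ℝ → ℝ} (h : CompletelyMonotonicOn U (Ioi 0)) {x : ℝ} (hx : 0 < x) (n : ℕ) :
    ContDiffAt ℝ n U x :=
  ((h.1 x hx).contDiffAt (Ioi_mem_nhds hx)).of_le (by exact_mod_cast le_top)

lemma uIcc_pos {x A : ℝ} (hx : 0 < x) (hxA : x < A) : uIcc A x ⊆ Ioi 0 := by
  rw [uIcc_of_ge hxA.le]
  intro z hz
  exact lt_of_lt_of_le hx hz.1

lemma taylor_eq {U : ℝ → ℝ} (h : CompletelyMonotonicOn U (Ioi 0)) {x A : ℝ} (hx : 0 < x) (hxA : x < A)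
    (n : ℕ) : taylorWithinEval U n (uIcc A x) A x = ∑ k ∈ Finset.range (n + 1), tc U A k * (A - x) ^ k := by
  rw [taylor_within_apply]
  refine Finset.sum_congr rfl fun k _ => ?_
  rw [iteratedDerivWithin_eq_iteratedDeriv (uniqueDiffOn_uIcc hxA.ne') (cm_contDiffAt h (hx.trans hxA) k) left_mem_uIcc,
    tc, show x - A = (-1) * (A - x) by ring, mul_pow, smul_eq_mul]
  field_simp

lemma taylor_low {U : ℝ → ℝ} (h : CompletelyMonotonicOn U (Ioi 0)) {x A : ℝ} (hx : 0 < x) (hxA : x < A)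
    (n : ℕ) : ∑ k ∈ Finset.range (n + 1), tc U A k * (A - x) ^ k ≤ U x := by
  obtain ⟨z, hz, hz2⟩ := taylor_mean_remainder_lagrange_iteratedDeriv (f := U) (n := n) hxA.ne'
    ((h.1.mono (uIcc_pos hx hxA)).of_le (by exact_mod_cast le_top))
  rw [taylor_eq h hx hxA] at hz2
  rw [uIoo_of_ge hxA.le] at hz
  have h1 := h.2 (n + 1) z (hx.trans hz.1)
  have h2 : iteratedDeriv (n + 1) U z * (x - A) ^ (n + 1) / (n + 1).factorial
      = ((-1) ^ (n + 1) * iteratedDeriv (n + 1) U z) * (A - x) ^ (n + 1) / (n + 1).factorial := by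
    rw [show x - A = (-1) * (A - x) by ring, mul_pow]; ring
  rw [h2] at hz2
  have h3 : 0 < A - x := by linarith
  have h4 : 0 ≤ ((-1) ^ (n + 1) * iteratedDeriv (n + 1) U z) * (A - x) ^ (n + 1) / (n + 1).factorial := by
    positivity
  linarith

lemma tc_bound {U : ℝ → ℝ} (h : CompletelyMonotonicOn U (Ioi 0)) {x A : ℝ} (hx : 0 < x) (hxA : x < A)
    (n : ℕ) : tc U A n * (A - x) ^ n ≤ U x := by
  refine le_trans ?_ (taylor_low h hx hxA n)
  refine Finset.single_le_sum (f := fun k => tc U A k * (A - x) ^ k) (fun k _ => ?_) (by simp)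
  have h3 : 0 < A - x := by linarith
  exact mul_nonneg (tc_nonneg h (hx.trans hxA) k) (by positivity)

lemma taylor_up {U : ℝ → ℝ} (h : CompletelyMonotonicOn U (Ioi 0)) {x A : ℝ} (hx : 0 < x) (hxA : x < A)
    (n : ℕ) : U x - ∑ k ∈ Finset.range (n + 1), tc U A k * (A - x) ^ k ≤
      ((n + 1 : ℝ) * ((A - x) / (A - x / 2)) ^ n) * ((A - x) * U (x / 2) / (x / 2)) := by
  have hu : UniqueDiffOn ℝ (uIcc A x) := uniqueDiffOn_uIcc hxA.ne'
  have hcd : ContDiffOn ℝ (n + 1) U (uIcc A x) := (h.1.mono (uIcc_pos hx hxA)).of_le (by exact_mod_cast le_top)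
  have hd : DifferentiableOn ℝ (iteratedDerivWithin n U (uIcc A x)) (uIcc A x) := by
    refine hcd.differentiableOn_iteratedDerivWithin ?_ hu
    norm_cast
    simp
  obtain ⟨z, hz, hz2⟩ := taylor_mean_remainder_cauchy (f := U) (n := n) hxA.ne' hcd.of_succ
    (hd.mono Ioo_subset_Icc_self)
  rw [taylor_eq h hx hxA, iteratedDerivWithin_eq_iteratedDeriv hu
    (cm_contDiffAt h (uIcc_pos hx hxA (uIoo_subset_uIcc_self hz)) (n + 1)) (uIoo_subset_uIcc_self hz)] at hz2
  rw [uIoo_of_ge hxA.le] at hz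
  rw [hz2]
  have hz0 : 0 < z := hx.trans hz.1
  have a1 : 0 < z - x := by linarith [hz.1]
  have a2 : 0 < A - x := by linarith
  have a3 : 0 < z - x / 2 := by linarith
  have a4 : 0 < A - x / 2 := by linarith
  have hb := tc_bound h (half_pos hx) (show x / 2 < z by linarith [hz.1]) (n + 1)
  have hU0 : 0 ≤ U (x / 2) := by simpa using h.2 0 (x / 2) (half_pos hx)
  have h2 : iteratedDeriv (n + 1) U z * (x - z) ^ n / n.factorial * (x - A) =
     (n + 1 : ℝ) * (tc U z (n + 1) * (z - x / 2) ^ (n + 1)) * ((z - x) / (z - x / 2)) ^ n * ((A - x) / (z - x / 2)) := by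
    rw [tc, show x - z = (-1) * (z - x) by ring, mul_pow, Nat.factorial_succ, div_pow]
    clear hb
    generalize z - x / 2 = c at a3
    have := a3.ne'
    push_cast
    field_simp
    ring
  rw [h2]
  have hr : (z - x) / (z - x / 2) ≤ (A - x) / (A - x / 2) := by
    rw [div_le_div_iff₀ a3 a4]
    nlinarith [hz.2]
  have hr0 : 0 ≤ (z - x) / (z - x / 2) := by positivity
  have hr2 : (A - x) / (z - x / 2) ≤ (A - x) / (x / 2) := by
    apply div_le_div_of_nonneg_left a2.le (by linarith) (by linarith [hz.1])
  calc _ ≤ (n + 1 : ℝ) * U (x / 2) * ((A - x) / (A - x / 2)) ^ n * ((A - x) / (x / 2)) := by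
        have := tc_nonneg h hz0 (n + 1)
        gcongr
    _ = _ := by ring

lemma taylor_hasSum {U : ℝ → ℝ} (h : CompletelyMonotonicOn U (Ioi 0)) {x A : ℝ} (hx : 0 < x) (hxA : x < A) :
    HasSum (fun k => tc U A k * (A - x) ^ k) (U x) := by
  have a2 : 0 < A - x := by linarith
  have a4 : 0 < A - x / 2 := by linarith
  rw [hasSum_iff_tendsto_nat_of_nonneg fun k => mul_nonneg (tc_nonneg h (hx.trans hxA) k) (by positivity)]
  rw [← Filter.tendsto_add_atTop_iff_nat 1]
  have hr0 : 0 ≤ (A - x) / (A - x / 2) := by positivity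
  have hr1 : (A - x) / (A - x / 2) < 1 := by rw [div_lt_one a4]; linarith
  have t1 : Filter.Tendsto (fun n : ℕ => ((n + 1 : ℝ) * ((A - x) / (A - x / 2)) ^ n) * ((A - x) * U (x / 2) / (x / 2))) Filter.atTop (nhds 0) := by
    have b1 := tendsto_self_mul_const_pow_of_lt_one hr0 hr1
    have b2 := tendsto_pow_atTop_nhds_zero_of_lt_one hr0 hr1
    have b3 := (b1.add b2).mul_const ((A - x) * U (x / 2) / (x / 2))
    simp only [add_zero, zero_mul] at b3
    refine b3.congr fun n => ?_
    ring
  have t2 : Filter.Tendsto (fun n : ℕ => U x - ∑ k ∈ Finset.range (n + 1), tc U A k * (A - x) ^ k) Filter.atTop (nhds 0) :=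
    squeeze_zero (fun n => sub_nonneg.2 (taylor_low h hx hxA n)) (fun n => taylor_up h hx hxA n) t1
  have t3 := t2.const_sub (U x)
  simpa using t3

lemma tc_hasSum_one {U : ℝ → ℝ} (hc : ContinuousOn U (Ici 0)) (h0 : U 0 = 1)
    (h : CompletelyMonotonicOn U (Ioi 0)) {A : ℝ} (hA : 0 < A) :
    HasSum (fun k => tc U A k * A ^ k) 1 := by
  have hlim : Filter.Tendsto U (nhdsWithin 0 (Ioi 0)) (nhds 1) := by
    rw [← h0]
    exact (hc 0 self_mem_Ici).mono_left (nhdsWithin_mono _ Ioi_subset_Ici_self)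
  have hnn : ∀ k, 0 ≤ tc U A k * A ^ k := fun k => mul_nonneg (tc_nonneg h hA k) (by positivity)
  have hev : ∀ᶠ x in nhdsWithin (0 : ℝ) (Ioi 0), 0 < x ∧ x < A := 
    (Ioo_mem_nhdsGT hA)
  have hpart : ∀ n, ∑ k ∈ Finset.range n, tc U A k * A ^ k ≤ 1 := by
    intro n
    have hcont : Continuous fun x : ℝ => ∑ k ∈ Finset.range n, tc U A k * (A - x) ^ k := by fun_prop
    have h1 := (hcont.tendsto 0).mono_left (nhdsWithin_le_nhds (s := Ioi 0))
    simp only [sub_zero] at h1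
    refine le_of_tendsto_of_tendsto h1 hlim ?_
    filter_upwards [hev] with x hx
    have a2 : 0 < A - x := by linarith [hx.2]
    exact sum_le_hasSum _ (fun k _ => mul_nonneg (tc_nonneg h hA k) (by positivity)) (taylor_hasSum h hx.1 hx.2)
  have hs : Summable (fun k => tc U A k * A ^ k) := summable_of_sum_range_le hnn hpart
  have hle : ∑' k, tc U A k * A ^ k ≤ 1 := hs.tsum_le_of_sum_range_le hpart
  have hge : 1 ≤ ∑' k, tc U A k * A ^ k := by
    refine le_of_tendsto hlim ?_
    filter_upwards [hev] with x hx
    refine hasSum_le (fun k => ?_) (taylor_hasSum h hx.1 hx.2) hs.hasSum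
    have a2 : 0 < A - x := by linarith [hx.2]
    have := tc_nonneg h hA k
    have := hx.1
    gcongr
    linarith
  rw [← le_antisymm hle hge]
  exact hs.hasSum

lemma exp_pow_close {h : ℝ} (h0 : 0 ≤ h) (h1 : h ≤ 1) (j : ℕ) :
    0 ≤ Real.exp (-h) ^ j - (1 - h) ^ j ∧ Real.exp (-h) ^ j - (1 - h) ^ j ≤ h := by
  have hq : 1 - h ≤ Real.exp (-h) := by linarith [Real.add_one_le_exp (-h)]
  have hr : 0 ≤ 1 - h := by linarith
  refine ⟨sub_nonneg.2 (by gcongr), ?_⟩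
  have hq2 : Real.exp (-h) - (1 - h) ≤ h ^ 2 := by
    have := Real.abs_exp_sub_one_sub_id_le (x := -h) (by rw [abs_neg, abs_of_nonneg h0]; exact h1)
    have := le_abs_self (Real.exp (-h) - 1 - -h)
    nlinarith
  have hq1 : Real.exp (-h) ≤ 1 := by rw [Real.exp_le_one_iff]; linarith
  induction j with
  | zero => simpa using h0
  | succ j ih =>
    have e : Real.exp (-h) ^ (j + 1) - (1 - h) ^ (j + 1) =
      (1 - h) * (Real.exp (-h) ^ j - (1 - h) ^ j) + (Real.exp (-h) - (1 - h)) * Real.exp (-h) ^ j := by ring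
    rw [e]
    have hp : Real.exp (-h) ^ j ≤ 1 := pow_le_one₀ (Real.exp_pos _).le hq1
    have hp0 : 0 ≤ Real.exp (-h) ^ j := by positivity
    calc _ ≤ (1 - h) * h + h ^ 2 * 1 := by gcongr
      _ = h := by ring

/-- The approximating measures. -/
lemma approx {U : ℝ → ℝ} (hc : ContinuousOn U (Ici 0)) (h0 : U 0 = 1)
    (h : CompletelyMonotonicOn U (Ioi 0)) {A : ℝ} (hA : 0 < A) :
    ∃ κ : ProbabilityMeasure (Icc (0 : ℝ) 1), ∀ x, 0 < x → x < A →
      |∫ s, (s : ℝ) ^ x ∂(κ : Measure (Icc (0 : ℝ) 1)) - U x| ≤ x / A := by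
  have hs := tc_hasSum_one hc h0 h hA
  have hnn : ∀ k, 0 ≤ tc U A k * A ^ k := fun k => mul_nonneg (tc_nonneg h hA k) (by positivity)
  let P : PMF ℕ := ⟨fun k => ENNReal.ofReal (tc U A k * A ^ k), by
    have := ENNReal.ofReal_tsum_of_nonneg hnn hs.summable
    rw [hs.tsum_eq, ENNReal.ofReal_one] at this
    rw [this]
    exact ENNReal.summable.hasSum⟩
  have hP : ∀ k, (P k).toReal = tc U A k * A ^ k := fun k => ENNReal.toReal_ofReal (hnn k)
  let q : ℕ → Icc (0 : ℝ) 1 := fun k => ⟨Real.exp (-(k / A)), (Real.exp_pos _).le, by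
    rw [Real.exp_le_one_iff]; have : 0 ≤ (k : ℝ) / A := by positivity
    linarith⟩
  have hqm : Measurable q := measurable_from_nat
  refine ⟨⟨P.toMeasure.map q, Measure.isProbabilityMeasure_map hqm.aemeasurable⟩, ?_⟩
  intro x hx hxA
  have hxc : Continuous fun s : Icc (0 : ℝ) 1 => (s : ℝ) ^ x :=
    (Real.continuous_rpow_const hx.le).comp continuous_subtype_val
  have hqx : ∀ k, ((q k : ℝ)) ^ x = Real.exp (-(x / A)) ^ k := by
    intro k
    rw [← Real.exp_mul, ← Real.exp_nat_mul]
    congr 1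
    ring
  have hx1 : x / A ≤ 1 := by rw [div_le_one hA]; exact hxA.le
  have hx0 : 0 ≤ x / A := by positivity
  have hE1 : Real.exp (-(x / A)) ≤ 1 := by rw [Real.exp_le_one_iff]; linarith
  have hIntg : ∫ s, (s : ℝ) ^ x ∂(P.toMeasure.map q) = ∑' k, (tc U A k * A ^ k) * Real.exp (-(x / A)) ^ k := by
    rw [integral_map hqm.aemeasurable hxc.aestronglyMeasurable]
    rw [PMF.integral_eq_tsum]
    · simp only [hP, hqx, smul_eq_mul]
    · refine (integrable_const (1 : ℝ)).mono' (measurable_from_nat).aestronglyMeasurable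
        (Filter.Eventually.of_forall fun k => ?_)
      rw [hqx, Real.norm_of_nonneg (by positivity)]
      exact pow_le_one₀ (Real.exp_pos _).le hE1
  have hU : HasSum (fun k => (tc U A k * A ^ k) * (1 - x / A) ^ k) (U x) := by
    refine (taylor_hasSum h hx hxA).congr_fun ?_
    intro k
    rw [mul_assoc, ← mul_pow]
    congr 2
    field_simp
  have hsE : Summable fun k => (tc U A k * A ^ k) * Real.exp (-(x / A)) ^ k :=
    hs.summable.of_nonneg_of_le (fun k => mul_nonneg (hnn k) (by positivity))
      (fun k => mul_le_of_le_one_right (hnn k) (pow_le_one₀ (Real.exp_pos _).le hE1))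
  have hd := hsE.hasSum.sub hU
  change |∫ s, (s : ℝ) ^ x ∂(P.toMeasure.map q) - U x| ≤ x / A
  rw [hIntg, abs_le]
  constructor
  · have : 0 ≤ ∑' k, (tc U A k * A ^ k) * Real.exp (-(x / A)) ^ k - U x := by
      refine hd.nonneg fun k => ?_
      rw [← mul_sub]
      exact mul_nonneg (hnn k) (exp_pow_close hx0 hx1 k).1
    linarith
  · have h3 := hs.mul_right (x / A)
    rw [one_mul] at h3
    refine hasSum_le (fun k => ?_) hd h3
    rw [← mul_sub]
    exact mul_le_mul_of_nonneg_left (exp_pow_close hx0 hx1 k).2 (hnn k)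

lemma bernstein_Icc {U : ℝ → ℝ} (hc : ContinuousOn U (Ici 0)) (h0 : U 0 = 1)
    (h : CompletelyMonotonicOn U (Ioi 0)) :
    ∃ κ : ProbabilityMeasure (Icc (0 : ℝ) 1), ∀ x, 0 < x → 
      U x = ∫ s, (s : ℝ) ^ x ∂(κ : Measure (Icc (0 : ℝ) 1)) := by
  choose κ hκ using fun n : ℕ => approx hc h0 h (show (0 : ℝ) < n + 1 by positivity)
  have hle := Ultrafilter.le_nhds_lim ((Filter.hyperfilter ℕ).map κ)
  set κ' := ((Filter.hyperfilter ℕ).map κ).lim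
  refine ⟨κ', fun x hx => ?_⟩
  have ht : Filter.Tendsto κ (Filter.hyperfilter ℕ : Filter ℕ) (nhds κ') := hle
  rw [ProbabilityMeasure.tendsto_iff_forall_integral_tendsto] at ht
  have hxc : Continuous fun s : Icc (0 : ℝ) 1 => (s : ℝ) ^ x :=
    (Real.continuous_rpow_const hx.le).comp continuous_subtype_val
  have h1 := ht (BoundedContinuousFunction.mkOfCompact ⟨_, hxc⟩)
  simp only [BoundedContinuousFunction.mkOfCompact_apply, ContinuousMap.coe_mk] at h1
  have h2 : Filter.Tendsto (fun n : ℕ => ∫ s, (s : ℝ) ^ x ∂(κ n : Measure (Icc (0 : ℝ) 1))) Filter.atTop (nhds (U x)) := by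
    rw [tendsto_iff_norm_sub_tendsto_zero]
    have h3 : Filter.Tendsto (fun n : ℕ => x / ((n : ℝ) + 1)) Filter.atTop (nhds 0) := by
      have := (tendsto_one_div_add_atTop_nhds_zero_nat (𝕜 := ℝ)).const_mul x
      simpa [div_eq_mul_inv] using this
    refine squeeze_zero' (Filter.Eventually.of_forall fun n => norm_nonneg _) ?_ h3
    filter_upwards [Filter.eventually_ge_atTop ⌈x⌉₊] with n hn
    refine hκ n x hx ?_
    have := Nat.ceil_le.1 hn
    linarith
  refine tendsto_nhds_unique (h2.mono_left ?_) h1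
  have := Filter.hyperfilter_le_cofinite (α := ℕ)
  rwa [Nat.cofinite_eq_atTop] at this

lemma bernstein_laplace {U : ℝ → ℝ} (hc : ContinuousOn U (Ici 0)) (h0 : U 0 = 1)
    (h : CompletelyMonotonicOn U (Ioi 0)) :
    ∃ ν : Measure ℝ, IsProbabilityMeasure ν ∧ ∀ y, 0 < y → U y = ∫ s, Real.exp (-y * |s|) ∂ν := by
  obtain ⟨κ, hκ⟩ := bernstein_Icc hc h0 h
  have hlog : Measurable fun s : Icc (0 : ℝ) 1 => Real.log (s : ℝ) :=
    Real.measurable_log.comp measurable_subtype_coe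
  have hpos : ∀ᵐ s : Icc (0 : ℝ) 1 ∂(κ : Measure (Icc (0 : ℝ) 1)), 0 < (s : ℝ) := by
    have hlim : Filter.Tendsto U (nhdsWithin 0 (Ioi 0)) (nhds 1) := by
      rw [← h0]
      exact (hc 0 self_mem_Ici).mono_left (nhdsWithin_mono _ Ioi_subset_Ici_self)
    have hS : MeasurableSet {s : Icc (0 : ℝ) 1 | 0 < (s : ℝ)} := measurableSet_lt measurable_const measurable_subtype_coe
    have hle : ∀ x, 0 < x → U x ≤ (κ : Measure (Icc (0 : ℝ) 1)).real {s : Icc (0 : ℝ) 1 | 0 < (s : ℝ)} := by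
      intro x hx
      have hxc : Continuous fun s : Icc (0 : ℝ) 1 => (s : ℝ) ^ x :=
        (Real.continuous_rpow_const hx.le).comp continuous_subtype_val
      rw [hκ x hx, ← integral_indicator_one hS]
      refine integral_mono_of_nonneg (Filter.Eventually.of_forall fun s => Real.rpow_nonneg s.2.1 _)
        ((integrable_const (1 : ℝ)).indicator hS) (Filter.Eventually.of_forall fun s => ?_)
      by_cases hs : 0 < (s : ℝ)
      · rw [indicator_of_mem (show s ∈ {s : Icc (0 : ℝ) 1 | 0 < (s : ℝ)} from hs)]
        exact Real.rpow_le_one s.2.1 s.2.2 hx.le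
      · have : (s : ℝ) = 0 := le_antisymm (not_lt.1 hs) s.2.1
        rw [indicator_of_notMem (show s ∉ {s : Icc (0 : ℝ) 1 | 0 < (s : ℝ)} from hs)]
        simp [this, Real.zero_rpow hx.ne']
    have h1 : 1 ≤ (κ : Measure (Icc (0 : ℝ) 1)).real {s : Icc (0 : ℝ) 1 | 0 < (s : ℝ)} := by
      refine le_of_tendsto hlim ?_
      filter_upwards [self_mem_nhdsWithin] with x hx using hle x hx
    have h2 : (κ : Measure (Icc (0 : ℝ) 1)) {s : Icc (0 : ℝ) 1 | 0 < (s : ℝ)} = 1 := by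
      have h3 := le_antisymm measureReal_le_one h1
      rw [measureReal_def] at h3
      exact (ENNReal.toReal_eq_one_iff _).1 h3
    exact (prob_compl_eq_zero_iff hS).2 h2
  refine ⟨(κ : Measure (Icc (0 : ℝ) 1)).map (fun s : Icc (0 : ℝ) 1 => Real.log (s : ℝ)),
    Measure.isProbabilityMeasure_map hlog.aemeasurable, fun y hy => ?_⟩
  rw [hκ y hy, integral_map hlog.aemeasurable (by fun_prop)]
  refine integral_congr_ae ?_
  filter_upwards [hpos] with s hs
  rw [abs_of_nonpos (Real.log_nonpos s.2.1 s.2.2), Real.rpow_def_of_pos hs]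
  congr 1
  ring

lemma backward (φ : ℝ → ℝ) (hc : Continuous φ) (hb : ∃ M : ℝ, ∀ x : ℝ, |φ x| ≤ M)
    (heven : ∀ x : ℝ, φ (-x) = φ x) (h0 : φ 0 = 1)
    (U : ℝ → ℝ) (hU : ∀ y : ℝ, U y = if y = 0 then φ 0 else poissonExtR φ 0 y)
    (hcU : ContinuousOn U (Ici 0)) (hcm : CompletelyMonotonicOn U (Ioi 0)) : IsCharFunR φ := by
  obtain ⟨ν, hν, hν2⟩ := bernstein_laplace hcU (by simp [hU, h0]) hcm
  obtain ⟨M, hM⟩ := hb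
  set ψ : ℝ → ℝ := fun t => ∫ s, Real.cos (t * s) ∂ν with hψ
  have hψ1 : ∀ t, |ψ t| ≤ 1 := by
    intro t
    rw [← Real.norm_eq_abs]
    refine (norm_integral_le_of_norm_le (integrable_const (1 : ℝ))
      (Filter.Eventually.of_forall fun s => ?_)).trans (by simp)
    exact Real.abs_cos_le_one _
  have hψc : Continuous ψ := by
    apply continuous_of_dominated (bound := fun _ => 1)
    · intro t
      apply Continuous.aestronglyMeasurable
      fun_prop
    · exact fun t => Filter.Eventually.of_forall fun s => Real.abs_cos_le_one _
    · exact integrable_const _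
    · exact Filter.Eventually.of_forall fun s => by fun_prop
  have hIntg : ∀ (f : ℝ → ℝ) (K : ℝ), Continuous f → (∀ x, |f x| ≤ K) → ∀ y : ℝ, 0 < y →
      Integrable (fun t : ℝ => y / (t ^ 2 + y ^ 2) * f t) := by
    intro f K hf hK y hy
    exact (integrable_pk hy).mul_bdd hf.aestronglyMeasurable (Filter.Eventually.of_forall hK)
  have hz : ∀ x, φ x - ψ x = 0 := by
    refine uniq (g := fun x => φ x - ψ x) (hc.sub hψc) (M := M + 1) (fun x => ?_) (fun x => ?_) ?_
    · exact (abs_sub _ _).trans (add_le_add (hM x) (hψ1 x))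
    · simp only [heven, hψ, neg_mul, Real.cos_neg]
    · intro y hy
      have h1 : poissonExtR φ 0 y = poissonExtR ψ 0 y := by
        rw [hψ, poisson_mix ν hy, ← hν2 y hy, hU, if_neg hy.ne']
      simp only [poissonExtR, zero_sub, neg_sq] at h1
      have h2 := mul_left_cancel₀ (by have := Real.pi_pos; positivity) h1
      simp only [mul_sub]
      rw [integral_sub (hIntg φ M hc hM y hy) (hIntg ψ 1 hψc hψ1 y hy), h2, sub_self]
  have hmn : Measurable (fun t : ℝ => -t) := measurable_neg
  have hν' : IsProbabilityMeasure (ν.map (fun t : ℝ => -t)) :=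
    Measure.isProbabilityMeasure_map hmn.aemeasurable
  refine ⟨(2⁻¹ : ENNReal) • (ν + ν.map (fun t : ℝ => -t)), ⟨?_⟩, fun x => ?_⟩
  · simp only [Measure.smul_apply, Measure.add_apply, measure_univ, smul_eq_mul]
    rw [one_add_one_eq_two]
    exact ENNReal.inv_mul_cancel (by simp) (by simp)
  · have hI : ∀ (μ : Measure ℝ) [IsProbabilityMeasure μ] (x : ℝ),
        Integrable (fun t : ℝ => cexp (I * x * t)) μ := by
      intro μ _ x
      refine (integrable_const (1 : ℝ)).mono' (by fun_prop) (Filter.Eventually.of_forall fun s => ?_)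
      rw [show I * (x : ℂ) * s = ((x * s : ℝ) : ℂ) * I by push_cast; ring, norm_exp_ofReal_mul_I]
    rw [integral_smul_measure, integral_add_measure (hI ν x) (hI _ x),
      integral_map hmn.aemeasurable (by fun_prop)]
    have hI2 : Integrable (fun t : ℝ => cexp (I * x * ((-t : ℝ) : ℂ))) ν := by
      simpa using hI ν (-x)
    rw [← integral_add (hI ν x) hI2]
    have e : (fun t : ℝ => cexp (I * x * t) + cexp (I * x * ((-t : ℝ) : ℂ))) =
        fun t : ℝ => ((2 * Real.cos (x * t) : ℝ) : ℂ) := by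
      ext t
      push_cast
      rw [Complex.two_cos]
      congr 2 <;> ring
    rw [e, integral_complex_ofReal, integral_const_mul, sub_eq_zero.1 (hz x)]
    simp [hψ]

/-- Theorem 1 (Novak): a bounded continuous even `φ : ℝ → ℝ` with `φ 0 = 1` is a
characteristic function iff `y ↦ u_φ(0,y)` (extended by `φ 0` at `y = 0`) is completely
monotonic on `[0,∞)`, i.e. continuous on `[0,∞)` and completely monotonic on `(0,∞)`. -/
theorem stmt_2 (φ : ℝ → ℝ) (hc : Continuous φ) (hb : ∃ M : ℝ, ∀ x : ℝ, |φ x| ≤ M)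
    (heven : ∀ x : ℝ, φ (-x) = φ x) (h0 : φ 0 = 1)
    (U : ℝ → ℝ) (hU : ∀ y : ℝ, U y = if y = 0 then φ 0 else poissonExtR φ 0 y) :
    IsCharFunR φ ↔ (ContinuousOn U (Ici 0) ∧ CompletelyMonotonicOn U (Ioi 0)) := by
  exact ⟨fun h => forward φ U hU h, fun h => backward φ hc hb heven h0 U hU h.1 h.2⟩
end

section
/- Let f : ℝ → ℂ be a bounded continuous characteristic function satisfying ∫ℝ |f(t)|/(1 + |t|) dt < ∞, and let k_f denote its Cauchy transform. Then the function y ↦ k_f(iy) is real-valued and completely monotonic on (0, ∞). -/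
open MeasureTheory Complex Set
open scoped ENNReal ComplexOrder

open Filter Topology in
lemma aux_bound (a : ℝ) (ha : 0 < a) (n : ℕ) (y : ℝ) (hy : a ≤ y) (x : ℝ) (w : ℂ) :
    ‖w / ((y : ℂ) + I * x) ^ (n + 1)‖ ≤ (a ^ n * (min a 1 / 2))⁻¹ * (‖w‖ / (1 + |x|)) := by
  have h1 : a ≤ ‖(y : ℂ) + I * x‖ := by
    have := Complex.abs_re_le_norm ((y : ℂ) + I * x)
    simp at this
    exact hy.trans ((le_abs_self y).trans this)
  have h2 : |x| ≤ ‖(y : ℂ) + I * x‖ := by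
    have := Complex.abs_im_le_norm ((y : ℂ) + I * x)
    simpa using this
  have h3 : min a 1 / 2 * (1 + |x|) ≤ ‖(y : ℂ) + I * x‖ := by
    have := min_le_left a 1
    have := min_le_right a 1
    nlinarith [abs_nonneg x]
  have hm : 0 < min a 1 := lt_min ha one_pos
  have hx : 0 < 1 + |x| := by positivity
  rw [norm_div, norm_pow, pow_succ]
  have : a ^ n * (min a 1 / 2 * (1 + |x|)) ≤
      ‖(y : ℂ) + I * x‖ ^ n * ‖(y : ℂ) + I * x‖ := by gcongr
  calc _ ≤ ‖w‖ / (a ^ n * (min a 1 / 2 * (1 + |x|))) := by gcongr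
    _ = _ := by field_simp

lemma aux_ne (y : ℝ) (hy : 0 < y) (x : ℝ) : (y : ℂ) + I * x ≠ 0 := by
  intro h
  have := congrArg Complex.re h
  simp at this
  exact hy.ne' this

lemma aux_cont (y : ℝ) (hy : 0 < y) (n : ℕ) (f : ℝ → ℂ) (hc : Continuous f) :
    Continuous (fun x : ℝ => f x / ((y : ℂ) + I * x) ^ (n + 1)) :=
  hc.div (by fun_prop) (fun x => pow_ne_zero _ (aux_ne y hy x))

noncomputable def auxG (f : ℝ → ℂ) (n : ℕ) (y : ℝ) : ℂ :=
  ∫ x : ℝ, f x / ((y : ℂ) + I * x) ^ (n + 1)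

lemma aux_integrable (f : ℝ → ℂ) (hc : Continuous f)
    (hint : Integrable (fun t : ℝ => ‖f t‖ / (1 + |t|))) (n : ℕ) (y : ℝ) (hy : 0 < y) :
    Integrable (fun x : ℝ => f x / ((y : ℂ) + I * x) ^ (n + 1)) :=
  (hint.const_mul _).mono' (aux_cont y hy n f hc).aestronglyMeasurable
    (ae_of_all _ fun x => aux_bound y hy n y le_rfl x (f x))

lemma aux_deriv (f : ℝ → ℂ) (hc : Continuous f)
    (hint : Integrable (fun t : ℝ => ‖f t‖ / (1 + |t|))) (n : ℕ) (y : ℝ) (hy : 0 < y) :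
    HasDerivAt (auxG f n) (-(n + 1) * auxG f (n + 1) y) y := by
  have hy2 : 0 < y / 2 := by positivity
  have key := hasDerivAt_integral_of_dominated_loc_of_deriv_le (μ := (volume : Measure ℝ))
    (F := fun (y : ℝ) (x : ℝ) => f x / ((y : ℂ) + I * x) ^ (n + 1))
    (F' := fun (y : ℝ) (x : ℝ) => (-(n + 1) : ℂ) * (f x / ((y : ℂ) + I * x) ^ (n + 1 + 1)))
    (x₀ := y) (s := Ioi (y / 2))
    (bound := fun x => ‖(-(n + 1) : ℂ)‖ *
      (((y / 2) ^ (n + 1) * (min (y / 2) 1 / 2))⁻¹ * (‖f x‖ / (1 + |x|))))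
    (Ioi_mem_nhds (by linarith))
    (Filter.mem_of_superset (Ioi_mem_nhds hy) fun z hz => (aux_cont z hz n f hc).aestronglyMeasurable)
    (aux_integrable f hc hint n y hy)
    ((aux_cont y hy (n + 1) f hc).aestronglyMeasurable.const_mul _)
    (ae_of_all _ fun x z hz => by
      rw [norm_mul]
      gcongr
      exact aux_bound (y / 2) hy2 (n + 1) z (le_of_lt hz) x (f x))
    ((hint.const_mul _).const_mul _)
    (ae_of_all _ fun x z hz => by
      have hz0 : 0 < z := hy2.trans hz
      have h1 : HasDerivAt (fun z : ℝ => (z : ℂ) + I * x) 1 z :=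
        (Complex.ofRealCLM.hasDerivAt (x := z)).add_const _ 
      have h2 := (hasDerivAt_const z (f x)).div (h1.pow (n + 1))
        (pow_ne_zero _ (aux_ne z hz0 x))
      refine h2.congr_deriv ?_
      have := aux_ne z hz0 x
      simp
      field_simp
      ring)
  have h := key.2
  rw [integral_const_mul] at h
  exact h

lemma aux_phi (f : ℝ → ℂ) (hchar : IsCharFun f) (ε : ℝ) (hε : 0 < ε) (s : ℝ) :
    0 ≤ ∫ x : ℝ, f x * (Real.exp (-ε * x ^ 2) : ℂ) * cexp (-(I * s * x)) := by
  obtain ⟨σ, hσ, hf⟩ := hchar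
  have hI : Integrable (fun p : ℝ × ℝ => cexp (I * p.1 * p.2) * cexp (-(I * s * p.1)) *
      ((Real.exp (-ε * p.1 ^ 2) : ℂ) * 1)) ((volume : Measure ℝ).prod σ) := by
    refine Integrable.bdd_mul (c := 1)
      (((integrable_exp_neg_mul_sq hε).ofReal (𝕜 := ℂ)).mul_prod (integrable_const (1 : ℂ)))
      (Continuous.aestronglyMeasurable (by fun_prop)) (ae_of_all _ fun p => ?_)
    rw [norm_mul, Complex.norm_exp, Complex.norm_exp]
    simp
  have h1 : ∫ x : ℝ, f x * (Real.exp (-ε * x ^ 2) : ℂ) * cexp (-(I * s * x)) =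
      ∫ x : ℝ, ∫ t : ℝ, cexp (I * x * t) * cexp (-(I * s * x)) *
      ((Real.exp (-ε * x ^ 2) : ℂ) * 1) ∂σ := by
    congr 1
    ext x
    rw [hf x, integral_mul_const, integral_mul_const]
    ring
  rw [h1, integral_integral_swap hI]
  apply integral_nonneg
  intro t
  have h2 : ∫ x : ℝ, cexp (I * x * t) * cexp (-(I * s * x)) * ((Real.exp (-ε * x ^ 2) : ℂ) * 1)
      = ∫ x : ℝ, cexp (I * ((t - s : ℝ) : ℂ) * x) * cexp (-(ε : ℂ) * x ^ 2) := by
    congr 1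
    ext x
    push_cast
    rw [mul_one, ← Complex.exp_add]
    congr 2
    ring
  show 0 ≤ ∫ x : ℝ, cexp (I * x * t) * cexp (-(I * s * x)) * ((Real.exp (-ε * x ^ 2) : ℂ) * 1)
  rw [h2, fourierIntegral_gaussian (by simpa using hε)]
  have h3 : ((Real.pi : ℂ) / (ε : ℂ)) ^ (1 / 2 : ℂ) * cexp (-((t - s : ℝ) : ℂ) ^ 2 / (4 * ε)) =
      (((Real.pi / ε) ^ (1 / 2 : ℝ) * Real.exp (-(t - s) ^ 2 / (4 * ε)) : ℝ) : ℂ) := by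
    rw [Complex.ofReal_mul, Complex.ofReal_cpow (by positivity)]
    push_cast
    rfl
  rw [h3, Complex.zero_le_real]
  positivity

lemma aux_gamma_int (n : ℕ) (r : ℂ) (hr : 0 < r.re) :
    IntegrableOn (fun s : ℝ => (s : ℂ) ^ n * cexp (-(r * s))) (Ioi 0) := by
  have := integrableOn_rpow_mul_exp_neg_mul_rpow (s := n) (p := 1) (b := r.re)
    (by have : (0 : ℝ) ≤ n := n.cast_nonneg
        linarith) one_pos hr
  simp only [Real.rpow_natCast, Real.rpow_one] at this
  refine Integrable.mono' this (Continuous.aestronglyMeasurable (by fun_prop)) ?_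
  filter_upwards [ae_restrict_mem measurableSet_Ioi] with s hs
  have hs : 0 < s := hs
  rw [norm_mul, norm_pow, Complex.norm_exp, Complex.norm_real, Real.norm_of_nonneg hs.le]
  simp

open Filter Topology in
lemma aux_gamma (n : ℕ) (r : ℂ) (hr : 0 < r.re) :
    ∫ s in Ioi (0 : ℝ), ((s : ℂ) ^ n * cexp (-(r * s))) = n.factorial / r ^ (n + 1) := by
  have hr0 : r ≠ 0 := by
    rintro rfl
    simp at hr
  induction n with
  | zero =>
    have := integral_exp_mul_complex_Ioi (a := -r) (by simpa using hr) 0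
    simpa [neg_mul] using this
  | succ n ih =>
    have hd : ∀ s ∈ Ici (0 : ℝ), HasDerivAt (fun s : ℝ => -((s : ℂ) ^ (n + 1) * cexp (-(r * s))) / r)
        ((s : ℂ) ^ (n + 1) * cexp (-(r * s)) - (n + 1) / r * ((s : ℂ) ^ n * cexp (-(r * s)))) s := by
      intro s _
      have h0 : HasDerivAt (fun s : ℝ => (s : ℂ)) 1 s := Complex.ofRealCLM.hasDerivAt (x := s)
      have h1 := (((h0.pow (n + 1)).mul ((h0.const_mul r).neg.cexp)).neg).div_const r
      refine h1.congr_deriv ?_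
      simp
      field_simp
      ring
    have ht : Tendsto (fun s : ℝ => -((s : ℂ) ^ (n + 1) * cexp (-(r * s))) / r) atTop (𝓝 0) := by
      have h1 : Tendsto (fun s : ℝ => (s : ℂ) ^ (n + 1) * cexp (-(r * s))) atTop (𝓝 0) := by
        rw [tendsto_zero_iff_norm_tendsto_zero]
        refine (tendsto_rpow_mul_exp_neg_mul_atTop_nhds_zero (n + 1 : ℕ) r.re hr).congr' ?_
        filter_upwards [eventually_ge_atTop 0] with s hs
        rw [norm_mul, norm_pow, Complex.norm_exp, Complex.norm_real, Real.norm_of_nonneg hs,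
          Real.rpow_natCast]
        simp
      simpa using h1.neg.div_const r
    have hi := aux_gamma_int (n + 1) r hr
    have hi2 := (aux_gamma_int n r hr).const_mul ((n + 1 : ℂ) / r)
    have h := integral_Ioi_of_hasDerivAt_of_tendsto' hd (hi.sub hi2) ht
    rw [integral_sub hi hi2, integral_const_mul, ih] at h
    simp at h
    rw [sub_eq_zero.1 h, Nat.factorial_succ]
    push_cast
    field_simp
    ring

lemma aux_reg (f : ℝ → ℂ) (hc : Continuous f) (hb : ∃ M : ℝ, ∀ x : ℝ, ‖f x‖ ≤ M)
    (hchar : IsCharFun f) (ε : ℝ) (hε : 0 < ε) (n : ℕ) (y : ℝ) (hy : 0 < y) :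
    0 ≤ ∫ x : ℝ, (Real.exp (-ε * x ^ 2) : ℂ) * (f x / ((y : ℂ) + I * x) ^ (n + 1)) := by
  obtain ⟨M, hM⟩ := hb
  have hJ : IntegrableOn (fun s : ℝ => ((s ^ n * Real.exp (-y * s) : ℝ) : ℂ)) (Ioi 0) := by
    have := integrableOn_rpow_mul_exp_neg_mul_rpow (s := n) (p := 1) (b := y)
      (by have : (0 : ℝ) ≤ n := n.cast_nonneg
          linarith) one_pos hy
    simp only [Real.rpow_natCast, Real.rpow_one] at this
    exact this.ofReal
  have hI : Integrable (fun p : ℝ × ℝ => (f p.1 * cexp (-(I * p.2 * p.1))) *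
      ((Real.exp (-ε * p.1 ^ 2) : ℂ) * ((p.2 ^ n * Real.exp (-y * p.2) : ℝ) : ℂ)))
      ((volume : Measure ℝ).prod (volume.restrict (Ioi 0))) := by
    refine Integrable.bdd_mul (c := M)
      (((integrable_exp_neg_mul_sq hε).ofReal (𝕜 := ℂ)).mul_prod hJ)
      (Continuous.aestronglyMeasurable (by fun_prop)) (ae_of_all _ fun p => ?_)
    rw [norm_mul, Complex.norm_exp]
    simpa using hM p.1
  have h1 : ∫ x : ℝ, (Real.exp (-ε * x ^ 2) : ℂ) *
      (f x * (n.factorial / ((y : ℂ) + I * x) ^ (n + 1))) =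
      ∫ x : ℝ, ∫ s in Ioi (0 : ℝ), (f x * cexp (-(I * s * x))) *
      ((Real.exp (-ε * x ^ 2) : ℂ) * ((s ^ n * Real.exp (-y * s) : ℝ) : ℂ)) := by
    congr 1
    ext x
    rw [← aux_gamma n _ (by simpa using hy), ← integral_const_mul, ← integral_const_mul]
    congr 1
    ext s
    rw [show -(((y : ℂ) + I * x) * s) = -(I * s * x) + (-y * s) by ring, Complex.exp_add]
    push_cast
    ring
  have h2 : 0 ≤ ∫ x : ℝ, (Real.exp (-ε * x ^ 2) : ℂ) *
      (f x * (n.factorial / ((y : ℂ) + I * x) ^ (n + 1))) := by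
    rw [h1, integral_integral_swap hI]
    apply integral_nonneg_of_ae
    filter_upwards [ae_restrict_mem measurableSet_Ioi] with s hs
    have h3 : ∫ x : ℝ, (f x * cexp (-(I * s * x))) *
      ((Real.exp (-ε * x ^ 2) : ℂ) * ((s ^ n * Real.exp (-y * s) : ℝ) : ℂ)) =
      (∫ x : ℝ, f x * (Real.exp (-ε * x ^ 2) : ℂ) * cexp (-(I * s * x))) *
        ((s ^ n * Real.exp (-y * s) : ℝ) : ℂ) := by
      rw [← integral_mul_const]
      congr 1
      ext x
      ring
    show 0 ≤ ∫ x : ℝ, (f x * cexp (-(I * s * x))) *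
      ((Real.exp (-ε * x ^ 2) : ℂ) * ((s ^ n * Real.exp (-y * s) : ℝ) : ℂ))
    rw [h3]
    refine mul_nonneg (aux_phi f hchar ε hε s) ?_
    rw [Complex.zero_le_real]
    have : 0 < s := hs
    positivity
  have h4 : ∫ x : ℝ, (Real.exp (-ε * x ^ 2) : ℂ) * (f x / ((y : ℂ) + I * x) ^ (n + 1)) =
      (((n.factorial : ℝ)⁻¹ : ℝ) : ℂ) * ∫ x : ℝ, (Real.exp (-ε * x ^ 2) : ℂ) *
      (f x * (n.factorial / ((y : ℂ) + I * x) ^ (n + 1))) := by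
    rw [← integral_const_mul]
    congr 1
    ext x
    have := aux_ne y hy x
    have h5 : (n.factorial : ℂ) ≠ 0 := by exact_mod_cast n.factorial_ne_zero
    push_cast
    field_simp
  rw [h4]
  refine mul_nonneg ?_ h2
  rw [Complex.zero_le_real]
  positivity

open Filter Topology in
lemma aux_nonneg (f : ℝ → ℂ) (hc : Continuous f) (hb : ∃ M : ℝ, ∀ x : ℝ, ‖f x‖ ≤ M)
    (hchar : IsCharFun f) (hint : Integrable (fun t : ℝ => ‖f t‖ / (1 + |t|)))
    (n : ℕ) (y : ℝ) (hy : 0 < y) : 0 ≤ auxG f n y := by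
  have hlim : Tendsto (fun k : ℕ => ∫ x : ℝ, (Real.exp (-(1 / ((k : ℝ) + 1)) * x ^ 2) : ℂ) *
      (f x / ((y : ℂ) + I * x) ^ (n + 1))) atTop (𝓝 (auxG f n y)) := by
    have hi := aux_integrable f hc hint n y hy
    refine tendsto_integral_of_dominated_convergence
      (fun x => ‖f x / ((y : ℂ) + I * x) ^ (n + 1)‖) (fun k => ?_) hi.norm
      (fun k => ae_of_all _ fun x => ?_) (ae_of_all _ fun x => ?_)
    · exact (Continuous.mul (by fun_prop) (aux_cont y hy n f hc)).aestronglyMeasurable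
    · rw [norm_mul, Complex.norm_real, Real.norm_of_nonneg (Real.exp_pos _).le]
      refine mul_le_of_le_one_left (norm_nonneg _) (Real.exp_le_one_iff.2 ?_)
      have : 0 ≤ 1 / ((k : ℝ) + 1) * x ^ 2 := by positivity
      linarith
    · have h1 : Tendsto (fun k : ℕ => Real.exp (-(1 / ((k : ℝ) + 1)) * x ^ 2)) atTop (𝓝 1) := by
        have := ((tendsto_one_div_add_atTop_nhds_zero_nat (𝕜 := ℝ)).neg.mul_const (x ^ 2))
        have := (Real.continuous_exp.tendsto _).comp this
        simpa [Function.comp_def] using this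
      have h2 := ((Complex.continuous_ofReal.tendsto _).comp h1).mul_const
        (f x / ((y : ℂ) + I * x) ^ (n + 1))
      simpa [Function.comp_def] using h2
  exact ge_of_tendsto' hlim fun k => aux_reg f hc hb hchar _ (by positivity) n y hy

lemma aux_cauchy (f : ℝ → ℂ) (y : ℝ) :
    cauchyTransform f (I * y) = ((Real.pi⁻¹ : ℝ) : ℂ) * auxG f 0 y := by
  unfold cauchyTransform auxG
  rw [← integral_const_mul, ← integral_const_mul]
  congr 1
  ext x
  have h : I * (y : ℂ) - x = I * (y + I * x) := by
    linear_combination (-(x : ℂ)) * I_sq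
  rw [h, zero_add, pow_one]
  push_cast
  simp only [div_eq_mul_inv, mul_inv]
  linear_combination (Real.pi : ℂ)⁻¹ * f x * ((y : ℂ) + I * x)⁻¹ * mul_inv_cancel₀ I_ne_zero

lemma aux_deriv_re (f : ℝ → ℂ) (hc : Continuous f)
    (hint : Integrable (fun t : ℝ => ‖f t‖ / (1 + |t|))) (n : ℕ) (y : ℝ) (hy : 0 < y) :
    HasDerivAt (fun y => (auxG f n y).re) (-(n + 1) * (auxG f (n + 1) y).re) y := by
  have := Complex.reCLM.hasFDerivAt.comp_hasDerivAt y (aux_deriv f hc hint n y hy)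
  refine this.congr_deriv ?_
  simp

lemma aux_contDiff (f : ℝ → ℂ) (hc : Continuous f)
    (hint : Integrable (fun t : ℝ => ‖f t‖ / (1 + |t|))) (m : ℕ) : ∀ n : ℕ,
    ContDiffOn ℝ m (fun y => (auxG f n y).re) (Ioi 0) := by
  induction m with
  | zero =>
    intro n
    rw [Nat.cast_zero, contDiffOn_zero]
    exact fun y hy => (aux_deriv_re f hc hint n y hy).continuousAt.continuousWithinAt
  | succ m ih =>
    intro n
    rw [Nat.cast_succ, contDiffOn_succ_iff_deriv_of_isOpen isOpen_Ioi]
    refine ⟨fun y hy => (aux_deriv_re f hc hint n y hy).differentiableAt.differentiableWithinAt,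
      by simp, ?_⟩
    refine (contDiffOn_const.mul (ih (n + 1))).congr fun y hy =>
      (aux_deriv_re f hc hint n y hy).deriv

lemma aux_iter (f : ℝ → ℂ) (hc : Continuous f)
    (hint : Integrable (fun t : ℝ => ‖f t‖ / (1 + |t|))) (c : ℝ) (n : ℕ) : ∀ y : ℝ, 0 < y →
    iteratedDeriv n (fun y => c * (auxG f 0 y).re) y =
      c * ((-1) ^ n * n.factorial * (auxG f n y).re) := by
  induction n with
  | zero => intro y hy; simp
  | succ n ih =>
    intro y hy
    rw [iteratedDeriv_succ]
    have : iteratedDeriv n (fun y => c * (auxG f 0 y).re) =ᶠ[nhds y]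
        fun y => c * ((-1) ^ n * n.factorial * (auxG f n y).re) :=
      Filter.mem_of_superset (Ioi_mem_nhds hy) fun z hz => ih z hz
    rw [this.deriv_eq,
      (((aux_deriv_re f hc hint n y hy).const_mul ((-1) ^ n * (n.factorial : ℝ))).const_mul c).deriv,
      Nat.factorial_succ]
    push_cast
    ring

/-- Necessity, upper half-plane part of Theorem 3: if `f` is a bounded continuous
characteristic function satisfying (1.7), then `y ↦ k_f(iy)` is real-valued and
completely monotonic on `(0,∞)`. -/
theorem stmt_3 (f : ℝ → ℂ) (hc : Continuous f) (hb : ∃ M : ℝ, ∀ x : ℝ, ‖f x‖ ≤ M)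
    (hchar : IsCharFun f) (hint : Integrable (fun t : ℝ => ‖f t‖ / (1 + |t|))) :
    (∀ y ∈ Ioi (0 : ℝ), (cauchyTransform f (Complex.I * y)).im = 0) ∧
      CompletelyMonotonicOn (fun y : ℝ => (cauchyTransform f (Complex.I * y)).re) (Ioi 0) := by
  have hnn := aux_nonneg f hc hb hchar hint
  have hre : (fun y : ℝ => (cauchyTransform f (Complex.I * y)).re) =
      fun y => Real.pi⁻¹ * (auxG f 0 y).re := by
    ext y
    rw [aux_cauchy, Complex.re_ofReal_mul]
  refine ⟨fun y hy => ?_, ?_, fun n y hy => ?_⟩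
  · rw [aux_cauchy, Complex.im_ofReal_mul, ← (Complex.le_def.1 (hnn 0 y hy)).2]
    simp
  · rw [hre]
    exact contDiffOn_const.mul (contDiffOn_infty.2 fun m => aux_contDiff f hc hint m 0)
  · rw [hre, aux_iter f hc hint _ n y hy]
    have h := (Complex.le_def.1 (hnn n y hy)).1
    rw [Complex.zero_re] at h
    have h1 : ((-1 : ℝ) ^ n) * (-1) ^ n = 1 := by rw [← mul_pow]; simp
    calc (0 : ℝ) ≤ Real.pi⁻¹ * (n.factorial * (auxG f n y).re) := by positivity
      _ = (((-1 : ℝ) ^ n) * (-1) ^ n) * (Real.pi⁻¹ * (n.factorial * (auxG f n y).re)) := by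
        rw [h1, one_mul]
      _ = _ := by ring
end
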